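/- Let K ⊂ ℝⁿ be a convex body with 0 in its interior, let Φ be an n-dimensional Young function with 0 < Φ(x) < ∞ for every x ≠ 0, and let u ∈ V^{1,Φ}_d(ℝⁿ). Assume that for a.e. t ∈ (ess inf u, ess sup u) there exist s_t ≥ 0, a_t > 0 and x_t ∈ ℝⁿ such that: (a) the set {Φ_• ≤ s_t} has nonempty interior; (b) {u ≥ t} = −a_t{Φ_• ≤ s_t} + x_t up to a set of Lebesgue measure zero; (c) for H^{n−1}-a.e. x ∈ {u = t} there exists ξ with Φ_•(ξ) = s_t and ∇u(x) ∈ ∂Φ_•(ξ); (d) for H^{n−1}-a.e. x ∈ {u^K = t} there exists ξ with Φ_{•K}(ξ) = s_t and ∇u^K(x) ∈ ∂Φ_{•K}(ξ); (e) if s_t > 0 then ∫_{{u=t}} |∇u|^{−1} dH^{n−1} = ∫_{{u^K=t}} |∇u^K|^{−1} dH^{n−1}. Then ∫_{ℝⁿ} Φ_{•K•}(∇u^K) dx = ∫_{ℝⁿ} Φ(∇u) dx. -/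

import Mathlib

open MeasureTheory Filter Set
open scoped ENNReal NNReal Topology Pointwise symmDiff RealInnerProductSpace

noncomputable section

/-- Euclidean space `ℝⁿ`. -/
abbrev Euc (n : ℕ) := EuclideanSpace ℝ (Fin n)

/-- Convexity for `ℝ≥0∞`-valued functions on `ℝⁿ`. -/
def ConvexOnE {n : ℕ} (Φ : Euc n → ℝ≥0∞) : Prop :=
  ∀ x y : Euc n, ∀ a b : ℝ, 0 ≤ a → 0 ≤ b → a + b = 1 →
    Φ (a • x + b • y) ≤ ENNReal.ofReal a * Φ x + ENNReal.ofReal b * Φ y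

/-- Strict convexity for `ℝ≥0∞`-valued functions on `ℝⁿ`. -/
def StrictConvexOnE {n : ℕ} (Φ : Euc n → ℝ≥0∞) : Prop :=
  ∀ x y : Euc n, x ≠ y → ∀ a b : ℝ, 0 < a → 0 < b → a + b = 1 →
    Φ (a • x + b • y) < ENNReal.ofReal a * Φ x + ENNReal.ofReal b * Φ y

/-- An `n`-dimensional Young function: convex, lower semicontinuous, finite near `0`,
vanishing at `0`, tending to `∞` at infinity. -/
structure IsNYoung {n : ℕ} (Φ : Euc n → ℝ≥0∞) : Prop where
  convex : ConvexOnE Φ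
  lsc : LowerSemicontinuous Φ
  finite_near_zero : ∃ ε : ℝ, 0 < ε ∧ ∀ x : Euc n, ‖x‖ < ε → Φ x ≠ ⊤
  map_zero : Φ 0 = 0
  coercive : Tendsto Φ (Bornology.cobounded (Euc n)) (𝓝 ⊤)

/-- A convex body: a compact convex set. -/
def IsConvexBody {n : ℕ} (K : Set (Euc n)) : Prop :=
  IsCompact K ∧ Convex ℝ K

/-- The Young conjugate (Legendre transform) `Φ_•(ξ) = sup_η (⟨ξ,η⟩ - Φ(η))`,
`ℝ≥0∞`-valued (the supremum is nonnegative whenever `Φ 0 = 0`). -/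
def yconj {n : ℕ} (Φ : Euc n → ℝ≥0∞) (ξ : Euc n) : ℝ≥0∞ :=
  ⨆ η : Euc n, ENNReal.ofReal ⟪ξ, η⟫ - Φ η

/-- The subgradient of an `ℝ≥0∞`-valued function. -/
def subgrad {n : ℕ} (Ψ : Euc n → ℝ≥0∞) (ξ : Euc n) : Set (Euc n) :=
  {ζ | ∀ η : Euc n, (Ψ ξ : EReal) + ((⟪ζ, η - ξ⟫ : ℝ) : EReal) ≤ (Ψ η : EReal)}

/-- The support function of a set, real-valued. -/
def suppFnR {n : ℕ} (C : Set (Euc n)) (ξ : Euc n) : ℝ :=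
  sSup ((fun η => ⟪ξ, η⟫) '' C)

/-- The support function of a set, `EReal`-valued. -/
def suppFnE {n : ℕ} (C : Set (Euc n)) (ξ : Euc n) : EReal :=
  ⨆ η ∈ C, ((⟪ξ, η⟫ : ℝ) : EReal)

/-- The polar body `L° = {x : ⟨x,y⟩ ≤ 1 ∀ y ∈ L}`. -/
def polarBody {n : ℕ} (L : Set (Euc n)) : Set (Euc n) :=
  {x | ∀ y ∈ L, ⟪x, y⟫ ≤ 1}

/-- `E^K`: the dilate `cK` of `K` with `|cK| = |E|`. -/
def setSymm {n : ℕ} (K E : Set (Euc n)) : Set (Euc n) :=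
  (((volume E).toReal / (volume K).toReal) ^ ((1 : ℝ) / n)) • K

/-- The distribution function `μ(t) = |{u > t}|`. -/
def distFn {n : ℕ} (u : Euc n → ℝ) (t : ℝ) : ℝ≥0∞ := volume {x | t < u x}

/-- The decreasing rearrangement `u*(s) = inf {t : μ(t) ≤ s}`. -/
def decRearr {n : ℕ} (u : Euc n → ℝ) (s : ℝ) : ℝ :=
  sInf {t : ℝ | distFn u t ≤ ENNReal.ofReal s}

/-- The symmetral `u^K(x) = u*(|K| H₀^K(x)ⁿ)` of `u` with respect to `K`. -/
def funcSymm {n : ℕ} (K : Set (Euc n)) (u : Euc n → ℝ) (x : Euc n) : ℝ :=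
  decRearr u ((volume K).toReal * gauge K x ^ n)

/-- The symmetral `Ψ_K` of an `n`-dimensional Young function `Ψ` with respect to `K`,
characterized by `{Ψ_K ≤ t} = −({Ψ ≤ t}^K)`; equivalently
`Ψ_K(ξ) = inf {t : |K| H₀^K(−ξ)ⁿ ≤ |{Ψ ≤ t}|}`. -/
def youngSymm {n : ℕ} (K : Set (Euc n)) (Ψ : Euc n → ℝ≥0∞) (ξ : Euc n) : ℝ≥0∞ :=
  sInf {t : ℝ≥0∞ | volume K * ENNReal.ofReal (gauge K (-ξ) ^ n) ≤ volume {η | Ψ η ≤ t}}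

/-- The essential infimum of a real function on `ℝⁿ`, valued in `EReal`. -/
def eInf {n : ℕ} (u : Euc n → ℝ) : EReal := essInf (fun x => (u x : EReal)) volume

/-- The essential supremum of a real function on `ℝⁿ`, valued in `EReal`. -/
def eSup {n : ℕ} (u : Euc n → ℝ) : EReal := essSup (fun x => (u x : EReal)) volume

/-- `u ∈ M_d(ℝⁿ)`: measurable with `|{u > t}| < ∞` for all `t > ess inf u`. -/
def MemMd {n : ℕ} (u : Euc n → ℝ) : Prop :=
  Measurable u ∧ ∀ t : ℝ, eInf u < (t : EReal) → distFn u t < ⊤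

/-- `g` is the weak gradient of `u ∈ W^{1,1}_loc(ℝⁿ)`. -/
def HasWeakGradient {n : ℕ} (u : Euc n → ℝ) (g : Euc n → Euc n) : Prop :=
  LocallyIntegrable u volume ∧ LocallyIntegrable g volume ∧
    ∀ φ : Euc n → ℝ, ContDiff ℝ (⊤ : ℕ∞) φ → HasCompactSupport φ →
      ∀ v : Euc n, ∫ x, u x * fderiv ℝ φ x v = - ∫ x, ⟪g x, v⟫ * φ x

/-- `u ∈ V^{1,Φ}_d(ℝⁿ)`, with weak gradient `g` and `∫ Φ(∇u) < ∞`. -/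
def MemV1d {n : ℕ} (Φ : Euc n → ℝ≥0∞) (u : Euc n → ℝ) (g : Euc n → Euc n) : Prop :=
  HasWeakGradient u g ∧ MemMd u ∧ ∫⁻ x, Φ (g x) < ⊤

/-- A one-dimensional Young function (on `[0,∞)`, extended arbitrarily to `ℝ`). -/
structure IsYoung1 (A : ℝ → ℝ≥0∞) : Prop where
  map_zero : A 0 = 0
  convex : ∀ x y : ℝ, 0 ≤ x → 0 ≤ y → ∀ a b : ℝ, 0 ≤ a → 0 ≤ b → a + b = 1 →
    A (a * x + b * y) ≤ ENNReal.ofReal a * A x + ENNReal.ofReal b * A y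
  left_cont : ∀ t : ℝ, 0 < t → Tendsto A (𝓝[<] t) (𝓝 (A t))
  nonconst : ∃ s t : ℝ, 0 < s ∧ 0 < t ∧ A s ≠ A t

/-- The Young conjugate of a one-dimensional Young function. -/
def yconj1 (A : ℝ → ℝ≥0∞) (t : ℝ) : ℝ≥0∞ :=
  ⨆ (s : ℝ) (_ : 0 ≤ s), ENNReal.ofReal (s * t) - A s

/-- The generalized (right-continuous) inverse of a one-dimensional Young function. -/
def rinv (A : ℝ → ℝ≥0∞) (s : ℝ≥0∞) : ℝ :=
  sSup {t : ℝ | 0 ≤ t ∧ A t ≤ s}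

/-- The unit sphere of `ℝⁿ`. -/
abbrev USphere (n : ℕ) := Metric.sphere (0 : Euc n) 1

/-- The surface measure of the unit sphere. -/
abbrev sphMeas (n : ℕ) : Measure (USphere n) := (volume : Measure (Euc n)).toSphere

theorem norm_usphere {n : ℕ} (ω : USphere n) : ‖(ω : Euc n)‖ = 1 := by
  simp

theorem lintegral_volumeIoiPow (k : ℕ) (f : ℝ → ℝ≥0∞) (hf : Measurable f) :
    ∫⁻ r : Ioi (0 : ℝ), f r ∂(Measure.volumeIoiPow k) =
      ∫⁻ r in Ioi (0 : ℝ), f r * ENNReal.ofReal (r ^ k) := by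
  have h := lintegral_withDensity_eq_lintegral_mul (Measure.comap Subtype.val volume)
    (f := fun r : Ioi (0 : ℝ) => ENNReal.ofReal ((r : ℝ) ^ k)) (by fun_prop)
    (g := fun r : Ioi (0 : ℝ) => f r) (hf.comp measurable_subtype_coe)
  rw [Measure.volumeIoiPow, h]
  rw [← lintegral_subtype_comap measurableSet_Ioi (fun r => f r * ENNReal.ofReal (r ^ k))]
  refine lintegral_congr fun r => ?_
  simp [mul_comm]

/-- Integration in polar coordinates. -/
theorem lintegral_polar {n : ℕ} (hn : 1 ≤ n) (F : Euc n → ℝ≥0∞) (hF : Measurable F) :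
    ∫⁻ x, F x = ∫⁻ ω : USphere n, (∫⁻ r in Ioi (0 : ℝ),
      F (r • (ω : Euc n)) * ENNReal.ofReal (r ^ (n - 1))) ∂sphMeas n := by
  have : Nonempty (Fin n) := ⟨⟨0, hn⟩⟩
  have h1 := (Measure.measurePreserving_homeomorphUnitSphereProd (volume : Measure (Euc n)))
  have hme : MeasurableEmbedding (homeomorphUnitSphereProd (Euc n)) :=
    Homeomorph.measurableEmbedding _
  have h2 : ∫⁻ x, F x = ∫⁻ x : ({0}ᶜ : Set (Euc n)), F x.1 ∂(volume.comap Subtype.val) := by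
    rw [lintegral_subtype_comap (measurableSet_singleton _).compl (fun x => F x),
      restrict_compl_singleton]
  have h3 : ∫⁻ x : ({0}ᶜ : Set (Euc n)), F x.1 ∂(volume.comap Subtype.val) =
      ∫⁻ p : USphere n × Ioi (0 : ℝ), F ((p.2 : ℝ) • (p.1 : Euc n))
        ∂((sphMeas n).prod (Measure.volumeIoiPow (Module.finrank ℝ (Euc n) - 1))) := by
    rw [← h1.lintegral_comp_emb hme]
    refine lintegral_congr fun x => ?_
    have := congrArg Subtype.val ((homeomorphUnitSphereProd (Euc n)).symm_apply_apply x)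
    simp only [homeomorphUnitSphereProd_symm_apply_coe] at this
    rw [this]
  rw [h2, h3, lintegral_prod _ (by fun_prop)]
  refine lintegral_congr fun ω => ?_
  rw [lintegral_volumeIoiPow _ (fun r => F (r • (ω : Euc n))) (by fun_prop)]
  simp

theorem ae_ray {n : ℕ} (hn : 1 ≤ n) {P : Euc n → Prop} (h : ∀ᵐ x, P x) :
    ∀ᵐ ω : USphere n ∂sphMeas n, ∀ᵐ r : ℝ, 0 < r → P (r • (ω : Euc n)) := by
  obtain ⟨N, hN, hNm, hN0⟩ := exists_measurable_superset_of_null (ae_iff.1 h)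
  have h1 := lintegral_polar hn (N.indicator 1) (measurable_one.indicator hNm)
  rw [lintegral_indicator_one hNm, hN0] at h1
  have hm : Measurable (fun p : USphere n × ℝ =>
      N.indicator (1 : Euc n → ℝ≥0∞) (p.2 • (p.1 : Euc n)) * ENNReal.ofReal (p.2 ^ (n - 1))) := by
    refine Measurable.mul ((measurable_one.indicator hNm).comp (by fun_prop)) (by fun_prop)
  have h2 := (lintegral_eq_zero_iff (by exact hm.lintegral_prod_right')).1 h1.symm
  filter_upwards [h2] with ω hω
  have h3 := (lintegral_eq_zero_iff (by exact hm.comp (measurable_prodMk_left))).1 hω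
  rw [Filter.EventuallyEq, ae_restrict_iff' measurableSet_Ioi] at h3
  filter_upwards [h3] with r hr hr0
  have h4 := hr hr0
  by_contra hP
  have : r • (ω : Euc n) ∈ N := hN hP
  simp [this] at h4
  exact absurd h4 (not_le.2 (pow_pos hr0 _))

/-- The surface measure is controlled by the Hausdorff measure. -/
theorem sphMeas_le_diam {n : ℕ} (hn : 1 ≤ n) (s : Set (USphere n)) (hs : s.Nonempty) (δ : ℝ)
    (hδ : 0 < δ) (hδ1 : δ ≤ 1) (hsδ : Metric.ediam s ≤ ENNReal.ofReal δ) :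
    sphMeas n s ≤ ENNReal.ofReal (n * (2 * 2 ^ n) * δ ^ (n - 1)) *
      volume (Metric.ball (0 : Euc n) 1) := by
  have : Nonempty (Fin n) := ⟨⟨0, hn⟩⟩
  obtain ⟨ω0, hω0⟩ := hs
  set N : ℕ := ⌈1 / δ⌉₊ with hN
  have hNge : 1 / δ ≤ N := Nat.le_ceil _
  have hNlt : (N : ℝ) < 1 / δ + 1 := Nat.ceil_lt_add_one (by positivity)
  have hNpos : (0 : ℝ) < N := lt_of_lt_of_le (by positivity) hNge
  have h1N : 1 / (N : ℝ) ≤ δ := by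
    rw [div_le_iff₀ hNpos]; rw [div_le_iff₀ hδ] at hNge; linarith
  have hN2 : (N : ℝ) ≤ 2 / δ := by
    have : 1 ≤ 1 / δ := by rw [le_div_iff₀ hδ]; linarith
    have : 2 / δ = 1 / δ + 1 / δ := by ring
    linarith
  have hcov : Ioo (0 : ℝ) 1 • ((↑) '' closure s : Set (Euc n)) ⊆
      ⋃ k ∈ Finset.range N, Metric.closedBall (((k : ℝ) / N) • (ω0 : Euc n)) (2 * δ) := by
    rintro _ ⟨r, hr, _, ⟨ω, hω, rfl⟩, rfl⟩
    have hd : dist (ω : Euc n) ω0 ≤ δ := by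
      have h1 : edist ω ω0 ≤ ENNReal.ofReal δ :=
        (Metric.edist_le_ediam_of_mem hω (subset_closure hω0)).trans
          ((Metric.ediam_closure s).trans_le hsδ)
      rw [edist_dist] at h1
      exact (ENNReal.ofReal_le_ofReal_iff hδ.le).1 h1
    have hrN : 0 ≤ r * N := mul_nonneg hr.1.le hNpos.le
    have hk : ⌊r * N⌋₊ < N := by
      rw [Nat.floor_lt hrN]
      nlinarith [hr.2]
    simp only [mem_iUnion, Finset.mem_range]
    refine ⟨⌊r * N⌋₊, hk, ?_⟩
    rw [Metric.mem_closedBall, dist_eq_norm]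
    set k := ⌊r * N⌋₊
    have hk1 : (k : ℝ) ≤ r * N := Nat.floor_le hrN
    have hk2 : r * N < k + 1 := Nat.lt_floor_add_one _
    have e : r • (ω : Euc n) - ((k : ℝ) / N) • (ω0 : Euc n) =
        r • ((ω : Euc n) - ω0) + (r - (k : ℝ) / N) • (ω0 : Euc n) := by
      rw [smul_sub, sub_smul]; abel
    have hrk : |r - (k : ℝ) / N| ≤ δ := by
      refine le_trans ?_ h1N
      rw [abs_le]
      constructor
      · have : (k : ℝ) / N ≤ r := by rw [div_le_iff₀ hNpos]; exact hk1
        have : 0 < 1 / (N : ℝ) := by positivity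
        linarith
      · rw [sub_le_iff_le_add, ← add_div, le_div_iff₀ hNpos]; linarith
    change ‖r • (ω : Euc n) - ((k : ℝ) / N) • (ω0 : Euc n)‖ ≤ 2 * δ
    rw [e]
    refine (norm_add_le _ _).trans ?_
    rw [norm_smul, norm_smul, norm_usphere ω0, mul_one, Real.norm_eq_abs, Real.norm_eq_abs,
      abs_of_pos hr.1, ← dist_eq_norm]
    nlinarith [hr.1, hr.2, dist_nonneg (x := (ω : Euc n)) (y := (ω0 : Euc n))]
  calc sphMeas n s ≤ sphMeas n (closure s) := measure_mono subset_closure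
    _ = n * volume (Ioo (0 : ℝ) 1 • ((↑) '' closure s : Set (Euc n))) := by
      rw [sphMeas, Measure.toSphere_apply' _ isClosed_closure.measurableSet]; simp
    _ ≤ n * (∑ k ∈ Finset.range N,
        volume (Metric.closedBall (((k : ℝ) / N) • (ω0 : Euc n)) (2 * δ))) := by
      gcongr
      exact (measure_mono hcov).trans (measure_biUnion_finset_le _ _)
    _ = n * (N * (ENNReal.ofReal ((2 * δ) ^ n) * volume (Metric.ball (0 : Euc n) 1))) := by
      simp_rw [Measure.addHaar_closedBall _ _ (by positivity : (0:ℝ) ≤ 2 * δ)]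
      simp
    _ ≤ _ := by
      rw [← mul_assoc, ← mul_assoc]
      gcongr
      rw [← ENNReal.ofReal_natCast, ← ENNReal.ofReal_natCast, ← ENNReal.ofReal_mul (by positivity),
        ← ENNReal.ofReal_mul (by positivity)]
      apply ENNReal.ofReal_le_ofReal
      obtain ⟨m, rfl⟩ : ∃ m, n = m + 1 := ⟨n - 1, by omega⟩
      have : (N : ℝ) * δ ≤ 2 := by rwa [le_div_iff₀ hδ] at hN2
      have h2 : (2 * δ) ^ (m + 1) = 2 ^ (m + 1) * δ ^ m * δ := by rw [mul_pow, pow_succ δ]; ring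
      rw [h2]
      simp only [Nat.add_sub_cancel]
      have h3 : 0 ≤ ((m + 1 : ℕ) : ℝ) * (2 ^ (m + 1) * δ ^ m) := by positivity
      nlinarith

theorem sphMeas_null_of_hausdorff {n : ℕ} (hn : 1 ≤ n) (s : Set (USphere n))
    (hs : μH[(n : ℝ) - 1] s = 0) : sphMeas n s = 0 := by
  have : Nonempty (Fin n) := ⟨⟨0, hn⟩⟩
  set C : ℝ≥0∞ := ENNReal.ofReal (n * (2 * 2 ^ n)) * volume (Metric.ball (0 : Euc n) 1) with hC
  have hn0 : (0 : ℝ) < n := by exact_mod_cast hn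
  have hC0 : C ≠ 0 := by
    rw [hC]
    refine mul_ne_zero (by simp; positivity) (Metric.measure_ball_pos _ _ one_pos).ne'
  have hCt : C ≠ ⊤ := ENNReal.mul_ne_top ENNReal.ofReal_ne_top measure_ball_lt_top.ne
  have key : C⁻¹ • sphMeas n ≤ μH[(n : ℝ) - 1] := by
    refine Measure.le_hausdorffMeasure _ _ (ENNReal.ofReal (1/2)) (by norm_num) fun t ht => ?_
    rcases t.eq_empty_or_nonempty with rfl | hne
    · simp
    have hdt : Metric.ediam t ≠ ⊤ := (ht.trans_lt ENNReal.ofReal_lt_top).ne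
    set d := (Metric.ediam t).toReal with hd
    have hd1 : d ≤ 1/2 := ENNReal.toReal_le_of_le_ofReal (by norm_num) ht
    have hdt' : Metric.ediam t = ENNReal.ofReal d := (ENNReal.ofReal_toReal hdt).symm
    have hle : ∀ δ : ℝ, d < δ → δ ≤ 1 →
        (C⁻¹ • sphMeas n) t ≤ ENNReal.ofReal (δ ^ (n - 1)) := by
      intro δ h1 h2
      have := sphMeas_le_diam hn t hne δ (ENNReal.toReal_nonneg.trans_lt h1) h2
        (by rw [hdt']; exact ENNReal.ofReal_le_ofReal h1.le)
      rw [Measure.smul_apply, smul_eq_mul, mul_comm, ← div_eq_mul_inv,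
        ENNReal.div_le_iff hC0 hCt]
      refine this.trans_eq ?_
      rw [ENNReal.ofReal_mul (by positivity), hC]; ring
    have h4 : (C⁻¹ • sphMeas n) t ≤ ENNReal.ofReal (d ^ (n - 1)) := by
      have hc : Tendsto (fun δ : ℝ => ENNReal.ofReal (δ ^ (n - 1))) (𝓝[>] d)
          (𝓝 (ENNReal.ofReal (d ^ (n - 1)))) :=
        ((ENNReal.continuous_ofReal.comp (continuous_pow _)).tendsto d).mono_left
          nhdsWithin_le_nhds
      refine ge_of_tendsto hc ?_
      filter_upwards [Ioo_mem_nhdsGT (show d < 1 by linarith)] with δ hδ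
      exact hle δ hδ.1 hδ.2.le
    refine h4.trans_eq ?_
    have : (n : ℝ) - 1 = ((n - 1 : ℕ) : ℝ) := by push_cast [Nat.cast_sub hn]; ring
    rw [this, ENNReal.rpow_natCast, hdt', ENNReal.ofReal_pow ENNReal.toReal_nonneg]
  have h5 := key s
  rw [hs, Measure.smul_apply, smul_eq_mul] at h5
  have h6 := nonpos_iff_eq_zero.1 h5
  rcases mul_eq_zero.1 h6 with h | h
  · exact absurd h (ENNReal.inv_ne_zero.2 hCt)
  · exact h

/-- Hausdorff null sets are seen from the origin under a null set of directions. -/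
theorem sphMeas_radial_null {n : ℕ} (hn : 1 ≤ n) (A : Set (Euc n))
    (hA : μH[(n : ℝ) - 1] A = 0) (R : USphere n → ℝ) (ρ : ℝ) (hρ : 0 < ρ)
    (hR : ∀ ω, ρ ≤ R ω) : ∀ᵐ ω ∂sphMeas n, R ω • (ω : Euc n) ∉ A := by
  have hn0 : (0 : ℝ) ≤ (n : ℝ) - 1 := by
    have : (1 : ℝ) ≤ n := by exact_mod_cast hn
    linarith
  have hlip : LipschitzOnWith (Real.toNNReal (2 / ρ)) (fun x : Euc n => ‖x‖⁻¹ • x)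
      {x | ρ ≤ ‖x‖} := by
    refine LipschitzOnWith.of_dist_le_mul fun x hx y hy => ?_
    rw [Real.coe_toNNReal _ (by positivity), dist_eq_norm, dist_eq_norm]
    simp only [mem_ofPred_eq] at hx hy
    have hx0 : 0 < ‖x‖ := hρ.trans_le hx
    have hy0 : 0 < ‖y‖ := hρ.trans_le hy
    have e : ‖x‖⁻¹ • x - ‖y‖⁻¹ • y = ‖x‖⁻¹ • (x - y) + (‖x‖⁻¹ - ‖y‖⁻¹) • y := by
      rw [smul_sub, sub_smul]; abel
    rw [e]
    refine (norm_add_le _ _).trans ?_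
    rw [norm_smul, norm_smul, norm_inv, norm_norm]
    have h2 : ‖‖x‖⁻¹ - ‖y‖⁻¹‖ * ‖y‖ ≤ ‖x‖⁻¹ * ‖x - y‖ := by
      have : (‖x‖⁻¹ - ‖y‖⁻¹) = ‖x‖⁻¹ * (‖y‖ - ‖x‖) * ‖y‖⁻¹ := by field_simp
      rw [this, norm_mul, norm_mul, norm_inv, norm_inv, norm_norm, norm_norm, mul_assoc,
        mul_assoc, inv_mul_cancel₀ hy0.ne', mul_one, norm_sub_rev x y]
      gcongr
      exact abs_norm_sub_norm_le y x
    have h3 : ‖x‖⁻¹ ≤ ρ⁻¹ := inv_anti₀ hρ hx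
    have h4 : ‖x‖⁻¹ * ‖x - y‖ ≤ ρ⁻¹ * ‖x - y‖ := by gcongr
    have : 2 / ρ * ‖x - y‖ = ρ⁻¹ * ‖x - y‖ + ρ⁻¹ * ‖x - y‖ := by ring
    linarith
  set B := A ∩ {x | ρ ≤ ‖x‖}
  have hB : μH[(n : ℝ) - 1] ((fun x : Euc n => ‖x‖⁻¹ • x) '' B) = 0 := by
    have := (hlip.mono (show B ⊆ _ from inter_subset_right)).hausdorffMeasure_image_le hn0
    rw [measure_mono_null inter_subset_left hA, mul_zero] at this
    exact nonpos_iff_eq_zero.1 this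
  set s : Set (USphere n) := {ω | R ω • (ω : Euc n) ∈ A}
  have hsub : ((↑) '' s : Set (Euc n)) ⊆ (fun x : Euc n => ‖x‖⁻¹ • x) '' B := by
    rintro _ ⟨ω, hω, rfl⟩
    have hR0 : 0 < R ω := hρ.trans_le (hR ω)
    have hnm : ‖R ω • (ω : Euc n)‖ = R ω := by
      rw [norm_smul, norm_usphere, mul_one, Real.norm_eq_abs, abs_of_pos hR0]
    refine ⟨R ω • (ω : Euc n), ⟨hω, ?_⟩, ?_⟩
    · rw [mem_ofPred_eq, hnm]; exact hR ω
    · simp only [hnm, smul_smul, inv_mul_cancel₀ hR0.ne', one_smul]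
  have hs : μH[(n : ℝ) - 1] s = 0 := by
    rw [← isometry_subtype_coe.hausdorffMeasure_image (Or.inl hn0)]
    exact measure_mono_null hsub hB
  have := sphMeas_null_of_hausdorff hn s hs
  rw [ae_iff]
  simpa [s] using this

theorem weakGrad_euler {n : ℕ} (hn : 1 ≤ n) {w : Euc n → ℝ} {g : Euc n → Euc n}
    (hw : HasWeakGradient w g) {φ : Euc n → ℝ} (hφ : ContDiff ℝ (⊤ : ℕ∞) φ)
    (hφc : HasCompactSupport φ) {s : ℝ} (hs : 0 < s) :
    ∫ y, w y * (n * s ^ (n - 1) * φ (s • y) + s ^ n * fderiv ℝ φ (s • y) y) =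
      - ∫ y, ⟪g y, y⟫ * (s ^ (n - 1) * φ (s • y)) := by
  obtain ⟨hw1, hg1, hwg⟩ := hw
  set θ : Fin n → Euc n → ℝ := fun i y => y i * (s ^ (n - 1) * φ (s • y)) with hθ
  set e : Fin n → Euc n := fun i => EuclideanSpace.single i (1 : ℝ) with he
  have hcoord : ∀ i : Fin n, ContDiff ℝ (⊤ : ℕ∞) (fun y : Euc n => y i) := fun i => by fun_prop
  have hφs : ContDiff ℝ (⊤ : ℕ∞) (fun y => φ (s • y)) := hφ.comp (contDiff_const_smul s)
  have hφsc : HasCompactSupport (fun y => φ (s • y)) := hφc.comp_smul hs.ne'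
  have hθs : ∀ i, ContDiff ℝ (⊤ : ℕ∞) (θ i) := fun i =>
    (hcoord i).mul (contDiff_const.mul hφs)
  have hθc : ∀ i, HasCompactSupport (θ i) := fun i => (hφsc.mul_left).mul_left
  have hder : ∀ i y, fderiv ℝ (θ i) y (e i) =
      s ^ (n - 1) * φ (s • y) + s ^ n * (y i * fderiv ℝ φ (s • y) (e i)) := by
    intro i y
    have h1 : HasFDerivAt (fun y : Euc n => y i) (EuclideanSpace.proj i : Euc n →L[ℝ] ℝ) y :=
      (EuclideanSpace.proj i : Euc n →L[ℝ] ℝ).hasFDerivAt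
    have h2 : HasFDerivAt (fun y : Euc n => φ (s • y)) (s • fderiv ℝ φ (s • y)) y := by
      have h3 : HasFDerivAt (fun y : Euc n => s • y) (s • ContinuousLinearMap.id ℝ (Euc n)) y :=
        (hasFDerivAt_id y).const_smul s
      have h4 := ((hφ.differentiable (by simp)) (s • y)).hasFDerivAt.comp y h3
      have h5 : s • fderiv ℝ φ (s • y) =
          (fderiv ℝ φ (s • y)).comp (s • ContinuousLinearMap.id ℝ (Euc n)) := by ext; simp
      rw [h5]
      exact h4
    have h5 := h1.mul (h2.const_mul (s ^ (n - 1)))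
    rw [show θ i = (fun y : Euc n => y i) * fun y => s ^ (n - 1) * φ (s • y) from rfl, h5.fderiv]
    have hsn : s ^ n = s ^ (n - 1) * s := by
      rw [← pow_succ]; congr 1; omega
    simp [he, hsn]
    ring
  have hint1 : ∀ i, Integrable (fun y => w y * fderiv ℝ (θ i) y (e i)) := by
    intro i
    have hc : Continuous (fun y => fderiv ℝ (θ i) y (e i)) :=
      ((hθs i).continuous_fderiv (by simp)).clm_apply continuous_const
    have := hw1.integrable_smul_left_of_hasCompactSupport hc ((hθc i).fderiv_apply (𝕜 := ℝ) (e i))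
    simpa [mul_comm] using this
  have hint2 : ∀ i, Integrable (fun y => ⟪g y, e i⟫ * θ i y) := by
    intro i
    have hl : LocallyIntegrable (fun y => ⟪g y, e i⟫) := by
      intro x
      obtain ⟨U, hU, hUi⟩ := hg1 x
      exact ⟨U, hU, hUi.inner_const (e i)⟩
    have := hl.integrable_smul_left_of_hasCompactSupport (hθs i).continuous (hθc i)
    simpa [mul_comm] using this
  have hy : ∀ y : Euc n, ∑ i, y i • e i = y := fun y => by
    have := (EuclideanSpace.basisFun (Fin n) ℝ).sum_repr y
    simpa [he] using this
  calc ∫ y, w y * (n * s ^ (n - 1) * φ (s • y) + s ^ n * fderiv ℝ φ (s • y) y)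
      = ∫ y, ∑ i, w y * fderiv ℝ (θ i) y (e i) := by
        refine integral_congr_ae (Eventually.of_forall fun y => ?_)
        simp only
        rw [← Finset.mul_sum]
        congr 1
        simp_rw [hder]
        rw [Finset.sum_add_distrib, ← Finset.mul_sum]
        have : fderiv ℝ φ (s • y) y = ∑ i, y i * fderiv ℝ φ (s • y) (e i) := by
          conv_lhs => rw [← hy y]
          rw [map_sum, hy y]
          simp
        rw [this, ← Finset.mul_sum]
        simp only [Finset.sum_const, Finset.card_univ, Fintype.card_fin, nsmul_eq_mul]
        ring
    _ = ∑ i, ∫ y, w y * fderiv ℝ (θ i) y (e i) := integral_finsetSum _ fun i _ => hint1 i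
    _ = ∑ i, - ∫ y, ⟪g y, e i⟫ * θ i y := by
        refine Finset.sum_congr rfl fun i _ => hwg _ (hθs i) (hθc i) _
    _ = - ∫ y, ∑ i, ⟪g y, e i⟫ * θ i y := by
        rw [integral_finsetSum _ fun i _ => hint2 i, Finset.sum_neg_distrib]
    _ = _ := by
        congr 1
        refine integral_congr_ae (Eventually.of_forall fun y => ?_)
        simp only [hθ]
        have : ⟪g y, y⟫ = ∑ i, ⟪g y, e i⟫ * y i := by
          calc ⟪g y, y⟫ = ⟪g y, ∑ i, y i • e i⟫ := by rw [hy y]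
            _ = _ := by
              rw [inner_sum]
              exact Finset.sum_congr rfl fun i _ => by rw [inner_smul_right]; ring
        rw [this, Finset.sum_mul]
        refine Finset.sum_congr rfl fun i _ => by ring

/-- Derivative of the dilated averages of a locally integrable function. -/
theorem hasDerivAt_dilation {n : ℕ} {w : Euc n → ℝ} (hw : LocallyIntegrable w volume)
    {φ : Euc n → ℝ} (hφ : ContDiff ℝ (⊤ : ℕ∞) φ)
    (hφc : HasCompactSupport φ) {s : ℝ} (hs : 0 < s) :
    HasDerivAt (fun s => ∫ y, w y * (s ^ n * φ (s • y)))
      (∫ y, w y * (n * s ^ (n - 1) * φ (s • y) + s ^ n * fderiv ℝ φ (s • y) y)) s := by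
  obtain ⟨R, hR⟩ := hφc.isCompact.isBounded.subset_closedBall (0 : Euc n)
  have hR' : ∀ t ∈ Icc (s/2) (2*s), ∀ y : Euc n, y ∉ Metric.closedBall (0 : Euc n) (2 * R / s) →
      t • y ∉ tsupport φ := by
    intro t ht y hy hty
    apply hy
    have := hR hty
    rw [mem_closedBall_zero_iff, norm_smul, Real.norm_eq_abs,
      abs_of_pos (by linarith [ht.1])] at this
    rw [mem_closedBall_zero_iff, le_div_iff₀ hs]
    nlinarith [ht.1, norm_nonneg y]
  set D : ℝ × Euc n → ℝ := fun p =>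
    n * p.1 ^ (n - 1) * φ (p.1 • p.2) + p.1 ^ n * fderiv ℝ φ (p.1 • p.2) p.2 with hD
  have hφ0 : Continuous φ := hφ.continuous
  have hφ1 : Continuous (fderiv ℝ φ) := hφ.continuous_fderiv (by simp)
  have hDc : Continuous D := by
    refine Continuous.add (by fun_prop) (Continuous.mul (by fun_prop) ?_)
    exact (hφ1.comp (by fun_prop)).clm_apply continuous_snd
  obtain ⟨M, hM⟩ := (isCompact_Icc.prod
    (isCompact_closedBall (0 : Euc n) (2 * R / s))).exists_bound_of_continuousOn
    (f := D) (s := Icc (s/2) (2*s) ×ˢ Metric.closedBall (0 : Euc n) (2 * R / s)) hDc.continuousOn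
  have hwball : Integrable ((Metric.closedBall (0 : Euc n) (2 * R / s)).indicator w) :=
    (hw.integrableOn_isCompact (isCompact_closedBall _ _)).integrable_indicator
      Metric.isClosed_closedBall.measurableSet
  have hwm : AEStronglyMeasurable w volume := hw.aestronglyMeasurable
  have := hasDerivAt_integral_of_dominated_loc_of_deriv_le (𝕜 := ℝ)
    (μ := (volume : Measure (Euc n)))
    (F := fun s y => w y * (s ^ n * φ (s • y))) (F' := fun s y => w y * D (s, y)) (x₀ := s)
    (s := Icc (s/2) (2*s)) (bound := fun y =>
      M * ‖(Metric.closedBall (0 : Euc n) (2 * R / s)).indicator w y‖)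
    (Icc_mem_nhds (by linarith) (by linarith)) ?_ ?_ ?_ ?_ ?_ ?_
  · exact this.2
  · refine Eventually.of_forall fun t => hwm.mul ?_
    exact (by fun_prop : Continuous fun y => t ^ n * φ (t • y)).aestronglyMeasurable
  · have := hw.integrable_smul_left_of_hasCompactSupport
      (g := fun y => s ^ n * φ (s • y)) (by fun_prop) ((hφc.comp_smul hs.ne').mul_left)
    simpa [mul_comm] using this
  · exact hwm.mul (hDc.comp (by fun_prop)).aestronglyMeasurable
  · refine Eventually.of_forall fun y t ht => ?_
    by_cases hy : y ∈ Metric.closedBall (0 : Euc n) (2 * R / s)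
    · rw [indicator_of_mem hy, norm_mul, mul_comm]
      exact mul_le_mul_of_nonneg_right (hM (t, y) ⟨ht, hy⟩) (norm_nonneg _)
    · have h1 := hR' t ht y hy
      have h2 : φ (t • y) = 0 := image_eq_zero_of_notMem_tsupport h1
      have h3 : fderiv ℝ φ (t • y) = 0 :=
        image_eq_zero_of_notMem_tsupport (fun h => h1 (tsupport_fderiv_subset ℝ h))
      rw [indicator_of_notMem hy]
      simp [hD, h2, h3]
  · exact (hwball.norm.const_mul M)
  · refine Eventually.of_forall fun y t ht => ?_
    have h3 : HasDerivAt (fun t : ℝ => t • y) y t := by simpa using (hasDerivAt_id t).smul_const y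
    have h4 := ((hφ.differentiable (by simp)) (t • y)).hasFDerivAt.comp_hasDerivAt t h3
    exact ((hasDerivAt_pow n t).mul h4).const_mul (w y)

theorem lintegral_comp_const_smul {n : ℕ} (f : Euc n → ℝ≥0∞) (hf : Measurable f) {c : ℝ}
    (hc : 0 < c) : ∫⁻ x, f (c • x) = ENNReal.ofReal ((c ^ n)⁻¹) * ∫⁻ x, f x := by
  have h := Measure.map_addHaar_smul (volume : Measure (Euc n)) hc.ne'
  rw [← lintegral_map hf (measurable_const_smul c), h, lintegral_smul_measure]
  simp [abs_of_pos hc]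

theorem integrableOn_radial {n : ℕ} {g : Euc n → Euc n} (hgm : Measurable g)
    (hg : LocallyIntegrable g volume) {a b : ℝ} (ha : 0 < a) (R : ℝ) :
    Integrable (fun p : ℝ × Euc n => ⟪g (p.1 • p.2), p.2⟫)
      ((volume.restrict (Icc a b)).prod (volume.restrict (Metric.closedBall (0 : Euc n) R))) := by
  have hm : Measurable (fun p : ℝ × Euc n => ⟪g (p.1 • p.2), p.2⟫) :=
    (hgm.comp (by fun_prop)).inner measurable_snd
  refine ⟨hm.aestronglyMeasurable, ?_⟩
  rw [HasFiniteIntegral, lintegral_prod _ hm.enorm.aemeasurable]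
  set B := Metric.closedBall (0 : Euc n) (b * R)
  have hB : ∫⁻ y in B, ‖g y‖ₑ < ⊤ :=
    (hg.integrableOn_isCompact (isCompact_closedBall (0 : Euc n) (b * R))).2
  have hBm : MeasurableSet B := Metric.isClosed_closedBall.measurableSet
  refine lt_of_le_of_lt (setLIntegral_mono' (g := fun _ => ENNReal.ofReal R *
    (ENNReal.ofReal ((a ^ n)⁻¹) * ∫⁻ y in B, ‖g y‖ₑ)) measurableSet_Icc ?_) ?_
  · intro τ hτ
    have hτ0 : 0 < τ := ha.trans_le hτ.1
    calc ∫⁻ x in Metric.closedBall (0 : Euc n) R, ‖⟪g (τ • x), x⟫‖ₑ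
        ≤ ∫⁻ x in Metric.closedBall (0 : Euc n) R, ENNReal.ofReal R *
            B.indicator (fun y => ‖g y‖ₑ) (τ • x) := by
          refine setLIntegral_mono' Metric.isClosed_closedBall.measurableSet fun x hx => ?_
          rw [mem_closedBall_zero_iff] at hx
          have hR : 0 ≤ R := (norm_nonneg x).trans hx
          have : τ • x ∈ B := by
            rw [mem_closedBall_zero_iff, norm_smul, Real.norm_eq_abs, abs_of_pos hτ0]
            exact mul_le_mul hτ.2 hx (norm_nonneg _) (hτ0.le.trans hτ.2)
          rw [indicator_of_mem this, ← ofReal_norm, ← ofReal_norm, ← ENNReal.ofReal_mul hR]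
          refine ENNReal.ofReal_le_ofReal ((norm_inner_le_norm _ _).trans ?_)
          rw [mul_comm]
          gcongr
      _ ≤ ∫⁻ x, ENNReal.ofReal R * B.indicator (fun y => ‖g y‖ₑ) (τ • x) :=
          setLIntegral_le_lintegral _ _
      _ = ENNReal.ofReal R * (ENNReal.ofReal ((τ ^ n)⁻¹) * ∫⁻ y in B, ‖g y‖ₑ) := by
          have hmm : Measurable fun x => B.indicator (fun y => ‖g y‖ₑ) (τ • x) :=
            (hgm.enorm.indicator hBm).comp (measurable_const_smul τ)
          rw [lintegral_const_mul _ hmm,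
            lintegral_comp_const_smul _ (hgm.enorm.indicator hBm) hτ0,
            lintegral_indicator hBm]
      _ ≤ _ := by
          gcongr
          exact hτ.1
  · simp only [lintegral_const]
    refine ENNReal.mul_lt_top (ENNReal.mul_lt_top ENNReal.ofReal_lt_top
      (ENNReal.mul_lt_top ENNReal.ofReal_lt_top hB)) ?_
    simp

/-- A Sobolev function satisfies the fundamental theorem of calculus along almost every ray. -/
theorem weakGrad_radial {n : ℕ} (hn : 1 ≤ n) {w : Euc n → ℝ} {g : Euc n → Euc n}
    (hgm : Measurable g) (hw : HasWeakGradient w g) {l : ℝ} (hl : 0 < l) :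
    ∀ᵐ x, w (l • x) = w x + ∫ τ in (1 : ℝ)..l, ⟪g (τ • x), x⟫ := by
  set a := min 1 l
  set b := max 1 l
  have ha : 0 < a := lt_min one_pos hl
  have hI : uIoc (1 : ℝ) l ⊆ Icc a b := by
    rw [uIoc]; exact Ioc_subset_Icc_self
  set I := uIoc (1 : ℝ) l
  have hjoint : ∀ R : ℝ, Integrable (fun p : ℝ × Euc n => ⟪g (p.1 • p.2), p.2⟫)
      ((volume.restrict I).prod (volume.restrict (Metric.closedBall (0 : Euc n) R))) := by
    intro R
    refine (integrableOn_radial hgm hw.2.1 ha R (b := b)).mono_measure ?_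
    exact Measure.prod_mono (Measure.restrict_mono hI le_rfl) le_rfl
  set G : Euc n → ℝ := fun x => ∫ τ in (1 : ℝ)..l, ⟪g (τ • x), x⟫ with hG
  set c : ℝ := if (1 : ℝ) ≤ l then 1 else -1 with hc
  have hGI : ∀ x, G x = c * ∫ τ in I, ⟪g (τ • x), x⟫ := fun x => by
    rw [hG]; simp only; rw [intervalIntegral.intervalIntegral_eq_integral_uIoc]; rfl
  have hGloc : LocallyIntegrable G volume := by
    rw [locallyIntegrable_iff]
    intro k hk
    obtain ⟨R, hR⟩ := hk.isBounded.subset_closedBall (0 : Euc n)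
    have : IntegrableOn G (Metric.closedBall (0 : Euc n) R) := by
      have := ((hjoint R).integral_prod_right).const_mul c
      refine this.congr (Eventually.of_forall fun x => (hGI x).symm)
    exact this.mono_set hR
  have hwl : LocallyIntegrable (fun x => w (l • x)) volume := by
    rw [locallyIntegrable_iff]
    intro k hk
    have h1 : IntegrableOn w (l • k) volume :=
      hw.1.integrableOn_isCompact (hk.smul l)
    have h2 : Integrable (fun x => (l • k).indicator w (l • x)) :=
      (integrable_comp_smul_iff volume ((l • k).indicator w) hl.ne').2
        ((integrable_indicator_iff (hk.smul l).measurableSet).2 h1)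
    have h3 : (fun x => (l • k).indicator w (l • x)) = k.indicator (fun x => w (l • x)) := by
      ext x
      by_cases hx : x ∈ k
      · rw [indicator_of_mem hx, indicator_of_mem (smul_mem_smul_set hx)]
      · rw [indicator_of_notMem hx, indicator_of_notMem]
        rwa [smul_mem_smul_set_iff₀ hl.ne']
    rw [h3] at h2
    exact (integrable_indicator_iff hk.measurableSet).1 h2
  refine ae_eq_of_integral_contDiff_smul_eq hwl (hw.1.add hGloc) fun φ hφ hφc => ?_
  simp only [smul_eq_mul]
  have hφ0 : Continuous φ := hφ.continuous
  -- dilated averages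
  set H : ℝ → ℝ := fun s => ∫ y, w y * (s ^ n * φ (s • y)) with hH
  set h' : ℝ → ℝ := fun τ => ∫ x, φ x * ⟪g (τ • x), x⟫ with hh'
  have hHval : ∀ τ : ℝ, 0 < τ → H τ⁻¹ = ∫ x, φ x * w (τ • x) := by
    intro τ hτ
    have := Measure.integral_comp_smul (volume : Measure (Euc n))
      (fun y => w y * φ (τ⁻¹ • y)) τ
    simp only [smul_smul, inv_mul_cancel₀ hτ.ne', one_smul, finrank_euclideanSpace,
      Fintype.card_fin, smul_eq_mul] at this
    rw [abs_of_pos (by positivity)] at this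
    simp_rw [mul_comm (φ _)]
    rw [this, hH, ← integral_const_mul]
    refine integral_congr_ae (Eventually.of_forall fun y => ?_)
    simp only [inv_pow]; ring
  have hder : ∀ τ : ℝ, 0 < τ → HasDerivAt (fun τ => H τ⁻¹) (h' τ) τ := by
    intro τ hτ
    have h1 := hasDerivAt_dilation hw.1 hφ hφc (inv_pos.2 hτ)
    rw [weakGrad_euler hn hw hφ hφc (inv_pos.2 hτ)] at h1
    have h2 := h1.comp τ (hasDerivAt_inv hτ.ne')
    have h3 : (-∫ y, ⟪g y, y⟫ * (τ⁻¹ ^ (n - 1) * φ (τ⁻¹ • y))) * -(τ ^ 2)⁻¹ = h' τ := by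
      have := Measure.integral_comp_smul (volume : Measure (Euc n))
        (fun y => φ (τ⁻¹ • y) * ⟪g y, τ⁻¹ • y⟫) τ
      simp only [smul_smul, inv_mul_cancel₀ hτ.ne', one_smul, finrank_euclideanSpace,
        Fintype.card_fin, smul_eq_mul] at this
      rw [abs_of_pos (by positivity)] at this
      rw [hh']
      simp only
      rw [this, neg_mul_neg, mul_comm, ← integral_const_mul, ← integral_const_mul]
      refine integral_congr_ae (Eventually.of_forall fun y => ?_)
      simp only [inner_smul_right]
      have : τ ^ n = τ ^ (n - 1) * τ := by rw [← pow_succ]; congr 1; omega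
      rw [this, inv_pow]
      have : τ ^ (n - 1) ≠ 0 := by positivity
      field_simp
    rw [h3] at h2
    exact h2
  obtain ⟨R, hR⟩ := hφc.isCompact.isBounded.subset_closedBall (0 : Euc n)
  obtain ⟨M, hM⟩ := hφc.exists_bound_of_continuous hφ0
  have hφR : ∀ x, x ∉ Metric.closedBall (0 : Euc n) R → φ x = 0 := fun x hx =>
    image_eq_zero_of_notMem_tsupport fun h => hx (hR h)
  have hjφ : Integrable (fun p : ℝ × Euc n => φ p.2 * ⟪g (p.1 • p.2), p.2⟫)
      ((volume.restrict I).prod (volume.restrict (Metric.closedBall (0 : Euc n) R))) :=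
    (hjoint R).bdd_mul (c := M) (hφ0.comp continuous_snd).aestronglyMeasurable
      (Eventually.of_forall fun p => hM p.2)
  have hset : ∀ f : Euc n → ℝ, ∫ x in Metric.closedBall (0 : Euc n) R, φ x * f x =
      ∫ x, φ x * f x := fun f =>
    setIntegral_eq_integral_of_forall_compl_eq_zero fun x hx => by rw [hφR x hx, zero_mul]
  have hint : IntervalIntegrable h' volume 1 l := by
    rw [intervalIntegrable_iff]
    refine hjφ.integral_prod_left.congr (Eventually.of_forall fun τ => ?_)
    exact hset _
  have hFTC : ∫ τ in (1 : ℝ)..l, h' τ = H l⁻¹ - H 1⁻¹ := by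
    refine intervalIntegral.integral_eq_sub_of_hasDerivAt (fun τ hτ => hder τ ?_) hint
    exact (lt_min one_pos hl).trans_le hτ.1
  rw [hHval l hl, hHval 1 one_pos] at hFTC
  simp only [one_smul] at hFTC
  have hswap : ∫ τ in (1 : ℝ)..l, h' τ = ∫ x, φ x * G x := by
    rw [intervalIntegral.intervalIntegral_eq_integral_uIoc]
    have h1 := integral_integral_swap (f := fun τ x => φ x * ⟪g (τ • x), x⟫) hjφ
    simp_rw [hset] at h1
    change c • ∫ τ in I, h' τ = _
    rw [hh', h1, smul_eq_mul, ← integral_const_mul, ← hset]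
    refine integral_congr_ae (Eventually.of_forall fun x => ?_)
    simp only
    rw [hGI, integral_const_mul]; ring
  have hi1 : Integrable (fun x => φ x * w x) :=
    hw.1.integrable_smul_left_of_hasCompactSupport hφ0 hφc
  have hi2 : Integrable (fun x => φ x * G x) :=
    hGloc.integrable_smul_left_of_hasCompactSupport hφ0 hφc
  rw [sub_eq_iff_eq_add'.1 (hFTC.symm.trans hswap), ← integral_add hi1 hi2]
  refine integral_congr_ae (Eventually.of_forall fun x => ?_)
  ring

/-- A convex body containing a neighbourhood of the origin. -/
structure IsBody0 {n : ℕ} (E : Set (Euc n)) : Prop where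
  compact : IsCompact E
  convex : Convex ℝ E
  nhds : E ∈ 𝓝 (0 : Euc n)

/-- The radial function of a body. -/
def rad {n : ℕ} (E : Set (Euc n)) (ω : USphere n) : ℝ := (gauge E (ω : Euc n))⁻¹

theorem usphere_ne_zero {n : ℕ} (ω : USphere n) : (ω : Euc n) ≠ 0 := fun h => by
  have := norm_usphere ω
  rw [h, norm_zero] at this
  exact zero_ne_one this

namespace IsBody0

variable {n : ℕ} {E E' : Set (Euc n)}

theorem gauge_pos (hE : IsBody0 E) (ω : USphere n) : 0 < gauge E (ω : Euc n) :=
  (_root_.gauge_pos (absorbent_nhds_zero hE.nhds)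
    (NormedSpace.isVonNBounded_of_isBounded ℝ hE.compact.isBounded)).2 (usphere_ne_zero ω)

theorem rad_pos (hE : IsBody0 E) (ω : USphere n) : 0 < rad E ω := inv_pos.2 (hE.gauge_pos ω)

theorem smul_mem_iff (hE : IsBody0 E) (ω : USphere n) {r : ℝ} (hr : 0 ≤ r) :
    r • (ω : Euc n) ∈ E ↔ r ≤ rad E ω := by
  have h := gauge_le_one_iff_mem_closure (x := r • (ω : Euc n)) hE.convex hE.nhds
  rw [hE.compact.isClosed.closure_eq, gauge_smul_of_nonneg hr, smul_eq_mul] at h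
  rw [← h, rad, ← one_div, le_div_iff₀ (hE.gauge_pos ω)]

theorem mem_interior_of_lt (hE : IsBody0 E) (ω : USphere n) {r : ℝ} (hr : 0 ≤ r)
    (h : r < rad E ω) : r • (ω : Euc n) ∈ interior E := by
  rw [← setOfPred_gauge_lt_one_eq_interior hE.convex hE.nhds]
  change gauge E (r • (ω : Euc n)) < 1
  rw [gauge_smul_of_nonneg hr, smul_eq_mul]
  rwa [rad, ← one_div, lt_div_iff₀ (hE.gauge_pos ω)] at h

theorem measurable_rad (hE : IsBody0 E) : Measurable (rad E) :=
  ((continuous_gauge hE.convex hE.nhds).measurable.comp measurable_subtype_coe).inv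

theorem rad_mono (hE : IsBody0 E) (hE' : IsBody0 E') (h : E ⊆ E') (ω : USphere n) :
    rad E ω ≤ rad E' ω :=
  (hE'.smul_mem_iff ω (hE.rad_pos ω).le).1 (h ((hE.smul_mem_iff ω (hE.rad_pos ω).le).2 le_rfl))

theorem le_rad (hE : IsBody0 E) {ρ : ℝ} (hρ : 0 < ρ) (h : Metric.ball (0 : Euc n) ρ ⊆ E)
    (ω : USphere n) : ρ ≤ rad E ω := by
  refine le_of_forall_lt_imp_le_of_dense fun r hr => ?_
  rcases le_or_gt r 0 with h0 | h0
  · exact h0.trans (hE.rad_pos ω).le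
  · refine (hE.smul_mem_iff ω h0.le).1 (h ?_)
    rwa [mem_ball_zero_iff, norm_smul, norm_usphere, mul_one, Real.norm_eq_abs, abs_of_pos h0]

theorem rad_le (hE : IsBody0 E) {D : ℝ} (h : E ⊆ Metric.closedBall (0 : Euc n) D)
    (ω : USphere n) : rad E ω ≤ D := by
  have := h ((hE.smul_mem_iff ω (hE.rad_pos ω).le).2 le_rfl)
  rwa [mem_closedBall_zero_iff, norm_smul, norm_usphere, mul_one, Real.norm_eq_abs,
    abs_of_pos (hE.rad_pos ω)] at this

end IsBody0

theorem lintegral_Ioc_pow {n : ℕ} (hn : 1 ≤ n) {R : ℝ} (hR : 0 ≤ R) :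
    ∫⁻ r in Ioc (0 : ℝ) R, ENNReal.ofReal (r ^ (n - 1)) = ENNReal.ofReal (R ^ n / n) := by
  rw [← ofReal_integral_eq_lintegral_ofReal (intervalIntegral.intervalIntegrable_pow _).1,
    ← intervalIntegral.integral_of_le hR]
  · have h1 : ((n - 1 : ℕ) : ℝ) + 1 = n := by
      have : n - 1 + 1 = n := by omega
      exact_mod_cast this
    rw [integral_pow, h1, Nat.sub_add_cancel hn, zero_pow (by omega), sub_zero]
  · filter_upwards [ae_restrict_mem measurableSet_Ioc] with y hy
    exact pow_nonneg hy.1.le _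

/-- Volume of a body in polar coordinates. -/
theorem IsBody0.volume_eq {n : ℕ} (hn : 1 ≤ n) {E : Set (Euc n)} (hE : IsBody0 E) :
    ∫⁻ ω, ENNReal.ofReal (rad E ω ^ n) ∂sphMeas n = n * volume E := by
  have hEm := hE.compact.measurableSet
  have h1 := lintegral_polar hn (E.indicator 1) (measurable_one.indicator hEm)
  rw [lintegral_indicator_one hEm] at h1
  rw [h1, ← lintegral_const_mul']
  swap
  · simp
  refine lintegral_congr fun ω => ?_
  have h2 : ∫⁻ r in Ioi (0 : ℝ), E.indicator 1 (r • (ω : Euc n)) * ENNReal.ofReal (r ^ (n - 1)) =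
      ∫⁻ r in Ioc (0 : ℝ) (rad E ω), ENNReal.ofReal (r ^ (n - 1)) := by
    rw [← lintegral_indicator measurableSet_Ioi, ← lintegral_indicator measurableSet_Ioc]
    refine lintegral_congr fun r => ?_
    by_cases hr : 0 < r
    · by_cases hrR : r ≤ rad E ω
      · simp [indicator, hr, hrR, (hE.smul_mem_iff ω hr.le).2 hrR]
      · have h3 : r • (ω : Euc n) ∉ E := fun h => hrR ((hE.smul_mem_iff ω hr.le).1 h)
        simp [indicator, hr, hrR, h3]
    · rw [indicator_of_notMem (by simpa using hr), indicator_of_notMem (fun h => hr h.1)]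
  rw [h2, lintegral_Ioc_pow hn (hE.rad_pos ω).le, ← ENNReal.ofReal_natCast,
    ← ENNReal.ofReal_mul (by positivity)]
  congr 1
  have : (n : ℝ) ≠ 0 := by positivity
  field_simp

/-- One-dimensional change of variables along a ray. -/
theorem lintegral_inverse_levels {G f S : ℝ → ℝ} {A τ : ℝ} {α : EReal}
    (hGm : Measurable G) (hSm : Measurable S)
    (hG : ∀ b, IntegrableOn G (Ioc A b)) (hG0 : ∀ᵐ r, A < r → G r ≤ 0)
    (hf : ∀ a b, A ≤ a → a ≤ b → f b - f a = ∫ r in a..b, G r)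
    (hfa : ∀ r, A ≤ r → α ≤ (f r : EReal)) (hfA : f A = τ)
    (hSA : ∀ᵐ t : ℝ, α < (t : EReal) → t < τ → A ≤ S t)
    (hfS : ∀ᵐ t : ℝ, α < (t : EReal) → t < τ → f (S t) = t)
    (H : ℝ → ℝ≥0∞) (hH : Measurable H) :
    ∫⁻ r in Ioi A, H r * ENNReal.ofReal (-G r) =
      ∫⁻ t in {t : ℝ | α < (t : EReal) ∧ t < τ}, H (S t) := by
  set I : Set ℝ := {t : ℝ | α < (t : EReal) ∧ t < τ}
  have hIm : MeasurableSet I := by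
    refine MeasurableSet.inter ?_ measurableSet_Iio
    exact measurableSet_lt measurable_const measurable_coe_real_ereal
  have hanti : ∀ a b, A ≤ a → a ≤ b → f b ≤ f a := by
    intro a b ha hab
    rw [← sub_nonpos, hf a b ha hab, intervalIntegral.integral_of_le hab]
    refine integral_nonpos_of_ae ?_
    filter_upwards [ae_restrict_of_ae hG0, ae_restrict_mem measurableSet_Ioc] with r h1 h2
    exact h1 (ha.trans_lt h2.1)
  set μ := Measure.map S (volume.restrict I)
  set ν := (volume.restrict (Ioi A)).withDensity fun r => ENNReal.ofReal (-G r)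
  have hdm : Measurable fun r => ENNReal.ofReal (-G r) := hGm.neg.ennreal_ofReal
  have hν : ∀ a b, a < b → ν (Ioc a b) = ENNReal.ofReal (f (max a A) - f (max b A)) := by
    intro a b hab
    rw [withDensity_apply _ measurableSet_Ioc, Measure.restrict_restrict measurableSet_Ioc]
    have e : Ioc a b ∩ Ioi A = Ioc (max a A) (max b A) := by
      ext r
      simp only [mem_inter_iff, mem_Ioc, mem_Ioi, max_lt_iff, le_max_iff]
      constructor
      · rintro ⟨⟨h1, h2⟩, h3⟩; exact ⟨⟨h1, h3⟩, Or.inl h2⟩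
      · rintro ⟨⟨h1, h3⟩, h2⟩
        exact ⟨⟨h1, h2.resolve_right (not_le.2 h3)⟩, h3⟩
    have hle : max a A ≤ max b A := max_le_max_right A hab.le
    have hsub : Ioc (max a A) (max b A) ⊆ Ioc A (max b A) :=
      Ioc_subset_Ioc_left (le_max_right _ _)
    rw [e, ← ofReal_integral_eq_lintegral_ofReal]
    · rw [integral_neg, ← intervalIntegral.integral_of_le hle,
        ← hf _ _ (le_max_right _ _) hle, neg_sub]
    · exact ((hG _).mono_set hsub).neg
    · filter_upwards [ae_restrict_of_ae hG0, ae_restrict_mem measurableSet_Ioc] with r h1 h2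
      exact neg_nonneg.2 (h1 (hsub h2).1)
  have hμ : ∀ a b, a < b → μ (Ioc a b) = ENNReal.ofReal (f (max a A) - f (max b A)) := by
    intro a b hab
    rw [Measure.map_apply hSm measurableSet_Ioc, Measure.restrict_apply (hSm measurableSet_Ioc)]
    have hle : max a A ≤ max b A := max_le_max_right A hab.le
    set a' := max a A
    set b' := max b A
    have ha' : A ≤ a' := le_max_right _ _
    have hb' : A ≤ b' := le_max_right _ _
    apply le_antisymm
    · rw [← Real.volume_Icc]
      refine measure_mono_ae ?_
      filter_upwards [hSA, hfS] with t h1 h2 h3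
      obtain ⟨⟨h3, h4⟩, h5, h6⟩ := h3
      have h7 := h1 h5 h6
      have h8 := h2 h5 h6
      constructor
      · rw [← h8]; exact hanti _ _ h7 (h4.trans (le_max_left _ _))
      · rw [← h8]; exact hanti _ _ ha' (max_le h3.le h7)
    · rw [← Real.volume_Ioo]
      refine measure_mono_ae ?_
      filter_upwards [hSA, hfS] with t h1 h2 h3
      have h5 : α < (t : EReal) := (hfa b' hb').trans_lt (EReal.coe_lt_coe_iff.2 h3.1)
      have h6 : t < τ := h3.2.trans_le (hfA ▸ hanti A a' le_rfl ha')
      have h7 := h1 h5 h6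
      have h8 := h2 h5 h6
      refine ⟨⟨?_, ?_⟩, h5, h6⟩
      · by_contra h
        have := hanti (S t) a' h7 ((not_lt.1 h).trans (le_max_left _ _))
        exact absurd h3.2 (not_lt.2 (h8 ▸ this))
      · by_contra h
        have hb : b' ≤ S t := max_le (not_le.1 h).le h7
        have := hanti b' (S t) hb' hb
        exact absurd h3.1 (not_lt.2 (h8 ▸ this))
  have hμν : μ = ν := Measure.ext_of_Ioc' _ _ (fun a b hab => by rw [hμ a b hab]; simp)
    fun a b hab => by rw [hμ a b hab, hν a b hab]
  calc ∫⁻ r in Ioi A, H r * ENNReal.ofReal (-G r) = ∫⁻ r, H r ∂ν := by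
        rw [lintegral_withDensity_eq_lintegral_mul _ hdm hH]
        refine lintegral_congr fun r => ?_
        simp [mul_comm]
    _ = ∫⁻ r, H r ∂μ := by rw [hμν]
    _ = _ := lintegral_map hH hSm

/-- The radial component of a vector field along the ray through `ω`. -/
def radG {n : ℕ} (g : Euc n → Euc n) (ω : Euc n) (r : ℝ) : ℝ := ⟪g (r • ω), ω⟫

theorem measurable_radG {n : ℕ} {g : Euc n → Euc n} (hg : Measurable g) :
    Measurable fun p : Euc n × ℝ => radG g p.1 p.2 :=
  (hg.comp (by fun_prop)).inner measurable_fst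

theorem measurable_integral_radG {n : ℕ} {g : Euc n → Euc n} (hg : Measurable g) :
    Measurable fun p : Euc n × ℝ => ∫ τ in (1 : ℝ)..p.2, radG g p.1 τ := by
  have key : ∀ A : Set ((Euc n × ℝ) × ℝ), MeasurableSet A →
      Measurable fun p : Euc n × ℝ => ∫ τ, A.indicator (fun q => radG g q.1.1 q.2) (p, τ) := by
    intro A hA
    have h1 : Measurable fun q : (Euc n × ℝ) × ℝ => radG g q.1.1 q.2 :=
      (measurable_radG hg).comp (by fun_prop : Measurable fun q : (Euc n × ℝ) × ℝ => (q.1.1, q.2))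
    exact ((h1.indicator hA).stronglyMeasurable.integral_prod_right').measurable
  have h1 := key {q | 1 < q.2 ∧ q.2 ≤ q.1.2}
    ((measurableSet_lt measurable_const measurable_snd).inter
      (measurableSet_le measurable_snd (measurable_snd.comp measurable_fst)))
  have h2 := key {q | q.1.2 < q.2 ∧ q.2 ≤ 1}
    ((measurableSet_lt (measurable_snd.comp measurable_fst) measurable_snd).inter
      (measurableSet_le measurable_snd measurable_const))
  convert h1.sub h2 using 1
  ext p
  rw [intervalIntegral, ← integral_indicator measurableSet_Ioc,
    ← integral_indicator measurableSet_Ioc]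
  rfl

/-- Absolute continuity along almost every ray. -/
theorem ray_absolutelyContinuous {n : ℕ} (hn : 1 ≤ n) {w : Euc n → ℝ} {g : Euc n → Euc n}
    (hwm : Measurable w) (hgm : Measurable g) (hw : HasWeakGradient w g) :
    ∀ᵐ ω : USphere n ∂sphMeas n, ∃ f : ℝ → ℝ,
      (∀ a b : ℝ, 0 < a → IntegrableOn (radG g ω) (Icc a b)) ∧
      (∀ a b : ℝ, 0 < a → 0 < b → f b - f a = ∫ r in a..b, radG g ω r) ∧
      ∀ᵐ r : ℝ, 0 < r → w (r • (ω : Euc n)) = f r := by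
  have hP1 : ∀ᵐ x : Euc n, ∀ᵐ l : ℝ, 0 < l → w (l • x) = w x + ∫ τ in (1 : ℝ)..l, radG g x τ := by
    have hm : MeasurableSet {p : Euc n × ℝ | 0 < p.2 →
        w (p.2 • p.1) = w p.1 + ∫ τ in (1 : ℝ)..p.2, radG g p.1 τ} := by
      refine MeasurableSet.imp (measurableSet_lt (by fun_prop) (by fun_prop)) ?_
      exact measurableSet_eq_fun (hwm.comp (by fun_prop))
        ((hwm.comp measurable_fst).add (measurable_integral_radG hgm))
    refine (Measure.ae_ae_comm hm).2 (Eventually.of_forall fun l => ?_)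
    by_cases hl : 0 < l
    · filter_upwards [weakGrad_radial hn hgm hw hl] with x hx _ using hx
    · exact Eventually.of_forall fun x h => absurd h hl
  have hP2 : ∀ᵐ x : Euc n, ∀ m : ℕ,
      IntegrableOn (radG g x) (Icc ((m : ℝ) + 1)⁻¹ (m + 1)) := by
    rw [ae_all_iff]
    intro m
    have h1 : ∀ k : ℕ, ∀ᵐ x : Euc n, x ∈ Metric.closedBall (0 : Euc n) k →
        IntegrableOn (radG g x) (Icc ((m : ℝ) + 1)⁻¹ (m + 1)) := by
      intro k
      have h2 := (integrableOn_radial hgm hw.2.1 (a := ((m : ℝ) + 1)⁻¹) (b := m + 1)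
        (by positivity) k).prod_left_ae
      exact (ae_restrict_iff' measurableSet_closedBall).1 h2
    filter_upwards [ae_all_iff.2 h1] with x hx
    obtain ⟨k, hk⟩ := exists_nat_ge ‖x‖
    exact hx k (by simpa using hk)
  filter_upwards [ae_ray hn (hP1.and hP2)] with ω hω
  obtain ⟨r0, hr0, h1, h2⟩ : ∃ r0 : ℝ, 0 < r0 ∧ _ ∧ _ := by
    have : ∃ᶠ r : ℝ in ae volume, 0 < r := by
      rw [frequently_ae_iff]
      change volume (Ioi (0 : ℝ)) ≠ 0
      simp
    obtain ⟨r, hr, h⟩ := (this.and_eventually hω).exists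
    exact ⟨r, hr, h hr⟩
  have hresc : ∀ r, radG g (r0 • (ω : Euc n)) r = r0 * radG g ω (r0 * r) := by
    intro r
    simp only [radG]
    rw [smul_smul, mul_comm r r0, inner_smul_right]
  have hint : ∀ a b : ℝ, 0 < a → IntegrableOn (radG g ω) (Icc a b) := by
    intro a b ha
    obtain ⟨m, hm⟩ := exists_nat_ge (max (b / r0) (r0 / a))
    have hm1 : b / r0 ≤ m := (le_max_left _ _).trans hm
    have hm2 : r0 / a ≤ m := (le_max_right _ _).trans hm
    have h3 := h2 m
    rcases le_or_gt a b with hab | hab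
    swap
    · simp [Icc_eq_empty (not_le.2 hab)]
    have e1 : ((m : ℝ) + 1)⁻¹ * r0 ≤ a := by
      rw [inv_mul_le_iff₀ (by positivity)]
      rw [div_le_iff₀ ha] at hm2
      nlinarith
    have e2 : b ≤ (m + 1) * r0 := by
      rw [div_le_iff₀ hr0] at hm1
      nlinarith
    have e3 : ((m : ℝ) + 1)⁻¹ ≤ m + 1 := by
      have : (1 : ℝ) ≤ m + 1 := by simp
      exact (inv_le_one_of_one_le₀ this).trans this
    have h5 := ((intervalIntegrable_iff_integrableOn_Icc_of_le e3).2 h3).comp_mul_left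
      (c := r0⁻¹) |>.const_mul r0⁻¹
    have h7 : IntervalIntegrable (radG g ω) volume (((m : ℝ) + 1)⁻¹ * r0) ((m + 1) * r0) := by
      convert h5 using 1
      · ext r
        rw [hresc, mul_inv_cancel_left₀ hr0.ne', inv_mul_cancel_left₀ hr0.ne']
      · simp
      · simp
    exact ((intervalIntegrable_iff_integrableOn_Icc_of_le (by nlinarith)).1 h7).mono_set
      (Icc_subset_Icc e1 e2)
  refine ⟨fun r => w (r0 • (ω : Euc n)) + ∫ s in r0..r, radG g ω s, hint, ?_, ?_⟩
  · intro a b ha hb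
    have hii : ∀ a b : ℝ, 0 < a → 0 < b → IntervalIntegrable (radG g ω) volume a b := by
      intro a b ha hb
      rcases le_total a b with h | h
      · exact (intervalIntegrable_iff_integrableOn_Icc_of_le h).2 (hint a b ha)
      · exact ((intervalIntegrable_iff_integrableOn_Icc_of_le h).2 (hint b a hb)).symm
    simp only [add_sub_add_left_eq_sub]
    exact intervalIntegral.integral_interval_sub_left (hii _ _ hr0 hb) (hii _ _ hr0 ha)
  · have h3 : ∀ᵐ r : ℝ, 0 < r0⁻¹ * r → w ((r0⁻¹ * r) • r0 • (ω : Euc n)) =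
        w (r0 • (ω : Euc n)) + ∫ τ in (1 : ℝ)..(r0⁻¹ * r), radG g (r0 • (ω : Euc n)) τ := by
      have hq : Measure.QuasiMeasurePreserving (fun r : ℝ => r0⁻¹ * r) volume volume := by
        refine ⟨measurable_const_mul _, ?_⟩
        rw [Real.map_volume_mul_left (inv_ne_zero hr0.ne')]
        exact Measure.smul_absolutelyContinuous
      exact hq.ae h1
    filter_upwards [h3] with r hr hr'
    have h4 := hr (by positivity)
    rw [smul_smul, mul_right_comm, inv_mul_cancel₀ hr0.ne', one_mul] at h4
    rw [h4]
    congr 1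
    simp only [hresc]
    rw [intervalIntegral.integral_const_mul, intervalIntegral.mul_integral_comp_mul_left,
      mul_one, mul_inv_cancel_left₀ hr0.ne']

/-- A function whose superlevel sets, for levels in a set `T` of full measure in `(α, τ)`, are
convex bodies `E t` around the origin; `Q` is a countable dense set of levels. -/
structure Leaves {n : ℕ} (w : Euc n → ℝ) (g : Euc n → Euc n) (α : EReal) (τ : ℝ) (T Q : Set ℝ)
    (E : ℝ → Set (Euc n)) : Prop where
  weakGrad : HasWeakGradient w g
  wm : Measurable w
  gm : Measurable g
  countable : Q.Countable
  mem_Q : τ ∈ Q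
  Q_sub : Q ⊆ T
  bounds : ∀ t ∈ T, α < (t : EReal) ∧ t ≤ τ
  full : ∀ᵐ t : ℝ, α < (t : EReal) → t < τ → t ∈ T
  dense : ∀ x y : ℝ, α ≤ (x : EReal) → x < y → y ≤ τ → ∃ q ∈ Q, x < q ∧ q < y
  body : ∀ t ∈ T, IsBody0 (E t)
  anti : ∀ t ∈ T, ∀ t' ∈ T, t ≤ t' → E t' ⊆ E t
  level : ∀ t ∈ T, ∀ᵐ x, t ≤ w x ↔ x ∈ E t
  lower : ∀ᵐ x, α ≤ (w x : EReal)

/-- The supremum of the radial functions of the bodies at levels of `Q` above `t`. -/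
def levRad {n : ℕ} (Q : Set ℝ) (E : ℝ → Set (Euc n)) (t : ℝ) (ω : USphere n) : ℝ :=
  (⨆ q : Q, if t < q then ENNReal.ofReal (rad (E q) ω) else 0).toReal

namespace Leaves

variable {n : ℕ} {w : Euc n → ℝ} {g : Euc n → Euc n} {α : EReal} {τ : ℝ} {T Q : Set ℝ}
  {E : ℝ → Set (Euc n)}

theorem measurable_levRad (L : Leaves w g α τ T Q E) :
    Measurable fun p : ℝ × USphere n => levRad Q E p.1 p.2 := by
  have := L.countable.to_subtype
  refine Measurable.ennreal_toReal (Measurable.iSup fun q => ?_)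
  refine Measurable.ite (measurableSet_lt measurable_fst measurable_const) ?_ measurable_const
  exact (((L.body q (L.Q_sub q.2)).measurable_rad).comp measurable_snd).ennreal_ofReal

theorem exists_lt (L : Leaves w g α τ T Q E) {t : ℝ} (h1 : α < (t : EReal)) (h2 : t ≤ τ) :
    ∃ q ∈ Q, q < t := by
  obtain ⟨x, hx1, hx2⟩ := EReal.lt_iff_exists_real_btwn.1 h1
  obtain ⟨q, hq, -, h⟩ := L.dense x t hx1.le (EReal.coe_lt_coe_iff.1 hx2) h2
  exact ⟨q, hq, h⟩

theorem isLUB_levRad (L : Leaves w g α τ T Q E) {t : ℝ} (h1 : α < (t : EReal)) (h2 : t < τ)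
    (ω : USphere n) : IsLUB {r | ∃ q ∈ Q, t < q ∧ r = rad (E q) ω} (levRad Q E t ω) := by
  obtain ⟨q0, hq0, hq0t⟩ := L.exists_lt h1 h2.le
  have hle : (⨆ q : Q, if t < q then ENNReal.ofReal (rad (E q) ω) else 0) ≤
      ENNReal.ofReal (rad (E q0) ω) := by
    refine iSup_le fun q => ?_
    split_ifs with h
    · exact ENNReal.ofReal_le_ofReal ((L.body q (L.Q_sub q.2)).rad_mono (L.body q0 (L.Q_sub hq0))
        (L.anti q0 (L.Q_sub hq0) q (L.Q_sub q.2) (hq0t.trans h).le) ω)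
    · simp
  have hne := ne_top_of_le_ne_top ENNReal.ofReal_ne_top hle
  constructor
  · rintro _ ⟨q, hq, hqt, rfl⟩
    rw [levRad, ← ENNReal.ofReal_le_iff_le_toReal hne]
    have := le_iSup (fun q : Q => if t < (q : ℝ) then ENNReal.ofReal (rad (E q) ω) else 0) ⟨q, hq⟩
    simpa [hqt] using this
  · intro b hb
    have hb0 : 0 ≤ b := ((L.body τ (L.Q_sub L.mem_Q)).rad_pos ω).le.trans
      (hb ⟨τ, L.mem_Q, h2, rfl⟩)
    rw [levRad]
    refine ENNReal.toReal_le_of_le_ofReal hb0 (iSup_le fun q => ?_)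
    split_ifs with h
    · exact ENNReal.ofReal_le_ofReal (hb ⟨q, q.2, h, rfl⟩)
    · simp

theorem rad_le_levRad (L : Leaves w g α τ T Q E) {t : ℝ} (h1 : α < (t : EReal)) (h2 : t < τ)
    (ω : USphere n) : rad (E τ) ω ≤ levRad Q E t ω :=
  (L.isLUB_levRad h1 h2 ω).1 ⟨τ, L.mem_Q, h2, rfl⟩

theorem levRad_anti (L : Leaves w g α τ T Q E) {t t' : ℝ} (h1 : α < (t : EReal)) (h : t ≤ t')
    (h2 : t' < τ) (ω : USphere n) : levRad Q E t' ω ≤ levRad Q E t ω := by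
  have h1' : α < (t' : EReal) := h1.trans_le (EReal.coe_le_coe_iff.2 h)
  refine (L.isLUB_levRad h1' h2 ω).2 ?_
  rintro _ ⟨q, hq, hqt, rfl⟩
  exact (L.isLUB_levRad h1 (h.trans_lt h2) ω).1 ⟨q, hq, h.trans_lt hqt, rfl⟩

theorem levRad_pos (L : Leaves w g α τ T Q E) {t : ℝ} (h1 : α < (t : EReal)) (h2 : t < τ)
    (ω : USphere n) : 0 < levRad Q E t ω :=
  ((L.body τ (L.Q_sub L.mem_Q)).rad_pos ω).trans_le (L.rad_le_levRad h1 h2 ω)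

/-- For all but countably many levels `levRad` is the radial function of the body itself. -/
theorem levRad_eq (L : Leaves w g α τ T Q E) {t : ℝ} (ht : t ∈ T) (h2 : t < τ)
    (hnull : volume {x | w x = t} = 0) (ω : USphere n) : levRad Q E t ω = rad (E t) ω := by
  have h1 := (L.bounds t ht).1
  have hEt := L.body t ht
  apply le_antisymm
  · refine (L.isLUB_levRad h1 h2 ω).2 ?_
    rintro _ ⟨q, hq, hqt, rfl⟩
    exact (L.body q (L.Q_sub hq)).rad_mono hEt (L.anti t ht q (L.Q_sub hq) hqt.le) ω
  · refine le_of_forall_lt_imp_le_of_dense fun r hr => ?_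
    rcases le_or_gt r 0 with h0 | h0
    · exact h0.trans (L.levRad_pos h1 h2 ω).le
    have hx := hEt.mem_interior_of_lt ω h0.le hr
    set D : Set (Euc n) := ⋃ q ∈ {q ∈ Q | t < q}, E q with hD
    have hDm : ∀ x ∈ D, ∃ q ∈ Q, t < q ∧ x ∈ E q := by
      intro x hx
      simpa [hD, and_assoc] using hx
    have hsub : ∀ᵐ x, x ∈ E t → x ∈ D := by
      have h3 : ∀ᵐ x, ∀ q ∈ Q, (q ≤ w x ↔ x ∈ E q) :=
        (ae_ball_iff L.countable).2 fun q hq => L.level q (L.Q_sub hq)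
      have h4 : ∀ᵐ x, w x ≠ t := by simpa [ae_iff] using hnull
      filter_upwards [h3, h4, L.level t ht] with x hx1 hx2 hx3 hx4
      have hlt : t < w x := lt_of_le_of_ne (hx3.2 hx4) (Ne.symm hx2)
      obtain ⟨q, hq, hq1, hq2⟩ := L.dense t (min (w x) τ) h1.le (lt_min hlt h2) (min_le_right _ _)
      simp only [hD, mem_iUnion]
      exact ⟨q, ⟨hq, hq1⟩, (hx1 q hq).1 (hq2.le.trans (min_le_left _ _))⟩
    have hDconv : Convex ℝ D := by
      intro x hx y hy a b ha hb hab
      obtain ⟨q, hq, hqt, hxq⟩ := hDm x hx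
      obtain ⟨q', hq', hqt', hyq⟩ := hDm y hy
      simp only [hD, mem_iUnion]
      have hm : min q q' ∈ Q := by rcases min_choice q q' with h | h <;> rw [h] <;> assumption
      refine ⟨min q q', ⟨hm, lt_min hqt hqt'⟩, ?_⟩
      exact (L.body _ (L.Q_sub hm)).convex
        (L.anti _ (L.Q_sub hm) _ (L.Q_sub hq) (min_le_left _ _) hxq)
        (L.anti _ (L.Q_sub hm) _ (L.Q_sub hq') (min_le_right _ _) hyq) ha hb hab
    have hEτD : E τ ⊆ D := fun y hy => by
      simp only [hD, mem_iUnion]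
      exact ⟨τ, ⟨L.mem_Q, h2⟩, hy⟩
    have hDne : (interior D).Nonempty :=
      ⟨0, interior_mono hEτD (mem_interior_iff_mem_nhds.2 (L.body τ (L.Q_sub L.mem_Q)).nhds)⟩
    have hclos : interior (E t) ⊆ closure D := by
      intro y hy
      rw [mem_closure_iff_nhds]
      intro U hU
      obtain ⟨V, hVU, hV, hyV⟩ := mem_nhds_iff.1 hU
      have hpos : volume (V ∩ interior (E t)) ≠ 0 :=
        (hV.inter isOpen_interior).measure_ne_zero volume ⟨y, hyV, hy⟩
      obtain ⟨z, hz, hz'⟩ := ((frequently_ae_mem_iff.2 hpos).and_eventually hsub).exists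
      exact ⟨z, hVU hz.1, hz' (interior_subset hz.2)⟩
    have hxD : r • (ω : Euc n) ∈ D := by
      have := (isOpen_interior.subset_interior_iff).2 hclos hx
      rw [hDconv.interior_closure_eq_interior_of_nonempty_interior hDne] at this
      exact interior_subset this
    obtain ⟨q, hq, hqt, hxq⟩ := hDm _ hxD
    exact (((L.body q (L.Q_sub hq)).smul_mem_iff ω h0.le).1 hxq).trans
      ((L.isLUB_levRad h1 h2 ω).1 ⟨q, hq, hqt, rfl⟩)

theorem ae_levRad_eq (L : Leaves w g α τ T Q E) :
    ∀ᵐ t : ℝ, α < (t : EReal) → t < τ → ∀ ω, levRad Q E t ω = rad (E t) ω := by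
  have hc : ∀ᵐ t : ℝ, volume {x | w x = t} = 0 := by
    have h1 := (Measure.countable_meas_level_set_pos (μ := (volume : Measure (Euc n))) L.wm)
    filter_upwards [h1.ae_notMem volume] with t ht
    simpa using ht
  filter_upwards [hc, L.full] with t h1 h2 h3 h4 ω
  exact L.levRad_eq (h2 h3 h4) h4 h1 ω

theorem levRad_rightCont (L : Leaves w g α τ T Q E) {t : ℝ} (h1 : α < (t : EReal)) (h2 : t < τ)
    (ω : USphere n) : Tendsto (fun h => levRad Q E h ω) (𝓝[>] t) (𝓝 (levRad Q E t ω)) := by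
  rw [tendsto_order]
  have hev : ∀ᶠ h in 𝓝[>] t, t < h ∧ h < τ := Ioo_mem_nhdsGT h2
  constructor
  · intro a ha
    obtain ⟨_, ⟨q, hq, hqt, rfl⟩, hb⟩ := (lt_isLUB_iff (L.isLUB_levRad h1 h2 ω)).1 ha
    filter_upwards [hev, Ioo_mem_nhdsGT hqt] with h hh hh'
    exact hb.trans_le ((L.isLUB_levRad (h1.trans (EReal.coe_lt_coe_iff.2 hh.1)) hh.2 ω).1
      ⟨q, hq, hh'.2, rfl⟩)
  · intro a ha
    filter_upwards [hev] with h hh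
    exact (L.levRad_anti h1 hh.1.le hh.2 ω).trans_lt ha

end Leaves

/-- Behaviour of `w` along the ray through `ω`, described by its continuous version `f`. -/
structure IsRay {n : ℕ} (w : Euc n → ℝ) (g : Euc n → Euc n) (α : EReal) (τ : ℝ) (Q : Set ℝ)
    (E : ℝ → Set (Euc n)) (ω : USphere n) (f : ℝ → ℝ) : Prop where
  int : ∀ a b : ℝ, 0 < a → IntegrableOn (radG g ω) (Icc a b)
  ftc : ∀ a b : ℝ, 0 < a → 0 < b → f b - f a = ∫ r in a..b, radG g ω r
  eq : ∀ᵐ r : ℝ, 0 < r → w (r • (ω : Euc n)) = f r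
  lower : ∀ r : ℝ, 0 < r → α ≤ (f r : EReal)
  f_lev : ∀ t : ℝ, α < (t : EReal) → t < τ → f (levRad Q E t ω) = t
  f_top : f (rad (E τ) ω) = τ
  anti : AntitoneOn f (Ici (rad (E τ) ω))
  deriv : ∀ᵐ r : ℝ, 0 < r → HasDerivAt f (radG g ω r) r
  nonpos : ∀ᵐ r : ℝ, rad (E τ) ω < r → radG g ω r ≤ 0

theorem ae_frequently_Ioo {P : ℝ → Prop} (h : ∀ᵐ r : ℝ, P r) {a b : ℝ} (hab : a < b) :
    ∃ r ∈ Ioo a b, P r := by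
  have : volume (Ioo a b) ≠ 0 := by simp [hab]
  exact ((frequently_ae_mem_iff.2 this).and_eventually h).exists

namespace Leaves

variable {n : ℕ} {w : Euc n → ℝ} {g : Euc n → Euc n} {α : EReal} {τ : ℝ} {T Q : Set ℝ}
  {E : ℝ → Set (Euc n)}

theorem ae_isRay (hn : 1 ≤ n) (L : Leaves w g α τ T Q E) :
    ∀ᵐ ω : USphere n ∂sphMeas n, ∃ f, IsRay w g α τ Q E ω f := by
  have hlev : ∀ᵐ x, (∀ q ∈ Q, (q ≤ w x ↔ x ∈ E q)) ∧ α ≤ (w x : EReal) :=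
    ((ae_ball_iff L.countable).2 fun q hq => L.level q (L.Q_sub hq)).and L.lower
  filter_upwards [ray_absolutelyContinuous hn L.wm L.gm L.weakGrad, ae_ray hn hlev] with ω
    ⟨f, hint, hftc, hwf⟩ hω
  have hbτ := L.body τ (L.Q_sub L.mem_Q)
  have hτ0 := hbτ.rad_pos ω
  have hii : ∀ a b : ℝ, 0 < a → 0 < b → IntervalIntegrable (radG g ω) volume a b := by
    intro a b ha hb
    rcases le_total a b with h | h
    · exact (intervalIntegrable_iff_integrableOn_Icc_of_le h).2 (hint a b ha)
    · exact ((intervalIntegrable_iff_integrableOn_Icc_of_le h).2 (hint b a hb)).symm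
  have hcont : ∀ r : ℝ, 0 < r → ContinuousAt f r := by
    intro r hr
    have h1 : ContinuousOn (fun b => ∫ s in (r / 2)..b, radG g ω s) (uIcc (r / 2) (r + 1)) :=
      intervalIntegral.continuousOn_primitive_interval' (hii _ _ (by positivity) (by positivity))
        left_mem_uIcc
    rw [uIcc_of_le (by linarith)] at h1
    have h2 := (h1.continuousAt (Icc_mem_nhds (by linarith) (by linarith) :
      Icc (r / 2) (r + 1) ∈ 𝓝 r)).const_add (f (r / 2))
    refine h2.congr ?_
    filter_upwards [Ioi_mem_nhds hr] with b hb
    rw [← hftc _ _ (by positivity) hb]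
    ring
  have hall : ∀ᵐ r : ℝ, 0 < r → (∀ q ∈ Q, (q ≤ f r ↔ r ≤ rad (E q) ω)) ∧ α ≤ (f r : EReal) := by
    filter_upwards [hwf, hω] with r h1 h2 h3
    rw [← h1 h3]
    refine ⟨fun q hq => ?_, (h2 h3).2⟩
    rw [(h2 h3).1 q hq, (L.body q (L.Q_sub hq)).smul_mem_iff ω h3.le]
  -- closed conditions hold everywhere
  have hup : ∀ q ∈ Q, ∀ r, 0 < r → r ≤ rad (E q) ω → q ≤ f r := by
    intro q hq r hr hrq
    by_contra hlt
    obtain ⟨a, ha, h⟩ := exists_Ioc_subset_of_mem_nhds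
      ((hcont r hr).eventually_lt continuousAt_const (not_le.1 hlt)) ⟨r - 1, by linarith⟩
    obtain ⟨r', hr', hP⟩ := ae_frequently_Ioo hall (max_lt ha hr)
    have := (hP ((le_max_right _ _).trans_lt hr'.1)).1 q hq
    exact absurd (this.2 (hr'.2.le.trans hrq))
      (not_le.2 (h ⟨(le_max_left _ _).trans_lt hr'.1, hr'.2.le⟩))
  have hdown : ∀ q ∈ Q, ∀ r, rad (E q) ω ≤ r → f r ≤ q := by
    intro q hq r hrq
    have hr := ((L.body q (L.Q_sub hq)).rad_pos ω).trans_le hrq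
    by_contra hlt
    obtain ⟨a, ha, h⟩ := exists_Ico_subset_of_mem_nhds
      (continuousAt_const.eventually_lt (hcont r hr) (not_le.1 hlt)) ⟨r + 1, by linarith⟩
    obtain ⟨r', hr', hP⟩ := ae_frequently_Ioo hall ha
    have h0 := hr.trans hr'.1
    have := ((hP h0).1 q hq).1 (le_of_lt (h ⟨hr'.1.le, hr'.2⟩))
    exact absurd (this.trans hrq) (not_le.2 hr'.1)
  have hlow : ∀ r : ℝ, 0 < r → α ≤ (f r : EReal) := by
    intro r hr
    by_contra hlt
    have hc : ContinuousAt (fun r => (f r : EReal)) r :=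
      continuous_coe_real_ereal.continuousAt.comp (hcont r hr)
    obtain ⟨a, ha, h⟩ := exists_Ico_subset_of_mem_nhds
      (hc.eventually_lt continuousAt_const (not_le.1 hlt)) ⟨r + 1, by linarith⟩
    obtain ⟨r', hr', hP⟩ := ae_frequently_Ioo hall ha
    exact absurd (hP (hr.trans hr'.1)).2 (not_le.2 (h ⟨hr'.1.le, hr'.2⟩))
  have htop : ∀ r, rad (E τ) ω ≤ r → f r ≤ τ := hdown τ L.mem_Q
  have hanti : AntitoneOn f (Ici (rad (E τ) ω)) := by
    intro a ha b hb hab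
    by_contra hlt
    have ha0 : 0 < a := hτ0.trans_le ha
    obtain ⟨q, hq, h1, h2⟩ := L.dense (f a) (f b) (hlow a ha0) (not_le.1 hlt) (htop b hb)
    have h3 : rad (E q) ω ≤ b := by
      by_contra h
      exact absurd (hup q hq a ha0 (hab.trans (not_le.1 h).le)) (not_le.2 h1)
    exact absurd (hdown q hq b h3) (not_le.2 h2)
  have hlevel : ∀ t : ℝ, α < (t : EReal) → t < τ → f (levRad Q E t ω) = t := by
    intro t h1 h2
    have hlub := L.isLUB_levRad h1 h2 ω
    have hS0 := L.levRad_pos h1 h2 ω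
    have hSτ := L.rad_le_levRad h1 h2 ω
    apply le_antisymm
    · by_contra hlt
      obtain ⟨q, hq, hq1, hq2⟩ := L.dense t _ h1.le (not_le.1 hlt) (htop _ hSτ)
      exact absurd (hdown q hq _ (hlub.1 ⟨q, hq, hq1, rfl⟩)) (not_le.2 hq2)
    · by_contra hlt
      obtain ⟨q, hq, hq1, hq2⟩ := L.dense _ t (hlow _ hS0) (not_le.1 hlt) h2.le
      have h3 : rad (E q) ω < levRad Q E t ω := by
        by_contra h
        exact absurd (hup q hq _ hS0 (not_lt.1 h)) (not_le.2 hq1)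
      obtain ⟨_, ⟨q', hq', hqt, rfl⟩, hb⟩ := (lt_isLUB_iff hlub).1 h3
      exact absurd ((L.body q' (L.Q_sub hq')).rad_mono (L.body q (L.Q_sub hq))
        (L.anti q (L.Q_sub hq) q' (L.Q_sub hq') (hq2.trans hqt).le) ω) (not_le.2 hb)
  have hderiv : ∀ᵐ r : ℝ, 0 < r → HasDerivAt f (radG g ω r) r := by
    have h1 : ∀ m : ℕ, ∀ᵐ r : ℝ, r ∈ uIcc ((m : ℝ) + 1)⁻¹ (m + 1) →
        ∀ c ∈ uIcc ((m : ℝ) + 1)⁻¹ (m + 1),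
        HasDerivAt (fun x => ∫ t in c..x, radG g ω t) (radG g ω r) r := fun m =>
      (hii _ _ (by positivity) (by positivity)).ae_hasDerivAt_integral
    filter_upwards [ae_all_iff.2 h1] with r hr h0
    obtain ⟨m, hm⟩ := exists_nat_ge (max r r⁻¹)
    have hm1 : r ≤ m := (le_max_left _ _).trans hm
    have hm2 : r⁻¹ ≤ m := (le_max_right _ _).trans hm
    have hr1 : ((m : ℝ) + 1)⁻¹ ≤ r := by
      rw [inv_le_comm₀ (by positivity) h0]; linarith
    have hmem : r ∈ uIcc ((m : ℝ) + 1)⁻¹ (m + 1) := by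
      rw [uIcc_of_le (hr1.trans (by linarith))]
      exact ⟨hr1, by linarith⟩
    have h2 := (hr m hmem r hmem).const_add (f r)
    refine h2.congr_of_eventuallyEq ?_
    filter_upwards [Ioi_mem_nhds h0] with b hb
    rw [← hftc _ _ h0 hb]
    ring
  refine ⟨f, hint, hftc, hwf, hlow, hlevel, ?_, hanti, hderiv, ?_⟩
  · exact le_antisymm (htop _ le_rfl) (hup τ L.mem_Q _ hτ0 le_rfl)
  · filter_upwards [hderiv] with r hr hrτ
    have h1 := (hr (hτ0.trans hrτ)).hasDerivWithinAt (s := Ici (rad (E τ) ω))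
    have h2 := h1.derivWithin (uniqueDiffWithinAt_of_mem_nhds (Ici_mem_nhds hrτ))
    rw [← h2]
    exact hanti.derivWithin_nonpos

end Leaves

theorem ae_of_ae_ray {n : ℕ} (hn : 1 ≤ n) {P : Euc n → Prop} (hP : MeasurableSet {x | P x})
    (h : ∀ᵐ ω : USphere n ∂sphMeas n, ∀ᵐ r : ℝ, 0 < r → P (r • (ω : Euc n))) : ∀ᵐ x, P x := by
  have h1 := lintegral_polar hn ({x | P x}ᶜ.indicator 1) (measurable_one.indicator hP.compl)
  rw [lintegral_indicator_one hP.compl] at h1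
  rw [ae_iff]
  change volume {x | P x}ᶜ = 0
  rw [h1]
  refine lintegral_eq_zero_of_ae_eq_zero ?_
  filter_upwards [h] with ω hω
  refine lintegral_eq_zero_of_ae_eq_zero ?_
  filter_upwards [ae_restrict_of_ae hω, ae_restrict_mem measurableSet_Ioi] with r hr hr0
  have h2 : r • (ω : Euc n) ∉ {x | P x}ᶜ := fun h => h (hr hr0)
  simp [indicator_of_notMem h2]

namespace Leaves

variable {n : ℕ} {w : Euc n → ℝ} {g : Euc n → Euc n} {α : EReal} {τ : ℝ} {T Q : Set ℝ}
  {E : ℝ → Set (Euc n)}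

/-- The open interval of levels. -/
def lvl (α : EReal) (τ : ℝ) : Set ℝ := {t : ℝ | α < (t : EReal) ∧ t < τ}

theorem measurableSet_lvl : MeasurableSet (lvl α τ) :=
  (measurableSet_lt measurable_const measurable_coe_real_ereal).inter measurableSet_Iio

theorem bodyTop (L : Leaves w g α τ T Q E) : IsBody0 (E τ) := L.body τ (L.Q_sub L.mem_Q)

theorem measurable_inner (L : Leaves w g α τ T Q E) : Measurable fun x => ⟪g x, x⟫ :=
  L.gm.inner measurable_id

theorem ae_inner_nonpos (hn : 1 ≤ n) (L : Leaves w g α τ T Q E) :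
    ∀ᵐ x, x ∉ E τ → ⟪g x, x⟫ ≤ 0 := by
  refine ae_of_ae_ray hn ?_ ?_
  · exact L.bodyTop.compact.measurableSet.compl.imp
      (measurableSet_le L.measurable_inner measurable_const)
  · filter_upwards [L.ae_isRay hn] with ω ⟨f, hf⟩
    filter_upwards [hf.nonpos] with r hr h0 hrE
    have h1 : rad (E τ) ω < r := not_le.1 fun h => hrE ((L.bodyTop.smul_mem_iff ω h0.le).2 h)
    rw [inner_smul_right]
    exact mul_nonpos_of_nonneg_of_nonpos h0.le (hr h1)

theorem ray_inverse (L : Leaves w g α τ T Q E) {ω : USphere n} {f : ℝ → ℝ}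
    (hf : IsRay w g α τ Q E ω f) (H : ℝ → ℝ≥0∞) (hH : Measurable H) :
    ∫⁻ r in Ioi (rad (E τ) ω), H r * ENNReal.ofReal (-radG g ω r) =
      ∫⁻ t in lvl α τ, H (levRad Q E t ω) := by
  have h0 := L.bodyTop.rad_pos ω
  refine lintegral_inverse_levels (f := f) ?_ ?_ ?_ hf.nonpos ?_ ?_ hf.f_top ?_ ?_ H hH
  · exact (measurable_radG L.gm).comp measurable_prodMk_left
  · exact L.measurable_levRad.comp measurable_prodMk_right
  · exact fun b => (hf.int _ b h0).mono_set Ioc_subset_Icc_self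
  · exact fun a b ha hab => hf.ftc a b (h0.trans_le ha) (h0.trans_le (ha.trans hab))
  · exact fun r hr => hf.lower r (h0.trans_le hr)
  · exact Eventually.of_forall fun t h1 h2 => L.rad_le_levRad h1 h2 ω
  · exact Eventually.of_forall fun t h1 h2 => hf.f_lev t h1 h2

/-- A property of almost every radius holds at almost every level. -/
theorem ray_ae (L : Leaves w g α τ T Q E) {ω : USphere n} {f : ℝ → ℝ}
    (hf : IsRay w g α τ Q E ω f) {P : ℝ → Prop} (hP : ∀ᵐ r : ℝ, 0 < r → P r) :
    ∀ᵐ t : ℝ, t ∈ lvl α τ → P (levRad Q E t ω) := by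
  obtain ⟨N, hN, hNm, hN0⟩ := exists_measurable_superset_of_null (ae_iff.1 hP)
  have h := L.ray_inverse hf (N.indicator 1) (measurable_one.indicator hNm)
  have hz : ∫⁻ r in Ioi (rad (E τ) ω), N.indicator 1 r * ENNReal.ofReal (-radG g ω r) = 0 := by
    refine lintegral_eq_zero_of_ae_eq_zero (ae_restrict_of_ae ?_)
    filter_upwards [measure_eq_zero_iff_ae_notMem.1 hN0] with r hr
    simp [indicator_of_notMem hr]
  rw [hz] at h
  have hm : Measurable fun t => N.indicator (1 : ℝ → ℝ≥0∞) (levRad Q E t ω) :=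
    (measurable_one.indicator hNm).comp (L.measurable_levRad.comp measurable_prodMk_right)
  have h2 := (lintegral_eq_zero_iff hm).1 h.symm
  filter_upwards [(ae_restrict_iff' measurableSet_lvl).1 h2] with t ht hI
  have h3 : levRad Q E t ω ∉ N := fun hmem => by
    have := ht hI
    simp [indicator_of_mem hmem] at this
  by_contra hcon
  exact h3 (hN fun h => hcon (h (L.levRad_pos hI.1 hI.2 ω)))

/-- Integration over the level sets. -/
theorem lintegral_levels (hn : 1 ≤ n) (L : Leaves w g α τ T Q E) (F : Euc n → ℝ≥0∞)
    (hF : Measurable F) :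
    ∫⁻ x in (E τ)ᶜ, F x * ENNReal.ofReal (-⟪g x, x⟫) =
      ∫⁻ t in lvl α τ, (∫⁻ ω, F (levRad Q E t ω • (ω : Euc n)) *
        ENNReal.ofReal (levRad Q E t ω ^ n) ∂sphMeas n) := by
  have hEm := L.bodyTop.compact.measurableSet
  have hFm : Measurable fun x => F x * ENNReal.ofReal (-⟪g x, x⟫) :=
    hF.mul L.measurable_inner.neg.ennreal_ofReal
  rw [← lintegral_indicator hEm.compl, lintegral_polar hn _ (hFm.indicator hEm.compl)]
  have hstep : ∀ᵐ ω : USphere n ∂sphMeas n, (∫⁻ r in Ioi (0 : ℝ),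
      (E τ)ᶜ.indicator (fun x => F x * ENNReal.ofReal (-⟪g x, x⟫)) (r • (ω : Euc n)) *
        ENNReal.ofReal (r ^ (n - 1))) = ∫⁻ t in lvl α τ, F (levRad Q E t ω • (ω : Euc n)) *
        ENNReal.ofReal (levRad Q E t ω ^ n) := by
    filter_upwards [L.ae_isRay hn] with ω ⟨f, hf⟩
    rw [← L.ray_inverse hf (fun r => F (r • (ω : Euc n)) * ENNReal.ofReal (r ^ n))
      ((hF.comp (by fun_prop)).mul (by fun_prop)), ← lintegral_indicator measurableSet_Ioi,
      ← lintegral_indicator measurableSet_Ioi]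
    refine lintegral_congr fun r => ?_
    have h0 := L.bodyTop.rad_pos ω
    by_cases hr : rad (E τ) ω < r
    · have hr0 := h0.trans hr
      have hmem : r • (ω : Euc n) ∈ (E τ)ᶜ := fun h =>
        absurd ((L.bodyTop.smul_mem_iff ω hr0.le).1 h) (not_le.2 hr)
      rw [indicator_of_mem (show r ∈ Ioi 0 from hr0), indicator_of_mem hmem,
        indicator_of_mem (show r ∈ Ioi _ from hr), inner_smul_right, ← mul_neg,
        ENNReal.ofReal_mul hr0.le, ← pow_sub_one_mul (by omega : n ≠ 0) r,
        ENNReal.ofReal_mul (pow_nonneg hr0.le _)]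
      simp only [radG]
      ring
    · rw [indicator_of_notMem (s := Ioi (rad (E τ) ω)) hr]
      by_cases hr0 : 0 < r
      · have hmem : r • (ω : Euc n) ∉ (E τ)ᶜ := fun h =>
          h ((L.bodyTop.smul_mem_iff ω hr0.le).2 (not_lt.1 hr))
        rw [indicator_of_mem (show r ∈ Ioi 0 from hr0), indicator_of_notMem hmem, zero_mul]
      · rw [indicator_of_notMem (s := Ioi (0 : ℝ)) hr0]
  rw [lintegral_congr_ae hstep]
  refine lintegral_lintegral_swap (Measurable.aemeasurable ?_)
  have hS : Measurable fun p : USphere n × ℝ => levRad Q E p.2 p.1 :=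
    L.measurable_levRad.comp measurable_swap
  exact (hF.comp (hS.smul (measurable_subtype_coe.comp measurable_fst))).mul
    (hS.pow_const n).ennreal_ofReal

/-- A property which holds almost everywhere where `⟪g x, x⟫ ≠ 0` holds at almost every point of
almost every level set. -/
theorem ae_levels (hn : 1 ≤ n) (L : Leaves w g α τ T Q E) {P : Euc n → Prop}
    (hP : ∀ᵐ x, x ∉ E τ → ⟪g x, x⟫ ≠ 0 → P x) :
    ∀ᵐ t : ℝ, t ∈ lvl α τ →
      ∀ᵐ ω : USphere n ∂sphMeas n, P (levRad Q E t ω • (ω : Euc n)) := by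
  obtain ⟨N, hN, hNm, hN0⟩ := exists_measurable_superset_of_null (ae_iff.1 hP)
  set M : Set (Euc n) := N ∪ ({x | ⟪g x, x⟫ = 0} ∪ E τ) with hM
  have hEm := L.bodyTop.compact.measurableSet
  have hMm : MeasurableSet M :=
    hNm.union ((measurableSet_eq_fun L.measurable_inner measurable_const).union hEm)
  have h := L.lintegral_levels hn (M.indicator 1) (measurable_one.indicator hMm)
  have hz : ∫⁻ x in (E τ)ᶜ, M.indicator 1 x * ENNReal.ofReal (-⟪g x, x⟫) = 0 := by
    refine lintegral_eq_zero_of_ae_eq_zero ?_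
    filter_upwards [ae_restrict_of_ae (measure_eq_zero_iff_ae_notMem.1 hN0),
      ae_restrict_mem hEm.compl] with x hx hxE
    by_cases h0 : ⟪g x, x⟫ = 0
    · simp [h0]
    · have : x ∉ M := by
        simp only [hM, mem_union, not_or]
        exact ⟨hx, h0, hxE⟩
      simp [indicator_of_notMem this]
  rw [hz] at h
  have hSm : Measurable fun p : ℝ × USphere n => levRad Q E p.1 p.2 • (p.2 : Euc n) :=
    L.measurable_levRad.smul (measurable_subtype_coe.comp measurable_snd)
  have hm : Measurable fun p : ℝ × USphere n =>
      M.indicator (1 : Euc n → ℝ≥0∞) (levRad Q E p.1 p.2 • (p.2 : Euc n)) *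
        ENNReal.ofReal (levRad Q E p.1 p.2 ^ n) :=
    ((measurable_one.indicator hMm).comp hSm).mul (L.measurable_levRad.pow_const n).ennreal_ofReal
  have h1 := (lintegral_eq_zero_iff hm.lintegral_prod_right').1 h.symm
  filter_upwards [(ae_restrict_iff' measurableSet_lvl).1 h1] with t ht hI
  have h2 := (lintegral_eq_zero_iff (hm.comp measurable_prodMk_left)).1 (ht hI)
  filter_upwards [h2] with ω hω
  have hpos := L.levRad_pos hI.1 hI.2 ω
  have h3 : levRad Q E t ω • (ω : Euc n) ∉ M := fun hmem => by
    simp only [Function.comp_apply, indicator_of_mem hmem, Pi.one_apply, one_mul, Pi.zero_apply,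
      ENNReal.ofReal_eq_zero] at hω
    exact absurd hω (not_le.2 (pow_pos hpos n))
  simp only [hM, mem_union, not_or] at h3
  by_contra hcon
  exact h3.1 (hN fun hh => hcon (hh h3.2.2 h3.2.1))

/-- Swapping the order of the almost everywhere quantifiers over levels and directions. -/
theorem ae_lvl_comm {P : ℝ → USphere n → Prop}
    (hP : MeasurableSet {p : ℝ × USphere n | P p.1 p.2})
    (h : ∀ᵐ ω ∂sphMeas n, ∀ᵐ t : ℝ, t ∈ lvl α τ → P t ω) :
    ∀ᵐ t : ℝ, t ∈ lvl α τ → ∀ᵐ ω ∂sphMeas n, P t ω := by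
  have hm : MeasurableSet {p : ℝ × USphere n | p.1 ∈ lvl α τ → P p.1 p.2} :=
    (measurableSet_lvl.preimage measurable_fst).imp hP
  have h1 := (Measure.ae_ae_comm (μ := volume) (ν := sphMeas n) hm).2 h
  filter_upwards [h1] with t ht hI
  filter_upwards [ht] with ω hω using hω hI

theorem measurable_levPoint (L : Leaves w g α τ T Q E) :
    Measurable fun p : ℝ × USphere n => levRad Q E p.1 p.2 • (p.2 : Euc n) :=
  L.measurable_levRad.smul (measurable_subtype_coe.comp measurable_snd)

theorem ae_level_eq (hn : 1 ≤ n) (L : Leaves w g α τ T Q E) :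
    ∀ᵐ t : ℝ, t ∈ lvl α τ →
      ∀ᵐ ω : USphere n ∂sphMeas n, w (levRad Q E t ω • (ω : Euc n)) = t := by
  refine ae_lvl_comm (measurableSet_eq_fun (L.wm.comp L.measurable_levPoint) measurable_fst) ?_
  filter_upwards [L.ae_isRay hn] with ω ⟨f, hf⟩
  filter_upwards [L.ray_ae hf hf.eq] with t ht hI
  rw [ht hI, hf.f_lev t hI.1 hI.2]

end Leaves

theorem tendsto_div_of_rat {m : ℝ → ℝ} {δ k : ℝ} (hδ : 0 < δ) (hk : 0 ≤ k)
    (hm : ∀ a b, 0 < a → a ≤ b → b < δ → m a ≤ m b) (hm0 : ∀ a, 0 < a → a < δ → 0 ≤ m a)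
    (h : Tendsto (fun q : ℚ => m q / q) (comap (Rat.cast : ℚ → ℝ) (𝓝[>] 0)) (𝓝 k)) :
    Tendsto (fun h => m h / h) (𝓝[>] 0) (𝓝 k) := by
  have hev : ∀ {P : ℚ → Prop}, (∀ᶠ q in comap (Rat.cast : ℚ → ℝ) (𝓝[>] 0), P q) →
      ∃ ε > 0, ∀ q : ℚ, 0 < (q : ℝ) → (q : ℝ) < ε → P q := by
    intro P hP
    obtain ⟨s, hs, hsP⟩ := hP
    obtain ⟨ε, hε, h2⟩ := (mem_nhdsGT_iff_exists_Ioo_subset).1 hs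
    exact ⟨ε, hε, fun q h0 h1 => hsP (h2 ⟨h0, h1⟩)⟩
  rw [tendsto_order]
  constructor
  · intro a ha
    rcases lt_or_ge a 0 with h0 | h0
    · filter_upwards [Ioo_mem_nhdsGT hδ] with x hx
      exact h0.trans_le (div_nonneg (hm0 x hx.1 hx.2) hx.1.le)
    · obtain ⟨a', h1, h2⟩ := exists_between ha
      have ha' : 0 < a' := h0.trans_lt h1
      obtain ⟨ε, hε, hq⟩ := hev ((tendsto_order.1 h).1 a' h2)
      filter_upwards [Ioo_mem_nhdsGT (lt_min hδ hε)] with x hx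
      have hx1 := hx.2.trans_le (min_le_left _ _)
      have hx2 := hx.2.trans_le (min_le_right _ _)
      have hlt : x * a / a' < x := by
        rw [div_lt_iff₀ ha']; exact mul_lt_mul_of_pos_left h1 hx.1
      obtain ⟨q, hq1, hq2⟩ := exists_rat_btwn hlt
      have hq0 : (0 : ℝ) < q := lt_of_le_of_lt (by have := hx.1; positivity) hq1
      have h3 := hq q hq0 (hq2.trans hx2)
      rw [lt_div_iff₀ hq0] at h3
      rw [div_lt_iff₀ ha'] at hq1
      rw [lt_div_iff₀ hx.1]
      have := hm q x hq0 hq2.le hx1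
      nlinarith
  · intro b hb
    obtain ⟨b', h1, h2⟩ := exists_between hb
    have hb' : 0 < b' := hk.trans_lt h1
    obtain ⟨ε, hε, hq⟩ := hev ((tendsto_order.1 h).2 b' h1)
    have hbb : 0 < b' / b := div_pos hb' (hb'.trans h2)
    filter_upwards [Ioo_mem_nhdsGT (mul_pos (lt_min hδ hε) hbb)] with x hx
    have hb0 := hb'.trans h2
    have hlt : x < x * b / b' := by
      rw [lt_div_iff₀ hb']; exact mul_lt_mul_of_pos_left h2 hx.1
    obtain ⟨q, hq1, hq2⟩ := exists_rat_btwn hlt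
    have hq0 : (0 : ℝ) < q := hx.1.trans hq1
    have hqm : (q : ℝ) < min δ ε := by
      refine hq2.trans ?_
      rw [div_lt_iff₀ hb']
      have := hx.2
      rw [← mul_div_assoc, lt_div_iff₀ hb0] at this
      exact this
    have h3 := hq q hq0 (hqm.trans_le (min_le_right _ _))
    rw [div_lt_iff₀ hq0] at h3
    rw [lt_div_iff₀ hb'] at hq2
    rw [div_lt_iff₀ hx.1]
    have := hm x q hx.1 hq1.le (hqm.trans_le (min_le_left _ _))
    nlinarith

namespace Leaves

variable {n : ℕ} {w : Euc n → ℝ} {g : Euc n → Euc n} {α : EReal} {τ : ℝ} {T Q : Set ℝ}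
  {E : ℝ → Set (Euc n)}

theorem ray_deriv (L : Leaves w g α τ T Q E) {ω : USphere n} {f : ℝ → ℝ}
    (hf : IsRay w g α τ Q E ω f) {t G : ℝ} (ht : t ∈ lvl α τ) (hG : G ≠ 0)
    (hd : HasDerivAt f G (levRad Q E t ω)) :
    Tendsto (fun h => (levRad Q E t ω - levRad Q E (t + h) ω) / h) (𝓝[>] 0) (𝓝 (-G⁻¹)) := by
  have hs := (hasDerivAt_iff_tendsto_slope.1 hd)
  have hsh : Tendsto (fun h : ℝ => t + h) (𝓝[>] 0) (𝓝[>] t) := by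
    refine tendsto_nhdsWithin_iff.2 ⟨?_, ?_⟩
    · have : Tendsto (fun h : ℝ => t + h) (𝓝 0) (𝓝 (t + 0)) :=
        (continuous_const.add continuous_id).tendsto 0
      rw [add_zero] at this
      exact this.mono_left nhdsWithin_le_nhds
    · filter_upwards [self_mem_nhdsWithin] with h hh
      simpa using hh
  have hev : ∀ᶠ h : ℝ in 𝓝[>] 0, 0 < h ∧ t + h ∈ lvl α τ := by
    filter_upwards [Ioo_mem_nhdsGT (sub_pos.2 ht.2)] with h hh
    exact ⟨hh.1, ht.1.trans (EReal.coe_lt_coe_iff.2 (by linarith [hh.1])), by linarith [hh.2]⟩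
  have hS : Tendsto (fun h => levRad Q E (t + h) ω) (𝓝[>] 0) (𝓝[≠] (levRad Q E t ω)) := by
    refine tendsto_nhdsWithin_iff.2 ⟨(L.levRad_rightCont ht.1 ht.2 ω).comp hsh, ?_⟩
    filter_upwards [hev] with h ⟨h0, hh⟩ heq
    have h1 := hf.f_lev _ hh.1 hh.2
    rw [mem_singleton_iff] at heq
    rw [heq, hf.f_lev t ht.1 ht.2] at h1
    linarith
  have h3 := ((hs.comp hS).inv₀ hG).neg
  refine h3.congr' ?_
  filter_upwards [hev] with h ⟨h0, hh⟩
  simp only [Function.comp_apply, slope_def_field]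
  rw [hf.f_lev t ht.1 ht.2, hf.f_lev _ hh.1 hh.2, inv_div, ← neg_div, neg_sub,
    add_sub_cancel_left]

/-- The radial function decreases in the level at the rate prescribed by the gradient. -/
theorem ae_levRad_deriv (hn : 1 ≤ n) (L : Leaves w g α τ T Q E) :
    ∀ᵐ t : ℝ, t ∈ lvl α τ → ∀ᵐ ω : USphere n ∂sphMeas n,
      radG g ω (levRad Q E t ω) ≠ 0 →
      Tendsto (fun h => (levRad Q E t ω - levRad Q E (t + h) ω) / h) (𝓝[>] 0)
        (𝓝 (-(radG g ω (levRad Q E t ω))⁻¹)) := by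
  set l : Filter ℚ := comap (Rat.cast : ℚ → ℝ) (𝓝[>] 0)
  have hGm : Measurable fun p : ℝ × USphere n => radG g p.2 (levRad Q E p.1 p.2) :=
    (measurable_radG L.gm).comp ((measurable_subtype_coe.comp measurable_snd).prodMk
      L.measurable_levRad)
  have hdm : ∀ q : ℚ, Measurable fun p : ℝ × USphere n =>
      (levRad Q E p.1 p.2 - levRad Q E (p.1 + q) p.2) / (q : ℝ) := fun q =>
    (L.measurable_levRad.sub (L.measurable_levRad.comp
      ((measurable_fst.add_const _).prodMk measurable_snd))).div_const _
  have key : ∀ᵐ t : ℝ, t ∈ lvl α τ → ∀ᵐ ω : USphere n ∂sphMeas n,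
      radG g ω (levRad Q E t ω) ≠ 0 →
      Tendsto (fun q : ℚ => (levRad Q E t ω - levRad Q E (t + q) ω) / (q : ℝ)) l
        (𝓝 (-(radG g ω (levRad Q E t ω))⁻¹)) := by
    refine ae_lvl_comm ?_ ?_
    · refine MeasurableSet.imp (measurableSet_eq_fun hGm measurable_const).compl ?_
      exact measurableSet_tendsto_fun hdm hGm.inv.neg
    · filter_upwards [L.ae_isRay hn] with ω ⟨f, hf⟩
      filter_upwards [L.ray_ae hf hf.deriv] with t ht hI hG
      exact (L.ray_deriv hf hI hG (ht hI)).comp tendsto_comap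
  filter_upwards [key] with t ht hI
  filter_upwards [ht hI] with ω hω hG
  have hδ : 0 < τ - t := sub_pos.2 hI.2
  have hI' : ∀ a, 0 ≤ a → a < τ - t → t + a ∈ lvl α τ := fun a h1 h2 =>
    ⟨hI.1.trans_le (EReal.coe_le_coe_iff.2 (by linarith)), by linarith⟩
  have hm0 : ∀ a, 0 < a → a < τ - t → 0 ≤ levRad Q E t ω - levRad Q E (t + a) ω :=
    fun a h1 h2 => sub_nonneg.2 (L.levRad_anti hI.1 (by linarith) (by linarith) ω)
  refine tendsto_div_of_rat hδ ?_ ?_ hm0 (hω hG)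
  · have hne : l.NeBot := by
      refine comap_neBot fun s hs => ?_
      obtain ⟨ε, hε, h2⟩ := (mem_nhdsGT_iff_exists_Ioo_subset).1 hs
      obtain ⟨q, hq1, hq2⟩ := exists_rat_btwn (show (0 : ℝ) < ε from hε)
      exact ⟨q, h2 ⟨hq1, hq2⟩⟩
    refine ge_of_tendsto (hω hG) ?_
    have : ∀ᶠ q : ℚ in l, (q : ℝ) ∈ Ioo 0 (τ - t) := tendsto_comap.eventually (Ioo_mem_nhdsGT hδ)
    filter_upwards [this] with q hq
    exact div_nonneg (hm0 _ hq.1 hq.2) hq.1.le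
  · intro a b ha hab hb
    have := L.levRad_anti (hI' a ha.le (by linarith)).1 (by linarith : t + a ≤ t + b)
      (by linarith) ω
    linarith

end Leaves

theorem HasWeakGradient.comp_add {n : ℕ} {w : Euc n → ℝ} {g : Euc n → Euc n}
    (h : HasWeakGradient w g) (p : Euc n) :
    HasWeakGradient (fun x => w (x + p)) (fun x => g (x + p)) := by
  have hloc : ∀ {F : Type} [NormedAddCommGroup F] (f : Euc n → F), LocallyIntegrable f volume →
      LocallyIntegrable (fun x => f (x + p)) volume := by
    intro F _ f hf
    rw [← (measurePreserving_add_right (volume : Measure (Euc n)) p).map_eq] at hf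
    exact (locallyIntegrable_map_homeomorph (Homeomorph.addRight p)).1 hf
  refine ⟨hloc w h.1, hloc g h.2.1, fun φ hφ hφc v => ?_⟩
  have h1 := h.2.2 (fun x => φ (x - p)) (hφ.comp (contDiff_id.sub contDiff_const))
    (hφc.comp_homeomorph (Homeomorph.subRight p)) v
  have h2 := integral_add_right_eq_self (μ := volume)
    (fun x => w x * fderiv ℝ (fun x => φ (x - p)) x v) p
  have h3 := integral_add_right_eq_self (μ := volume) (fun x => ⟪g x, v⟫ * φ (x - p)) p
  rw [← h2, ← h3] at h1
  simp only [add_sub_cancel_right, fderiv_comp_sub] at h1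
  exact h1

theorem IsBody0.translate {n : ℕ} {A : Set (Euc n)} (hA : IsBody0 A) {p : Euc n}
    (hp : p ∈ interior A) : IsBody0 ((fun x => x + p) ⁻¹' A) := by
  refine ⟨?_, ?_, ?_⟩
  · exact (Homeomorph.addRight p).isCompact_preimage.2 hA.compact
  · exact hA.convex.translate_preimage_left p
  · have : ContinuousAt (fun x : Euc n => x + p) 0 := by fun_prop
    refine this ?_
    simp only [zero_add]
    exact mem_interior_iff_mem_nhds.1 hp

namespace Leaves

variable {n : ℕ} {w : Euc n → ℝ} {g : Euc n → Euc n} {α : EReal} {τ : ℝ} {T Q : Set ℝ}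
  {E : ℝ → Set (Euc n)}

theorem translate (L : Leaves w g α τ T Q E) {p : Euc n} (hp : p ∈ interior (E τ)) :
    Leaves (fun x => w (x + p)) (fun x => g (x + p)) α τ T Q
      (fun t => (fun x => x + p) ⁻¹' E t) where
  weakGrad := L.weakGrad.comp_add p
  wm := L.wm.comp (by fun_prop)
  gm := L.gm.comp (by fun_prop)
  countable := L.countable
  mem_Q := L.mem_Q
  Q_sub := L.Q_sub
  bounds := L.bounds
  full := L.full
  dense := L.dense
  body t ht := (L.body t ht).translate
    (interior_mono (L.anti t ht τ (L.Q_sub L.mem_Q) (L.bounds t ht).2) hp)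
  anti t ht t' ht' h := preimage_mono (L.anti t ht t' ht' h)
  level t ht := (measurePreserving_add_right volume p).quasiMeasurePreserving.ae (L.level t ht)
  lower := (measurePreserving_add_right volume p).quasiMeasurePreserving.ae L.lower

theorem restrict (L : Leaves w g α τ T Q E) {q : ℝ} (hq : q ∈ Q) :
    Leaves w g α q (T ∩ Iic q) (Q ∩ Iic q) E where
  weakGrad := L.weakGrad
  wm := L.wm
  gm := L.gm
  countable := L.countable.mono inter_subset_left
  mem_Q := ⟨hq, self_mem_Iic⟩
  Q_sub := inter_subset_inter_left _ L.Q_sub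
  bounds t ht := ⟨(L.bounds t ht.1).1, ht.2⟩
  full := by
    filter_upwards [L.full] with t ht h1 h2
    exact ⟨ht h1 (h2.trans_le (L.bounds q (L.Q_sub hq)).2), h2.le⟩
  dense x y h1 h2 h3 := by
    obtain ⟨q', h4, h5, h6⟩ := L.dense x y h1 h2 (h3.trans (L.bounds q (L.Q_sub hq)).2)
    exact ⟨q', ⟨h4, h6.le.trans h3⟩, h5, h6⟩
  body t ht := L.body t ht.1
  anti t ht t' ht' h := L.anti t ht.1 t' ht'.1 h
  level t ht := L.level t ht.1
  lower := L.lower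

theorem ae_base (hn : 1 ≤ n) (L : Leaves w g α τ T Q E) {p : Euc n} (hp : p ∈ interior (E τ)) :
    ∀ᵐ x, x ∉ E τ → ⟪g x, x - p⟫ ≤ 0 := by
  have h := (measurePreserving_sub_right volume p).quasiMeasurePreserving.ae
    ((L.translate hp).ae_inner_nonpos hn)
  filter_upwards [h] with x hx
  simpa using hx

/-- Outside a superlevel set the gradient points towards it. -/
theorem ae_normal (hn : 1 ≤ n) (L : Leaves w g α τ T Q E) :
    ∀ᵐ x, ∀ q ∈ Q, x ∉ E q → ∀ y ∈ E q, 0 ≤ ⟪g x, y - x⟫ := by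
  have h1 : ∀ᵐ x, ∀ q ∈ Q, ∀ k : ℕ, TopologicalSpace.denseSeq (Euc n) k ∈ interior (E q) →
      x ∉ E q → ⟪g x, x - TopologicalSpace.denseSeq (Euc n) k⟫ ≤ 0 := by
    refine (ae_ball_iff L.countable).2 fun q hq => ae_all_iff.2 fun k => ?_
    by_cases hk : TopologicalSpace.denseSeq (Euc n) k ∈ interior (E q)
    · filter_upwards [(L.restrict hq).ae_base hn hk] with x hx _ using hx
    · exact Eventually.of_forall fun x h => absurd h hk
  filter_upwards [h1] with x hx q hq hxq
  have hb := L.body q (L.Q_sub hq)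
  have hsub : closure (interior (E q) ∩ range (TopologicalSpace.denseSeq (Euc n))) ⊆
      {y | 0 ≤ ⟪g x, y - x⟫} := by
    refine closure_minimal ?_ (isClosed_le continuous_const (by fun_prop))
    rintro _ ⟨hy, k, rfl⟩
    have := hx q hq k hy hxq
    rw [← neg_sub, inner_neg_right] at this
    simpa using this
  intro y hy
  refine hsub ?_
  have hcl := (TopologicalSpace.denseRange_denseSeq (Euc n)).open_subset_closure_inter
    (isOpen_interior (s := E q))
  have h2 : closure (interior (E q)) = E q := by
    rw [hb.convex.closure_interior_eq_closure_of_nonempty_interior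
      ⟨0, mem_interior_iff_mem_nhds.2 hb.nhds⟩, hb.compact.isClosed.closure_eq]
  rw [← h2] at hy
  exact closure_minimal hcl isClosed_closure hy

/-- Quantitative transversality of the gradient to rays. -/
theorem ae_norm_le (hn : 1 ≤ n) (L : Leaves w g α τ T Q E) {ρ : ℝ} (hρ : 0 ≤ ρ)
    (hb : Metric.closedBall (0 : Euc n) ρ ⊆ E τ) :
    ∀ᵐ x, x ∉ E τ → ρ * ‖g x‖ ≤ -⟪g x, x⟫ := by
  filter_upwards [L.ae_normal hn] with x hx hxE
  rcases eq_or_ne (g x) 0 with h0 | h0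
  · simp [h0]
  have hg : 0 < ‖g x‖ := norm_pos_iff.2 h0
  have h1 := hx τ L.mem_Q hxE (-(ρ / ‖g x‖) • g x) (hb (by
    rw [mem_closedBall_zero_iff, norm_smul, norm_neg, Real.norm_eq_abs,
      abs_of_nonneg (by positivity), div_mul_cancel₀ _ hg.ne']))
  rw [inner_sub_right, inner_smul_right, real_inner_self_eq_norm_sq] at h1
  have h2 : ρ / ‖g x‖ * ‖g x‖ ^ 2 = ρ * ‖g x‖ := by field_simp
  linarith

end Leaves

/-- The point of the level set in direction `ω`. -/
def levPt {n : ℕ} (Q : Set ℝ) (E : ℝ → Set (Euc n)) (t : ℝ) (ω : USphere n) : Euc n :=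
  levRad Q E t ω • (ω : Euc n)

namespace Leaves

variable {n : ℕ} {w : Euc n → ℝ} {g : Euc n → Euc n} {α : EReal} {τ : ℝ} {T Q : Set ℝ}
  {E : ℝ → Set (Euc n)}

theorem ae_volume (hn : 1 ≤ n) (L : Leaves w g α τ T Q E) : ∀ᵐ t : ℝ, t ∈ lvl α τ →
    ∫⁻ ω, ENNReal.ofReal (levRad Q E t ω ^ n) ∂sphMeas n = n * volume (E t) := by
  filter_upwards [L.ae_levRad_eq, L.full] with t h1 h2 hI
  rw [← (L.body t (h2 hI.1 hI.2)).volume_eq hn]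
  simp only [h1 hI.1 hI.2]

theorem lintegral_levels_mem (hn : 1 ≤ n) (L : Leaves w g α τ T Q E) {B : Set ℝ}
    (hB : MeasurableSet B) (F : Euc n → ℝ≥0∞) (hF : Measurable F) :
    ∫⁻ x in (E τ)ᶜ, (w ⁻¹' B).indicator F x * ENNReal.ofReal (-⟪g x, x⟫) =
      ∫⁻ t in B, (∫⁻ ω, F (levPt Q E t ω) *
        ENNReal.ofReal (levRad Q E t ω ^ n) ∂sphMeas n) ∂(volume.restrict (lvl α τ)) := by
  rw [L.lintegral_levels hn _ (hF.indicator (L.wm hB)), ← lintegral_indicator hB]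
  refine lintegral_congr_ae ?_
  filter_upwards [(ae_restrict_iff' measurableSet_lvl).2 (L.ae_level_eq hn)] with t ht
  by_cases htB : t ∈ B
  · rw [indicator_of_mem htB]
    refine lintegral_congr_ae ?_
    filter_upwards [ht] with ω hω
    rw [indicator_of_mem (show _ ∈ w ⁻¹' B by rw [mem_preimage, hω]; exact htB)]
    rfl
  · rw [indicator_of_notMem htB]
    refine lintegral_eq_zero_of_ae_eq_zero ?_
    filter_upwards [ht] with ω hω
    rw [indicator_of_notMem (show _ ∉ w ⁻¹' B by rw [mem_preimage, hω]; exact htB)]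
    simp

theorem measurable_inner_levels (L : Leaves w g α τ T Q E) (F : Euc n → ℝ≥0∞)
    (hF : Measurable F) : Measurable fun t => ∫⁻ ω, F (levPt Q E t ω) *
        ENNReal.ofReal (levRad Q E t ω ^ n) ∂sphMeas n := by
  have hm : Measurable fun p : ℝ × USphere n =>
      F (levPt Q E p.1 p.2) * ENNReal.ofReal (levRad Q E p.1 p.2 ^ n) :=
    (hF.comp L.measurable_levPoint).mul (L.measurable_levRad.pow_const n).ennreal_ofReal
  exact hm.lintegral_prod_right'

/-- Comparison of the level set integrals seen from two centres. -/
theorem ae_lintegral_shift (hn : 1 ≤ n) (L : Leaves w g α τ T Q E) {ρ : ℝ} (hρ : 0 < ρ)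
    (hb : Metric.closedBall (0 : Euc n) ρ ⊆ E τ) {p : Euc n} (hp : ‖p‖ < ρ) :
    ∀ᵐ t : ℝ, t ∈ lvl α τ →
      ∫⁻ ω, ENNReal.ofReal (1 + ⟪g (levPt Q E t ω), p⟫ / -⟪g (levPt Q E t ω), levPt Q E t ω⟫) *
        ENNReal.ofReal (levRad Q E t ω ^ n) ∂sphMeas n =
      ∫⁻ ω, ENNReal.ofReal (levRad Q E t ω ^ n) ∂sphMeas n := by
  have hpE : p ∈ interior (E τ) := by
    rw [mem_interior_iff_mem_nhds]
    exact mem_of_superset (Metric.closedBall_mem_nhds_of_mem (by simpa using hp)) hb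
  have L' := L.translate hpE
  set F : Euc n → ℝ≥0∞ := fun x => ENNReal.ofReal (1 + ⟪g x, p⟫ / -⟪g x, x⟫) with hFdef
  have hF : Measurable F := by
    refine (measurable_const.add (Measurable.div ?_ L.measurable_inner.neg)).ennreal_ofReal
    exact L.gm.inner measurable_const
  have hEm := L.bodyTop.compact.measurableSet
  have hcmp : ∀ B : Set ℝ, MeasurableSet B →
      ∫⁻ x in (E τ)ᶜ, (w ⁻¹' B).indicator F x * ENNReal.ofReal (-⟪g x, x⟫) =
      ∫⁻ x in ((fun x => x + p) ⁻¹' E τ)ᶜ, ((fun x => w (x + p)) ⁻¹' B).indicator 1 x *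
        ENNReal.ofReal (-⟪g (x + p), x⟫) := by
    intro B hB
    have h1 := lintegral_add_right_eq_self (μ := volume) (fun x => (E τ)ᶜ.indicator
      (fun x => (w ⁻¹' B).indicator 1 x * ENNReal.ofReal (-⟪g x, x - p⟫)) x) p
    have h2 : MeasurableSet ((fun x => x + p) ⁻¹' E τ)ᶜ :=
      (L'.bodyTop.compact.measurableSet).compl
    rw [← lintegral_indicator h2]
    refine Eq.trans ?_ (h1.symm.trans ?_)
    · rw [lintegral_indicator hEm.compl]
      refine lintegral_congr_ae ((ae_restrict_iff' hEm.compl).2 ?_)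
      filter_upwards [L.ae_norm_le hn hρ.le hb] with x hx hxE
      have hx' := hx hxE
      by_cases hxB : x ∈ w ⁻¹' B
      swap
      · simp [indicator_of_notMem hxB]
      rw [indicator_of_mem hxB, indicator_of_mem hxB, Pi.one_apply, one_mul, inner_sub_right]
      rcases eq_or_ne (g x) 0 with h0 | h0
      · simp [h0]
      have hD : 0 < -⟪g x, x⟫ := (mul_pos hρ (norm_pos_iff.2 h0)).trans_le hx'
      rw [hFdef, ← ENNReal.ofReal_mul' hD.le, add_mul, div_mul_cancel₀ _ hD.ne']
      congr 1
      ring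
    · refine lintegral_congr fun x => ?_
      by_cases hx : x + p ∈ (E τ)ᶜ
      · rw [indicator_of_mem hx, indicator_of_mem (show x ∈ ((fun x => x + p) ⁻¹' E τ)ᶜ from hx)]
        simp only [indicator, mem_preimage, add_sub_cancel_right, Pi.one_apply]
        rfl
      · rw [indicator_of_notMem hx,
          indicator_of_notMem (show x ∉ ((fun x => x + p) ⁻¹' E τ)ᶜ from hx)]
  have hvol : ∀ᵐ t : ℝ, t ∈ lvl α τ →
      ∫⁻ ω, ENNReal.ofReal (levRad Q (fun t => (fun x => x + p) ⁻¹' E t) t ω ^ n) ∂sphMeas n =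
      ∫⁻ ω, ENNReal.ofReal (levRad Q E t ω ^ n) ∂sphMeas n := by
    filter_upwards [L.ae_volume hn, L'.ae_volume hn] with t h1 h2 hI
    rw [h1 hI, h2 hI, measure_preimage_add_right]
  have hmain := ae_eq_of_forall_setLIntegral_eq_of_sigmaFinite (μ := volume.restrict (lvl α τ))
    (L.measurable_inner_levels F hF)
    (L'.measurable_inner_levels 1 measurable_one) (fun B hB _ => by
      rw [← L.lintegral_levels_mem hn hB F hF, hcmp B hB]
      exact L'.lintegral_levels_mem hn hB 1 measurable_one)
  filter_upwards [(ae_restrict_iff' measurableSet_lvl).1 hmain, hvol] with t h1 h2 hI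
  rw [← h2 hI]
  refine (h1 hI).trans ?_
  simp

end Leaves

/-- The boundary point of `A` in direction `ω`. -/
def bdPt {n : ℕ} (A : Set (Euc n)) (ω : USphere n) : Euc n := rad A ω • (ω : Euc n)

/-- Minus the radial derivative, at the boundary point of `A` in direction `ω`. -/
def bdD {n : ℕ} (g : Euc n → Euc n) (A : Set (Euc n)) (ω : USphere n) : ℝ :=
  -⟪g (bdPt A ω), bdPt A ω⟫

/-- Properties of the gradient on the boundary of a superlevel set `A = {w ≥ t}`. -/
structure GoodLevel {n : ℕ} (w : Euc n → ℝ) (g : Euc n → Euc n) (ρ : ℝ) (t : ℝ)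
    (A : Set (Euc n)) : Prop where
  body : IsBody0 A
  rho_pos : 0 < ρ
  ball : Metric.closedBall (0 : Euc n) ρ ⊆ A
  gm : Measurable g
  level : ∀ᵐ ω ∂sphMeas n, w (bdPt A ω) = t
  normal : ∀ᵐ ω ∂sphMeas n, ∀ y ∈ A, 0 ≤ ⟪g (bdPt A ω), y - bdPt A ω⟫
  pos : ∀ᵐ ω ∂sphMeas n, 0 < bdD g A ω
  norm_le : ∀ᵐ ω ∂sphMeas n, ρ * ‖g (bdPt A ω)‖ ≤ bdD g A ω
  int_eq_zero : ∀ v : Euc n, ∫ ω, ⟪g (bdPt A ω), v⟫ / bdD g A ω * rad A ω ^ n ∂sphMeas n = 0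

theorem IsBody0.measurable_bdPt {n : ℕ} {A : Set (Euc n)} (hA : IsBody0 A) :
    Measurable (bdPt A) :=
  hA.measurable_rad.smul measurable_subtype_coe

theorem IsBody0.exists_rad_le {n : ℕ} {A : Set (Euc n)} (hA : IsBody0 A) :
    ∃ D, 0 < D ∧ A ⊆ Metric.closedBall 0 D ∧ ∀ ω, rad A ω ≤ D := by
  obtain ⟨D, hD⟩ := hA.compact.isBounded.subset_closedBall (0 : Euc n)
  have h : A ⊆ Metric.closedBall 0 (max D 1) :=
    hD.trans (Metric.closedBall_subset_closedBall (le_max_left _ _))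
  exact ⟨max D 1, by positivity, h, fun ω => hA.rad_le h ω⟩

theorem integrable_bdd_rad {n : ℕ} {A : Set (Euc n)} (hA : IsBody0 A) {f : USphere n → ℝ}
    (hf : AEStronglyMeasurable f (sphMeas n)) {C : ℝ} (hC : ∀ᵐ ω ∂sphMeas n, |f ω| ≤ C) :
    Integrable (fun ω => f ω * rad A ω ^ n) (sphMeas n) := by
  obtain ⟨D, hD, -, hDr⟩ := hA.exists_rad_le
  refine Integrable.of_bound (C := C * D ^ n)
    (hf.mul (hA.measurable_rad.pow_const n).aestronglyMeasurable) ?_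
  filter_upwards [hC] with ω hω
  rw [norm_mul, Real.norm_eq_abs, Real.norm_eq_abs, abs_of_nonneg (pow_nonneg (hA.rad_pos ω).le n)]
  exact mul_le_mul hω (pow_le_pow_left₀ (hA.rad_pos ω).le (hDr ω) n)
    (pow_nonneg (hA.rad_pos ω).le n) ((abs_nonneg _).trans hω)

theorem measurable_bdD {n : ℕ} {g : Euc n → Euc n} (hg : Measurable g) {A : Set (Euc n)}
    (hA : IsBody0 A) : Measurable (bdD g A) :=
  ((hg.comp hA.measurable_bdPt).inner hA.measurable_bdPt).neg

theorem measurable_quot {n : ℕ} {g : Euc n → Euc n} (hg : Measurable g) {A : Set (Euc n)}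
    (hA : IsBody0 A) (v : Euc n) : Measurable fun ω => ⟪g (bdPt A ω), v⟫ / bdD g A ω :=
  ((hg.comp hA.measurable_bdPt).inner measurable_const).div (measurable_bdD hg hA)

theorem quot_le {n : ℕ} {g : Euc n → Euc n} {A : Set (Euc n)} {ρ : ℝ} {ω : USphere n}
    (h0 : 0 < bdD g A ω) (hρ : 0 < ρ) (h : ρ * ‖g (bdPt A ω)‖ ≤ bdD g A ω) (v : Euc n) :
    |⟪g (bdPt A ω), v⟫ / bdD g A ω| ≤ ‖v‖ / ρ := by
  rw [abs_div, abs_of_pos h0, div_le_div_iff₀ h0 hρ]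
  have h1 := abs_real_inner_le_norm (g (bdPt A ω)) v
  have h2 := norm_nonneg v
  nlinarith

namespace Leaves

variable {n : ℕ} {w : Euc n → ℝ} {g : Euc n → Euc n} {α : EReal} {τ : ℝ} {T Q : Set ℝ}
  {E : ℝ → Set (Euc n)}

theorem ae_goodLevel (hn : 1 ≤ n) (L : Leaves w g α τ T Q E) {ρ : ℝ} (hρ : 0 < ρ)
    (hb : Metric.closedBall (0 : Euc n) ρ ⊆ E τ) :
    ∀ᵐ t : ℝ, t ∈ lvl α τ → GoodLevel w g ρ t (E t) := by
  have hP : ∀ᵐ x, x ∉ E τ → ⟪g x, x⟫ ≠ 0 →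
      ⟪g x, x⟫ ≠ 0 ∧ ρ * ‖g x‖ ≤ -⟪g x, x⟫ ∧ ⟪g x, x⟫ ≤ 0 ∧
      ∀ q ∈ Q, w x < q → ∀ y ∈ E q, 0 ≤ ⟪g x, y - x⟫ := by
    have hlev : ∀ᵐ x, ∀ q ∈ Q, (q ≤ w x ↔ x ∈ E q) :=
      (ae_ball_iff L.countable).2 fun q hq => L.level q (L.Q_sub hq)
    filter_upwards [L.ae_norm_le hn hρ.le hb, L.ae_inner_nonpos hn, L.ae_normal hn, hlev] with x
      h1 h2 h3 h4 hx hx0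
    exact ⟨hx0, h1 hx, h2 hx, fun q hq hqt =>
      h3 q hq fun h => absurd ((h4 q hq).2 h) (not_le.2 hqt)⟩
  have hshift : ∀ᵐ t : ℝ, ∀ i : Fin n, t ∈ lvl α τ →
      ∫⁻ ω, ENNReal.ofReal (1 + ⟪g (levPt Q E t ω), (ρ / 2) • EuclideanSpace.single i (1 : ℝ)⟫ /
        -⟪g (levPt Q E t ω), levPt Q E t ω⟫) * ENNReal.ofReal (levRad Q E t ω ^ n) ∂sphMeas n =
      ∫⁻ ω, ENNReal.ofReal (levRad Q E t ω ^ n) ∂sphMeas n := by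
    refine ae_all_iff.2 fun i => L.ae_lintegral_shift hn hρ hb ?_
    rw [norm_smul, EuclideanSpace.norm_single, norm_one, mul_one, Real.norm_eq_abs,
      abs_of_pos (by positivity)]
    linarith
  filter_upwards [L.ae_levels hn hP, L.ae_level_eq hn, L.ae_levRad_eq, L.full, hshift] with t
    h1 h2 h3 h4 h5 hI
  have hR := h3 hI.1 hI.2
  have hT := h4 hI.1 hI.2
  have hB := L.body t hT
  have hx : ∀ ω, levRad Q E t ω • (ω : Euc n) = bdPt (E t) ω := fun ω => by rw [hR, bdPt]
  have hball : Metric.closedBall (0 : Euc n) ρ ⊆ E t :=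
    hb.trans (L.anti t hT τ (L.Q_sub L.mem_Q) hI.2.le)
  have h1' := h1 hI
  have h2' := h2 hI
  have h5' := fun i => h5 i hI
  simp only [levPt, hR] at h1' h2' h5'
  have hpos : ∀ᵐ ω ∂sphMeas n, 0 < bdD g (E t) ω := by
    filter_upwards [h1'] with ω hω
    exact neg_pos.2 (lt_of_le_of_ne hω.2.2.1 hω.1)
  have hnl : ∀ᵐ ω ∂sphMeas n, ρ * ‖g (bdPt (E t) ω)‖ ≤ bdD g (E t) ω := by
    filter_upwards [h1'] with ω hω using hω.2.1
  refine ⟨hB, hρ, hball, L.gm, h2', ?_, hpos, hnl, ?_⟩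
  · filter_upwards [h1', h2'] with ω hω hwt y hy
    have hωq := hω.2.2.2
    rw [hwt] at hωq
    rcases eq_or_ne y 0 with rfl | hy0
    · exact hωq τ L.mem_Q hI.2 0 (mem_of_mem_nhds L.bodyTop.nhds)
    have hny : 0 < ‖y‖ := norm_pos_iff.2 hy0
    set η : USphere n := ⟨‖y‖⁻¹ • y, by
      rw [mem_sphere_zero_iff_norm, norm_smul, norm_inv, norm_norm, inv_mul_cancel₀ hny.ne']⟩
    have hyη : ‖y‖ • (η : Euc n) = y := smul_inv_smul₀ hny.ne' y
    have hle : ‖y‖ ≤ levRad Q E t η := by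
      rw [hR, ← hB.smul_mem_iff η hny.le, hyη]; exact hy
    have hlt : ∀ r ∈ Ioo 0 (levRad Q E t η),
        0 ≤ ⟪g (bdPt (E t) ω), r • (η : Euc n) - bdPt (E t) ω⟫ := by
      intro r hr
      obtain ⟨_, ⟨q, hq, hqt, rfl⟩, hrq⟩ := (lt_isLUB_iff (L.isLUB_levRad hI.1 hI.2 η)).1 hr.2
      exact hωq q hq hqt _ (((L.body q (L.Q_sub hq)).smul_mem_iff η hr.1.le).2 hrq.le)
    have hcl : closure (Ioo 0 (levRad Q E t η)) ⊆
        {r : ℝ | 0 ≤ ⟪g (bdPt (E t) ω), r • (η : Euc n) - bdPt (E t) ω⟫} :=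
      closure_minimal hlt (isClosed_le continuous_const (by fun_prop))
    rw [closure_Ioo (L.levRad_pos hI.1 hI.2 η).ne] at hcl
    have := hcl ⟨hny.le, hle⟩
    rwa [mem_ofPred_eq, hyη] at this
  · have hint : ∀ v : Euc n, Integrable
        (fun ω => ⟪g (bdPt (E t) ω), v⟫ / bdD g (E t) ω * rad (E t) ω ^ n) (sphMeas n) := fun v =>
      integrable_bdd_rad hB (measurable_quot L.gm hB v).aestronglyMeasurable (C := ‖v‖ / ρ) (by
        filter_upwards [hpos, hnl] with ω ha hb' using quot_le ha hρ hb' v)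
    have hone : Integrable (fun ω => rad (E t) ω ^ n) (sphMeas n) := by
      simpa using integrable_bdd_rad hB (f := fun _ => 1) (C := 1)
        aestronglyMeasurable_const (by simp)
    have hbasis : ∀ i : Fin n, ∫ ω, ⟪g (bdPt (E t) ω), (ρ / 2) • EuclideanSpace.single i (1 : ℝ)⟫ /
        bdD g (E t) ω * rad (E t) ω ^ n ∂sphMeas n = 0 := by
      intro i
      have h6 := h5' i
      set v : Euc n := (ρ / 2) • EuclideanSpace.single i (1 : ℝ)
      have hv : ‖v‖ / ρ ≤ 1 := by
        rw [norm_smul, EuclideanSpace.norm_single, norm_one, mul_one, Real.norm_eq_abs,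
          abs_of_pos (by positivity), div_le_one hρ]
        linarith
      have hnn : ∀ᵐ ω ∂sphMeas n, 0 ≤ 1 + ⟪g (bdPt (E t) ω), v⟫ / bdD g (E t) ω := by
        filter_upwards [hpos, hnl] with ω ha hb'
        have := (abs_le.1 ((quot_le ha hρ hb' v).trans hv)).1
        linarith
      have hadd : Integrable (fun ω => rad (E t) ω ^ n +
          ⟪g (bdPt (E t) ω), v⟫ / bdD g (E t) ω * rad (E t) ω ^ n) (sphMeas n) :=
        hone.add (hint v)
      have e1 : ∫⁻ ω, ENNReal.ofReal (1 + ⟪g (bdPt (E t) ω), v⟫ / bdD g (E t) ω) *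
          ENNReal.ofReal (rad (E t) ω ^ n) ∂sphMeas n = ENNReal.ofReal (∫ ω, (rad (E t) ω ^ n +
          ⟪g (bdPt (E t) ω), v⟫ / bdD g (E t) ω * rad (E t) ω ^ n) ∂sphMeas n) := by
        rw [ofReal_integral_eq_lintegral_ofReal hadd]
        · refine lintegral_congr_ae ?_
          filter_upwards [hnn] with ω hω
          rw [← ENNReal.ofReal_mul hω]
          congr 1
          ring
        · filter_upwards [hnn] with ω hω
          have := mul_nonneg hω (pow_nonneg (hB.rad_pos ω).le n)
          simp only [Pi.zero_apply]
          linarith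
      have e2 : ∫⁻ ω, ENNReal.ofReal (rad (E t) ω ^ n) ∂sphMeas n =
          ENNReal.ofReal (∫ ω, rad (E t) ω ^ n ∂sphMeas n) :=
        (ofReal_integral_eq_lintegral_ofReal hone
          (Eventually.of_forall fun ω => pow_nonneg (hB.rad_pos ω).le n)).symm
      have h7 : ENNReal.ofReal (∫ ω, (rad (E t) ω ^ n +
          ⟪g (bdPt (E t) ω), v⟫ / bdD g (E t) ω * rad (E t) ω ^ n) ∂sphMeas n) =
          ENNReal.ofReal (∫ ω, rad (E t) ω ^ n ∂sphMeas n) := by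
        rw [← e1, ← e2]; exact h6
      have hge : 0 ≤ ∫ ω, (rad (E t) ω ^ n +
          ⟪g (bdPt (E t) ω), v⟫ / bdD g (E t) ω * rad (E t) ω ^ n) ∂sphMeas n := by
        refine integral_nonneg_of_ae ?_
        filter_upwards [hnn] with ω hω
        have := mul_nonneg hω (pow_nonneg (hB.rad_pos ω).le n)
        simp only [Pi.zero_apply]
        linarith
      rw [ENNReal.ofReal_eq_ofReal_iff hge
        (integral_nonneg fun ω => pow_nonneg (hB.rad_pos ω).le n),
        integral_add hone (hint v)] at h7
      linarith
    intro v
    have hv : v = ∑ i, (v i * (2 / ρ)) • ((ρ / 2) • EuclideanSpace.single i (1 : ℝ)) := by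
      ext j
      simp [Finset.sum_apply, Pi.single_apply]
      field_simp
    have e : ∀ ω, ⟪g (bdPt (E t) ω), v⟫ / bdD g (E t) ω * rad (E t) ω ^ n =
        ∑ i, (v i * (2 / ρ)) * (⟪g (bdPt (E t) ω), (ρ / 2) • EuclideanSpace.single i (1 : ℝ)⟫ /
        bdD g (E t) ω * rad (E t) ω ^ n) := by
      intro ω
      conv_lhs => rw [hv]
      rw [inner_sum, Finset.sum_div, Finset.sum_mul]
      refine Finset.sum_congr rfl fun i _ => ?_
      rw [inner_smul_right]
      ring
    simp only [e]
    rw [integral_finsetSum _ fun i _ => (hint _).const_mul _]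
    refine Finset.sum_eq_zero fun i _ => ?_
    rw [integral_const_mul, hbasis i, mul_zero]

end Leaves

/-- `ζ` is a subgradient of `Ψ` at `Y`, where `Ψ` takes the value `s`. -/
def SubAt {n : ℕ} (Ψ : Euc n → ℝ≥0∞) (s : ℝ) (Y ζ : Euc n) : Prop :=
  ∀ η : Euc n, ∀ r : ℝ, 0 ≤ r → Ψ η ≤ ENNReal.ofReal r → s + ⟪ζ, η - Y⟫ ≤ r

theorem subAt_of_mem_subgrad {n : ℕ} {Ψ : Euc n → ℝ≥0∞} {s : ℝ} (hs : 0 ≤ s) {ξ ζ : Euc n}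
    (h : Ψ ξ = ENNReal.ofReal s) (hζ : ζ ∈ subgrad Ψ ξ) : SubAt Ψ s ξ ζ := by
  intro η r hr hη
  have h1 := hζ η
  rw [h, EReal.coe_ennreal_ofReal, max_eq_left hs] at h1
  have h2 : ((Ψ η : ℝ≥0∞) : EReal) ≤ ((ENNReal.ofReal r : ℝ≥0∞) : EReal) :=
    EReal.coe_ennreal_le_coe_ennreal_iff.2 hη
  rw [EReal.coe_ennreal_ofReal, max_eq_left hr] at h2
  have h3 := h1.trans h2
  rw [← EReal.coe_add] at h3
  exact EReal.coe_le_coe_iff.1 h3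

theorem SubAt.le_inner {n : ℕ} {Ψ : Euc n → ℝ≥0∞} {s : ℝ} {Y ζ : Euc n} (h : SubAt Ψ s Y ζ)
    (h0 : Ψ 0 = 0) : s ≤ ⟪ζ, Y⟫ := by
  have := h 0 0 le_rfl (by simp [h0])
  rw [zero_sub, inner_neg_right] at this
  linarith

theorem SubAt.yconj_eq {n : ℕ} {Ψ : Euc n → ℝ≥0∞} {s : ℝ} (hs : 0 ≤ s) {Y ζ : Euc n}
    (h : SubAt Ψ s Y ζ) (h0 : Ψ 0 = 0) (hY : Ψ Y ≤ ENNReal.ofReal s) :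
    yconj Ψ ζ = ENNReal.ofReal (⟪ζ, Y⟫ - s) := by
  have hle := h.le_inner h0
  refine le_antisymm (iSup_le fun η => ?_) ?_
  · rw [tsub_le_iff_right]
    rcases eq_or_ne (Ψ η) ⊤ with ht | ht
    · simp [ht]
    · have h1 := h η (Ψ η).toReal ENNReal.toReal_nonneg (by rw [ENNReal.ofReal_toReal ht])
      rw [inner_sub_right] at h1
      rw [← ENNReal.ofReal_toReal ht, ← ENNReal.ofReal_add (by linarith) ENNReal.toReal_nonneg]
      exact ENNReal.ofReal_le_ofReal (by linarith)
  · rw [ENNReal.ofReal_sub _ hs]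
    exact (tsub_le_tsub_left hY _).trans (le_iSup (fun η => ENNReal.ofReal ⟪ζ, η⟫ - Ψ η) Y)

theorem lowerSemicontinuous_yconj {n : ℕ} (Ψ : Euc n → ℝ≥0∞) : LowerSemicontinuous (yconj Ψ) := by
  refine lowerSemicontinuous_iSup fun η => Continuous.lowerSemicontinuous ?_
  rcases eq_or_ne (Ψ η) ⊤ with h | h
  · simp only [h, ENNReal.sub_top]
    exact continuous_const
  · exact (ENNReal.continuous_sub_right _).comp
      (ENNReal.continuous_ofReal.comp (continuous_id.inner continuous_const))

/-- A good level all of whose boundary gradients are subgradients of `Ψ` at level `s`, the level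
set being a reflected homothetic copy of `{Ψ ≤ s}`. -/
structure ConjLevel {n : ℕ} (Ψ : Euc n → ℝ≥0∞) (w : Euc n → ℝ) (g : Euc n → Euc n) (ρ : ℝ)
    (t : ℝ) (A : Set (Euc n)) (s a : ℝ) (z : Euc n) : Prop extends GoodLevel w g ρ t A where
  zero : Ψ 0 = 0
  s_nonneg : 0 ≤ s
  a_pos : 0 < a
  meas : ∀ r : ℝ, MeasurableSet {ξ | Ψ ξ ≤ ENNReal.ofReal r}
  eq : A = (-a) • {ξ | Ψ ξ ≤ ENNReal.ofReal s} + ({z} : Set (Euc n))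
  sub : ∀ᵐ ω ∂sphMeas n, ∃ ξ, Ψ ξ = ENNReal.ofReal s ∧ g (bdPt A ω) ∈ subgrad Ψ ξ

theorem mem_homothet {n : ℕ} {L : Set (Euc n)} {a : ℝ} (ha : 0 < a) {z x : Euc n} :
    x ∈ (-a) • L + ({z} : Set (Euc n)) ↔ -(a⁻¹ • (x - z)) ∈ L := by
  constructor
  · rintro ⟨_, ⟨y, hy, rfl⟩, _, rfl, rfl⟩
    simpa [smul_smul, inv_mul_cancel₀ ha.ne'] using hy
  · intro h
    refine ⟨x - z, ⟨_, h, ?_⟩, z, rfl, sub_add_cancel x z⟩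
    simp [smul_smul, mul_inv_cancel₀ ha.ne']

namespace ConjLevel

variable {n : ℕ} {Ψ : Euc n → ℝ≥0∞} {w : Euc n → ℝ} {g : Euc n → Euc n} {ρ t : ℝ}
  {A : Set (Euc n)} {s a : ℝ} {z : Euc n}

theorem bdPt_mem (C : ConjLevel Ψ w g ρ t A s a z) (ω : USphere n) : bdPt A ω ∈ A :=
  (C.body.smul_mem_iff ω (C.body.rad_pos ω).le).2 le_rfl

theorem ae_subAt (C : ConjLevel Ψ w g ρ t A s a z) : ∀ᵐ ω ∂sphMeas n,
    Ψ (-(a⁻¹ • (bdPt A ω - z))) ≤ ENNReal.ofReal s ∧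
    SubAt Ψ s (-(a⁻¹ • (bdPt A ω - z))) (g (bdPt A ω)) := by
  filter_upwards [C.sub, C.normal] with ω ⟨ξ, hξ, hg⟩ hN
  have hs := subAt_of_mem_subgrad C.s_nonneg hξ hg
  have hY : Ψ (-(a⁻¹ • (bdPt A ω - z))) ≤ ENNReal.ofReal s := by
    have := C.bdPt_mem ω
    rw [C.eq] at this ⊢
    exact (mem_homothet C.a_pos).1 this
  refine ⟨hY, fun η r hr hη => ?_⟩
  set Y := -(a⁻¹ • (bdPt A ω - z)) with hYd
  have hx : bdPt A ω = z - a • Y := by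
    rw [hYd, smul_neg, smul_inv_smul₀ C.a_pos.ne']; abel
  have hξm : z - a • ξ ∈ A := by
    have h := (mem_homothet (L := {ξ | Ψ ξ ≤ ENNReal.ofReal s}) C.a_pos (z := z)
      (x := z - a • ξ)).2 (by simp [smul_smul, inv_mul_cancel₀ C.a_pos.ne', hξ])
    rw [← C.eq] at h
    exact h
  have h1 := hN _ hξm
  have h2 : z - a • ξ - bdPt A ω = a • (Y - ξ) := by rw [hx, smul_sub]; abel
  rw [h2, inner_smul_right] at h1
  have h3 : 0 ≤ ⟪g (bdPt A ω), Y - ξ⟫ := by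
    by_contra h
    exact absurd h1 (not_le.2 (mul_neg_of_pos_of_neg C.a_pos (not_le.1 h)))
  have h4 := hs η r hr hη
  rw [inner_sub_right] at h4 h3 ⊢
  linarith

theorem inner_eq (_C : ConjLevel Ψ w g ρ t A s a z) (ω : USphere n) :
    ⟪g (bdPt A ω), -(a⁻¹ • (bdPt A ω - z))⟫ = a⁻¹ * (bdD g A ω + ⟪g (bdPt A ω), z⟫) := by
  rw [inner_neg_right, inner_smul_right, inner_sub_right, bdD]
  ring

theorem exists_le_bdD (C : ConjLevel Ψ w g ρ t A s a z) (hs : 0 < s) :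
    ∃ c, 0 < c ∧ ∀ᵐ ω ∂sphMeas n, c ≤ bdD g A ω := by
  obtain ⟨D, hD, hAD, -⟩ := C.body.exists_rad_le
  have hρ := C.rho_pos
  have ha := C.a_pos
  refine ⟨ρ * (s * a / (D + ‖z‖)), by positivity, ?_⟩
  filter_upwards [C.norm_le, C.ae_subAt] with ω h1 h2
  refine le_trans (mul_le_mul_of_nonneg_left ?_ C.rho_pos.le) h1
  have h3 := (h2.2.le_inner C.zero).trans (real_inner_le_norm _ _)
  have h4 : ‖bdPt A ω - z‖ ≤ D + ‖z‖ := by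
    have := hAD (C.bdPt_mem ω)
    rw [mem_closedBall_zero_iff] at this
    exact (norm_sub_le _ _).trans (by linarith)
  rw [norm_neg, norm_smul, norm_inv, Real.norm_eq_abs, abs_of_pos ha] at h3
  rw [div_le_iff₀ (by positivity)]
  have h5 : s * a ≤ ‖g (bdPt A ω)‖ * ‖bdPt A ω - z‖ := by
    have := mul_le_mul_of_nonneg_right h3 ha.le
    field_simp at this
    linarith
  nlinarith [norm_nonneg (g (bdPt A ω))]

theorem integrable_inv (C : ConjLevel Ψ w g ρ t A s a z) (hs : 0 < s) :
    Integrable (fun ω => (bdD g A ω)⁻¹ * rad A ω ^ n) (sphMeas n) := by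
  obtain ⟨c, hc, h⟩ := C.exists_le_bdD hs
  refine integrable_bdd_rad C.body (measurable_bdD C.gm C.body).inv.aestronglyMeasurable
    (C := c⁻¹) ?_
  filter_upwards [h] with ω hω
  rw [abs_of_pos (inv_pos.2 (hc.trans_le hω))]
  exact inv_anti₀ hc hω

end ConjLevel

theorem exists_pow_le (n : ℕ) {M : ℝ} (hM : 0 ≤ M) :
    ∃ C, 0 ≤ C ∧ ∀ y : ℝ, |y| ≤ M → (max (1 + y) 0) ^ n ≤ 1 + n * y + C * y ^ 2 := by
  induction n with
  | zero => exact ⟨0, le_rfl, fun y _ => by simp⟩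
  | succ n ih =>
    obtain ⟨C, hC, h⟩ := ih
    refine ⟨n + 1 + C + C * M, by positivity, fun y hy => ?_⟩
    push_cast
    rcases le_total 0 (1 + y) with h1 | h1
    · rw [pow_succ, max_eq_left h1]
      have h2 := mul_le_mul_of_nonneg_right (h y hy) h1
      rw [max_eq_left h1] at h2
      have h3 : C * y ^ 2 * y ≤ C * y ^ 2 * M :=
        mul_le_mul_of_nonneg_left ((le_abs_self y).trans hy) (by positivity)
      nlinarith [sq_nonneg y]
    · rw [max_eq_right h1, zero_pow (Nat.succ_ne_zero n)]
      have h2 : -y ≤ y ^ 2 := by nlinarith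
      have h3 : 0 ≤ (C + C * M) * y ^ 2 := by positivity
      have h4 := mul_le_mul_of_nonneg_left h2 (by positivity : (0 : ℝ) ≤ n + 1)
      nlinarith

theorem volume_homothet {n : ℕ} (L : Set (Euc n)) {a : ℝ} (ha : 0 < a) (z : Euc n) :
    volume ((-a) • L + ({z} : Set (Euc n))) = ENNReal.ofReal (a ^ n) * volume L := by
  rw [Set.add_singleton, image_add_right, measure_preimage_add_right, Measure.addHaar_smul,
    finrank_euclideanSpace_fin, abs_pow, abs_neg, abs_of_pos ha]

/-- The integral of the reciprocal of minus the radial derivative over a level set. -/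
def lam {n : ℕ} (g : Euc n → Euc n) (A : Set (Euc n)) : ℝ :=
  ∫ ω, (bdD g A ω)⁻¹ * rad A ω ^ n ∂sphMeas n

theorem IsBody0.integrable_rad_pow {n : ℕ} {A : Set (Euc n)} (hA : IsBody0 A) :
    Integrable (fun ω => rad A ω ^ n) (sphMeas n) := by
  simpa using integrable_bdd_rad hA (f := fun _ => 1) (C := 1)
    aestronglyMeasurable_const (by simp)

theorem IsBody0.integral_rad_pow {n : ℕ} (hn : 1 ≤ n) {A : Set (Euc n)} (hA : IsBody0 A) :
    ∫ ω, rad A ω ^ n ∂sphMeas n = n * (volume A).toReal := by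
  rw [integral_eq_lintegral_of_nonneg_ae
    (Eventually.of_forall fun ω => pow_nonneg (hA.rad_pos ω).le n)
    hA.integrable_rad_pow.aestronglyMeasurable, hA.volume_eq hn, ENNReal.toReal_mul,
    ENNReal.toReal_natCast]

namespace ConjLevel

variable {n : ℕ} {Ψ : Euc n → ℝ≥0∞} {w : Euc n → ℝ} {g : Euc n → Euc n} {ρ t : ℝ}
  {A : Set (Euc n)} {s a : ℝ} {z : Euc n}

theorem lintegral_yconj (hn : 1 ≤ n) (C : ConjLevel Ψ w g ρ t A s a z) :
    ∫⁻ ω, yconj Ψ (g (bdPt A ω)) / ENNReal.ofReal (bdD g A ω) * ENNReal.ofReal (rad A ω ^ n)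
      ∂sphMeas n = ENNReal.ofReal (a⁻¹ * (n * (volume A).toReal) - s * lam g A) := by
  have hi1 := C.body.integrable_rad_pow.const_mul a⁻¹
  have hi2 : Integrable (fun ω => ⟪g (bdPt A ω), z⟫ / bdD g A ω * rad A ω ^ n) (sphMeas n) :=
    integrable_bdd_rad C.body (measurable_quot C.gm C.body z).aestronglyMeasurable
      (C := ‖z‖ / ρ) (by
        filter_upwards [C.pos, C.norm_le] with ω ha hb' using quot_le ha C.rho_pos hb' z)
  have hi2' := hi2.const_mul a⁻¹
  have hi3 : Integrable (fun ω => s * ((bdD g A ω)⁻¹ * rad A ω ^ n)) (sphMeas n) := by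
    rcases C.s_nonneg.eq_or_lt with h | h
    · simp [← h]
    · exact (C.integrable_inv h).const_mul s
  have hi12 : Integrable (fun ω => a⁻¹ * rad A ω ^ n +
    a⁻¹ * (⟪g (bdPt A ω), z⟫ / bdD g A ω * rad A ω ^ n)) (sphMeas n) := hi1.add hi2'
  have hi : Integrable (fun ω => a⁻¹ * rad A ω ^ n +
    a⁻¹ * (⟪g (bdPt A ω), z⟫ / bdD g A ω * rad A ω ^ n) -
    s * ((bdD g A ω)⁻¹ * rad A ω ^ n)) (sphMeas n) := hi12.sub hi3
  have key : ∀ᵐ ω ∂sphMeas n, 0 ≤ a⁻¹ * rad A ω ^ n +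
      a⁻¹ * (⟪g (bdPt A ω), z⟫ / bdD g A ω * rad A ω ^ n) -
      s * ((bdD g A ω)⁻¹ * rad A ω ^ n) ∧
      yconj Ψ (g (bdPt A ω)) / ENNReal.ofReal (bdD g A ω) * ENNReal.ofReal (rad A ω ^ n) =
      ENNReal.ofReal (a⁻¹ * rad A ω ^ n +
      a⁻¹ * (⟪g (bdPt A ω), z⟫ / bdD g A ω * rad A ω ^ n) -
      s * ((bdD g A ω)⁻¹ * rad A ω ^ n)) := by
    filter_upwards [C.ae_subAt, C.pos] with ω h1 h2
    have h3 := h1.2.le_inner C.zero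
    have hR := pow_nonneg (C.body.rad_pos ω).le n
    have e : a⁻¹ * rad A ω ^ n + a⁻¹ * (⟪g (bdPt A ω), z⟫ / bdD g A ω * rad A ω ^ n) -
        s * ((bdD g A ω)⁻¹ * rad A ω ^ n) =
        (⟪g (bdPt A ω), -(a⁻¹ • (bdPt A ω - z))⟫ - s) / bdD g A ω * rad A ω ^ n := by
      rw [C.inner_eq]
      field_simp
    rw [e, h1.2.yconj_eq C.s_nonneg C.zero h1.1, ← ENNReal.ofReal_div_of_pos h2,
      ← ENNReal.ofReal_mul (div_nonneg (by linarith) h2.le)]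
    exact ⟨mul_nonneg (div_nonneg (by linarith) h2.le) hR, rfl⟩
  rw [lintegral_congr_ae (key.mono fun ω h => h.2),
    ← ofReal_integral_eq_lintegral_ofReal hi (key.mono fun ω h => h.1),
    integral_sub hi12 hi3, integral_add hi1 hi2', integral_const_mul, integral_const_mul,
    integral_const_mul, C.int_eq_zero, C.body.integral_rad_pow hn, mul_zero, add_zero, lam]

/-- One-sided second order expansion of the volume of the sublevel sets of `Ψ`. -/
theorem volume_le (hn : 1 ≤ n) (C : ConjLevel Ψ w g ρ t A s a z) (hs : 0 < s) :
    ∃ B, 0 ≤ B ∧ ∀ δ : ℝ, |δ| ≤ 1 → 0 ≤ s + δ →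
      (volume {ξ | Ψ ξ ≤ ENNReal.ofReal (s + δ)}).toReal ≤
        (volume {ξ | Ψ ξ ≤ ENNReal.ofReal s}).toReal + a / a ^ n * lam g A * δ + B * δ ^ 2 := by
  obtain ⟨c, hc, hcd⟩ := C.exists_le_bdD hs
  have ha := C.a_pos
  have hn0 : (0 : ℝ) < n := by exact_mod_cast hn
  obtain ⟨B, hB, hBp⟩ := exists_pow_le n (div_nonneg ha.le hc.le)
  set V := (volume {ξ | Ψ ξ ≤ ENNReal.ofReal s}).toReal with hV
  have hVA : (volume A).toReal = a ^ n * V := by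
    rw [C.eq, volume_homothet _ ha, ENNReal.toReal_mul, ENNReal.toReal_ofReal (by positivity)]
  have hV0 : 0 ≤ V := ENNReal.toReal_nonneg
  refine ⟨B * (a / c) ^ 2 * V, by positivity, fun δ hδ hsδ => ?_⟩
  set A' := (-a) • {ξ | Ψ ξ ≤ ENNReal.ofReal (s + δ)} + ({z} : Set (Euc n)) with hA'
  have hA'm : MeasurableSet A' := by
    have : A' = (fun x => -(a⁻¹ • (x - z))) ⁻¹' {ξ | Ψ ξ ≤ ENNReal.ofReal (s + δ)} := by
      ext x; exact mem_homothet ha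
    rw [this]
    exact (by fun_prop : Measurable fun x : Euc n => -(a⁻¹ • (x - z))) (C.meas _)
  have hi1 := C.body.integrable_rad_pow.const_mul
    ((n : ℝ)⁻¹ + (n : ℝ)⁻¹ * (B * (a / c) ^ 2) * δ ^ 2)
  have hi2 := (C.integrable_inv hs).const_mul (a * δ)
  have hi : Integrable (fun ω => ((n : ℝ)⁻¹ + (n : ℝ)⁻¹ * (B * (a / c) ^ 2) * δ ^ 2) * rad A ω ^ n +
    a * δ * ((bdD g A ω)⁻¹ * rad A ω ^ n)) (sphMeas n) := hi1.add hi2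
  have key : ∀ᵐ ω : USphere n ∂sphMeas n,
      (∫⁻ r in Ioi (0 : ℝ), A'.indicator 1 (r • (ω : Euc n)) * ENNReal.ofReal (r ^ (n - 1))) ≤
      ENNReal.ofReal (((n : ℝ)⁻¹ + (n : ℝ)⁻¹ * (B * (a / c) ^ 2) * δ ^ 2) * rad A ω ^ n +
        a * δ * ((bdD g A ω)⁻¹ * rad A ω ^ n)) ∧
      0 ≤ ((n : ℝ)⁻¹ + (n : ℝ)⁻¹ * (B * (a / c) ^ 2) * δ ^ 2) * rad A ω ^ n +
        a * δ * ((bdD g A ω)⁻¹ * rad A ω ^ n) := by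
    filter_upwards [C.ae_subAt, hcd] with ω h1 hcω
    have hd : 0 < bdD g A ω := hc.trans_le hcω
    have hR := C.body.rad_pos ω
    set m := max (1 + a * δ / bdD g A ω) 0 with hm
    have hm0 : 0 ≤ m := le_max_right _ _
    have hy : |a * δ / bdD g A ω| ≤ a / c := by
      rw [abs_div, abs_of_pos hd, abs_mul, abs_of_pos ha]
      exact div_le_div₀ ha.le (mul_le_of_le_one_right ha.le hδ) hc hcω
    have hmn := hBp _ hy
    have hsq : (a * δ / bdD g A ω) ^ 2 ≤ (a / c) ^ 2 * δ ^ 2 := by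
      have : a * δ / bdD g A ω = a / bdD g A ω * δ := by ring
      rw [this, mul_pow]
      exact mul_le_mul_of_nonneg_right (pow_le_pow_left₀ (by positivity)
        (div_le_div_of_nonneg_left ha.le hc hcω) 2) (sq_nonneg δ)
    have hfin : (rad A ω * m) ^ n / n ≤
        ((n : ℝ)⁻¹ + (n : ℝ)⁻¹ * (B * (a / c) ^ 2) * δ ^ 2) * rad A ω ^ n +
        a * δ * ((bdD g A ω)⁻¹ * rad A ω ^ n) := by
      have h5 : m ^ n ≤ 1 + n * (a * δ / bdD g A ω) + B * ((a / c) ^ 2 * δ ^ 2) :=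
        hmn.trans (by gcongr)
      have h6 := mul_le_mul_of_nonneg_left h5 (by positivity : 0 ≤ rad A ω ^ n / n)
      rw [mul_pow]
      refine le_trans (le_of_eq ?_) (h6.trans (le_of_eq ?_))
      · ring
      · field_simp
        ring
    refine ⟨?_, le_trans (by positivity) hfin⟩
    refine le_trans ?_ (ENNReal.ofReal_le_ofReal hfin)
    rw [← lintegral_Ioc_pow hn (mul_nonneg hR.le hm0), ← lintegral_indicator measurableSet_Ioi,
      ← lintegral_indicator measurableSet_Ioc]
    refine lintegral_mono fun r => ?_
    by_cases hr : r ∈ Ioi (0 : ℝ)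
    swap
    · rw [indicator_of_notMem hr]; exact zero_le
    rw [indicator_of_mem hr]
    by_cases hrA : r • (ω : Euc n) ∈ A'
    swap
    · rw [indicator_of_notMem hrA, zero_mul]; exact zero_le
    have hle : r ≤ rad A ω * m := by
      have h2 := h1.2 _ (s + δ) hsδ ((mem_homothet ha).1 hrA)
      have e2 : -(a⁻¹ • (r • (ω : Euc n) - z)) - -(a⁻¹ • (bdPt A ω - z)) =
          (a⁻¹ * (1 - r / rad A ω)) • bdPt A ω := by
        have : r • (ω : Euc n) = (r / rad A ω) • bdPt A ω := by
          rw [bdPt, smul_smul, div_mul_cancel₀ _ hR.ne']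
        rw [this]
        module
      rw [e2, inner_smul_right] at h2
      have e3 : ⟪g (bdPt A ω), bdPt A ω⟫ = -bdD g A ω := by rw [bdD, neg_neg]
      rw [e3] at h2
      have h3 : r / rad A ω ≤ 1 + a * δ / bdD g A ω := by
        have h4 : (r / rad A ω - 1) * bdD g A ω ≤ a * δ := by
          have : a⁻¹ * (1 - r / rad A ω) * -bdD g A ω = a⁻¹ * ((r / rad A ω - 1) * bdD g A ω) := by
            ring
          rw [this] at h2
          have h4 : a⁻¹ * ((r / rad A ω - 1) * bdD g A ω) ≤ δ := by linarith
          rwa [inv_mul_le_iff₀ ha] at h4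
        have := (le_div_iff₀ hd).2 h4
        linarith
      have h4 := (div_le_iff₀ hR).1 (h3.trans (le_max_left _ (0 : ℝ)))
      linarith
    rw [indicator_of_mem hrA, indicator_of_mem (show r ∈ Ioc 0 (rad A ω * m) from ⟨hr, hle⟩)]
    simp
  have hvol : volume A' ≤ ENNReal.ofReal (a ^ n * V + a * lam g A * δ +
      B * (a / c) ^ 2 * δ ^ 2 * (a ^ n * V)) := by
    rw [← lintegral_indicator_one hA'm, lintegral_polar hn _ (measurable_one.indicator hA'm)]
    refine (lintegral_mono_ae (key.mono fun ω h => h.1)).trans (le_of_eq ?_)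
    rw [← ofReal_integral_eq_lintegral_ofReal hi (key.mono fun ω h => h.2),
      integral_add hi1 hi2, integral_const_mul, integral_const_mul, C.body.integral_rad_pow hn,
      hVA, ← lam]
    congr 1
    field_simp
    ring
  have hnn : 0 ≤ a ^ n * V + a * lam g A * δ + B * (a / c) ^ 2 * δ ^ 2 * (a ^ n * V) := by
    have h := integral_nonneg_of_ae (key.mono fun ω h => h.2)
    rw [integral_add hi1 hi2, integral_const_mul, integral_const_mul, C.body.integral_rad_pow hn,
      hVA, ← lam] at h
    refine h.trans (le_of_eq ?_)
    field_simp
    ring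
  have h := ENNReal.toReal_le_of_le_ofReal hnn hvol
  rw [hA', volume_homothet _ ha, ENNReal.toReal_mul, ENNReal.toReal_ofReal (by positivity)] at h
  have hap : 0 < a ^ n := by positivity
  have h' := (le_div_iff₀' hap).2 h
  refine h'.trans (le_of_eq ?_)
  field_simp

end ConjLevel

/-- `V` admits the one-sided second order expansion at `s` with slope `l`. -/
def UpperExp (V : ℝ → ℝ) (s l : ℝ) : Prop :=
  ∃ B, 0 ≤ B ∧ ∀ δ : ℝ, |δ| ≤ 1 → 0 ≤ s + δ → V (s + δ) ≤ V s + l * δ + B * δ ^ 2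

theorem UpperExp.exists_strictMax {V : ℝ → ℝ} {s l₁ l₂ : ℝ} (h₁ : UpperExp V s l₁)
    (h₂ : UpperExp V s l₂) (h : l₁ < l₂) : ∃ r : ℚ, ∃ k : ℕ, ∀ δ : ℝ, δ ≠ 0 →
    |δ| < ((k : ℝ) + 1)⁻¹ → 0 ≤ s + δ → V (s + δ) - r * (s + δ) < V s - r * s := by
  obtain ⟨B₁, hB₁, h₁⟩ := h₁
  obtain ⟨B₂, hB₂, h₂⟩ := h₂
  obtain ⟨r, hr1, hr2⟩ := exists_rat_btwn h
  obtain ⟨k, hk⟩ := exists_nat_gt ((B₁ + 1) / (r - l₁) + (B₂ + 1) / (l₂ - r))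
  have hr1' : 0 < (r : ℝ) - l₁ := by linarith
  have hr2' : 0 < l₂ - (r : ℝ) := by linarith
  have p1 : 0 ≤ (B₁ + 1) / (r - l₁) := by positivity
  have p2 : 0 ≤ (B₂ + 1) / (l₂ - r) := by positivity
  have hk0 : (0 : ℝ) < k + 1 := by positivity
  refine ⟨r, k, fun δ hδ hδk hs => ?_⟩
  have hδ1 : |δ| ≤ 1 := hδk.le.trans (inv_le_one_of_one_le₀ (by linarith [k.cast_nonneg (α := ℝ)]))
  have hδk' : |δ| * (k + 1) < 1 := by
    have := mul_lt_mul_of_pos_right hδk hk0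
    rwa [inv_mul_cancel₀ hk0.ne'] at this
  have habs : 0 < |δ| := abs_pos.2 hδ
  rcases lt_or_gt_of_ne hδ with hneg | hpos
  · rw [abs_of_neg hneg] at hδk' habs
    have h3 := h₂ δ hδ1 hs
    have h4 : (B₂ + 1) < (l₂ - r) * (k + 1) := by
      rw [mul_comm, ← div_lt_iff₀ hr2']; linarith
    have h6 : (B₂ + 1) * (-δ) < (l₂ - r) := by
      have := mul_lt_mul_of_pos_right h4 habs
      nlinarith
    nlinarith
  · rw [abs_of_pos hpos] at hδk' habs
    have h3 := h₁ δ hδ1 hs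
    have h4 : (B₁ + 1) < (r - l₁) * (k + 1) := by
      rw [mul_comm, ← div_lt_iff₀ hr1']; linarith
    have h6 : (B₁ + 1) * δ < (r - l₁) := by
      have := mul_lt_mul_of_pos_right h4 habs
      nlinarith
    nlinarith

theorem countable_upperExp (V : ℝ → ℝ) :
    {s : ℝ | 0 ≤ s ∧ ∃ l₁ l₂, l₁ ≠ l₂ ∧ UpperExp V s l₁ ∧ UpperExp V s l₂}.Countable := by
  set S : ℚ → ℕ → Set ℝ := fun r k => {s | 0 ≤ s ∧ ∀ δ : ℝ, δ ≠ 0 →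
    |δ| < ((k : ℝ) + 1)⁻¹ → 0 ≤ s + δ → V (s + δ) - r * (s + δ) < V s - r * s} with hS
  have hsub : {s : ℝ | 0 ≤ s ∧ ∃ l₁ l₂, l₁ ≠ l₂ ∧ UpperExp V s l₁ ∧ UpperExp V s l₂} ⊆
      ⋃ (r : ℚ) (k : ℕ), S r k := by
    rintro s ⟨hs, l₁, l₂, hne, h₁, h₂⟩
    rcases lt_or_gt_of_ne hne with h | h
    · obtain ⟨r, k, hrk⟩ := h₁.exists_strictMax h₂ h
      exact mem_iUnion₂.2 ⟨r, k, hs, hrk⟩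
    · obtain ⟨r, k, hrk⟩ := h₂.exists_strictMax h₁ h
      exact mem_iUnion₂.2 ⟨r, k, hs, hrk⟩
  refine (countable_iUnion fun r => countable_iUnion fun k => ?_).mono hsub
  have hk0 : (0 : ℝ) < k + 1 := by positivity
  have hinj : InjOn (fun s : ℝ => ⌊s * (k + 1)⌋) (S r k) := by
    intro x hx y hy hxy
    by_contra hne
    have h1 := Int.abs_sub_lt_one_of_floor_eq_floor hxy
    have h2 : |y - x| < ((k : ℝ) + 1)⁻¹ := by
      rw [← sub_mul, abs_mul, abs_of_pos hk0] at h1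
      rw [abs_sub_comm]
      rwa [lt_inv_comm₀ (by
        exact abs_pos.2 (sub_ne_zero.2 hne)) hk0, lt_inv_comm₀ hk0 (abs_pos.2 (sub_ne_zero.2 hne)),
        ← one_div, lt_div_iff₀ hk0]
    have h3 := hx.2 (y - x) (sub_ne_zero.2 (Ne.symm hne)) h2 (by linarith [hy.1])
    have h4 := hy.2 (x - y) (sub_ne_zero.2 hne) (by rwa [abs_sub_comm]) (by linarith [hx.1])
    have e1 : x + (y - x) = y := by ring
    have e2 : y + (x - y) = x := by ring
    rw [e1] at h3
    rw [e2] at h4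
    linarith
  exact (mapsTo_univ _ _).countable_of_injOn hinj countable_univ

theorem ConjLevel.upperExp {n : ℕ} {Ψ : Euc n → ℝ≥0∞} {w : Euc n → ℝ} {g : Euc n → Euc n}
    {ρ t : ℝ} {A : Set (Euc n)} {s a : ℝ} {z : Euc n} (hn : 1 ≤ n)
    (C : ConjLevel Ψ w g ρ t A s a z) (hs : 0 < s) :
    UpperExp (fun r => (volume {ξ | Ψ ξ ≤ ENNReal.ofReal r}).toReal) s (a / a ^ n * lam g A) :=
  C.volume_le hn hs

/-- A homothetic copy of `A` contained in `A` contains a dilate of `A` about the origin. -/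
theorem homothet_rad_ge {n : ℕ} {L A : Set (Euc n)} {a : ℝ} {z : Euc n} (ha : 0 < a)
    (hA : A = (-a) • L + ({z} : Set (Euc n))) (hbody : IsBody0 A) {ρ : ℝ} (hρ : 0 < ρ)
    (hball : Metric.closedBall (0 : Euc n) ρ ⊆ A) :
    ∃ C, 0 ≤ C ∧ ∀ a' z', 0 < a' → ∀ A', A' = (-a') • L + ({z'} : Set (Euc n)) → IsBody0 A' →
      A' ⊆ A → a' ≤ a → ∀ ω, (1 - C * (1 - a' / a)) * rad A ω ≤ rad A' ω := by
  obtain ⟨D, hD, hAD, -⟩ := hbody.exists_rad_le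
  set D2 := D + ‖z‖ with hD2
  refine ⟨1 + (‖z‖ + D2) / ρ, by positivity, fun a' z' ha' A' hA' hb' hsub hle ω => ?_⟩
  set θ := a' / a with hθ
  have hθ0 : 0 < θ := by positivity
  have hθ1 : θ ≤ 1 := (div_le_one ha).2 hle
  set C := 1 + (‖z‖ + D2) / ρ with hC
  have hmap : ∀ x, x ∈ A ↔ θ • (x - z) + z' ∈ A' := by
    intro x
    rw [hA, hA', mem_homothet ha, mem_homothet ha', add_sub_cancel_right, smul_smul]
    have : a'⁻¹ * θ = a⁻¹ := by rw [hθ]; field_simp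
    rw [this]
  have hz : ‖z' - z‖ ≤ (1 - θ) * D2 := by
    obtain ⟨x, hx, hmax⟩ := hbody.compact.exists_isMaxOn ⟨0, mem_of_mem_nhds hbody.nhds⟩
      (f := fun x => ⟪z' - z, x⟫) (by fun_prop)
    have h1 := hmax (hsub ((hmap x).1 hx))
    simp only [mem_ofPred_eq] at h1
    have e : θ • (x - z) + z' = x - (1 - θ) • (x - z) + (z' - z) := by module
    rw [e, inner_add_right, inner_sub_right, inner_smul_right, real_inner_self_eq_norm_sq] at h1
    have h2 := real_inner_le_norm (z' - z) (x - z)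
    have h3 : ‖x - z‖ ≤ D2 := by
      have := hAD hx
      rw [mem_closedBall_zero_iff] at this
      exact (norm_sub_le _ _).trans (by linarith)
    have h4 : ‖z' - z‖ ^ 2 ≤ (1 - θ) * (‖z' - z‖ * D2) := by
      have := mul_le_mul_of_nonneg_left (h2.trans (mul_le_mul_of_nonneg_left h3 (norm_nonneg _)))
        (sub_nonneg.2 hθ1)
      linarith
    rcases (norm_nonneg (z' - z)).eq_or_lt with h0 | h0
    · rw [← h0]; exact mul_nonneg (sub_nonneg.2 hθ1) (by positivity)
    · nlinarith
  rcases le_total (1 - C * (1 - θ)) 0 with h0 | h0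
  · exact (mul_nonpos_of_nonpos_of_nonneg h0 (hbody.rad_pos ω).le).trans (hb'.rad_pos ω).le
  rw [← hb'.smul_mem_iff ω (mul_nonneg h0 (hbody.rad_pos ω).le)]
  rcases hθ1.eq_or_lt with h1 | h1
  · have hzz : z' = z := by
      rw [h1, sub_self, zero_mul] at hz
      exact sub_eq_zero.1 (norm_le_zero_iff.1 hz)
    have := (hmap (rad A ω • (ω : Euc n))).1 ((hbody.smul_mem_iff ω (hbody.rad_pos ω).le).2 le_rfl)
    rw [h1, hzz, one_smul, sub_add_cancel] at this
    rwa [h1, sub_self, mul_zero, sub_zero, one_mul]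
  have h1' : 0 < 1 - θ := by linarith
  set E := (‖z‖ + D2) / ρ with hE
  have hE0 : 0 < E := by positivity
  have hp : (((1 - θ) * E)⁻¹ • (θ • z - z')) ∈ A := by
    apply hball
    rw [mem_closedBall_zero_iff, norm_smul, norm_inv, Real.norm_eq_abs,
      abs_of_pos (by positivity), inv_mul_le_iff₀ (by positivity)]
    have e : θ • z - z' = -((1 - θ) • z) - (z' - z) := by module
    rw [e]
    refine (norm_sub_le _ _).trans ?_
    rw [norm_neg, norm_smul, Real.norm_eq_abs, abs_of_pos h1']
    have : (1 - θ) * E * ρ = (1 - θ) * (‖z‖ + D2) := by rw [hE]; field_simp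
    rw [this]
    linarith
  have hx := (hbody.smul_mem_iff ω (hbody.rad_pos ω).le).2 le_rfl
  have hcomb := hbody.convex hx hp (a := (1 - C * (1 - θ)) / θ) (b := (1 - θ) * E / θ)
    (by positivity) (by positivity) (by rw [hC]; field_simp; ring)
  have := (hmap _).1 hcomb
  convert this using 1
  have e3 : ((1 - θ) * E / θ) • (((1 - θ) * E)⁻¹ • (θ • z - z')) = θ⁻¹ • (θ • z - z') := by
    rw [smul_smul]; congr 1; field_simp
  rw [e3, smul_sub, smul_add, smul_smul, smul_smul, smul_smul, mul_inv_cancel₀ hθ0.ne',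
    mul_div_cancel₀ _ hθ0.ne']
  module

theorem IsBody0.volume_pos {n : ℕ} {A : Set (Euc n)} (hA : IsBody0 A) :
    0 < (volume A).toReal :=
  ENNReal.toReal_pos (MeasureTheory.Measure.measure_pos_of_mem_nhds volume hA.nhds).ne'
    hA.compact.measure_lt_top.ne

namespace Leaves

variable {n : ℕ} {w : Euc n → ℝ} {g : Euc n → Euc n} {α : EReal} {τ : ℝ} {T Q : Set ℝ}
  {E : ℝ → Set (Euc n)}

theorem tendsto_pow_quot (hn : 1 ≤ n) {R : ℝ → ℝ} {S : Set ℝ} {t l : ℝ}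
    (h : Tendsto (fun h => (R t - R (t + h)) / h) (𝓝[>] 0) (𝓝 l)) :
    Tendsto (fun t' => (n : ℝ)⁻¹ * ((R t ^ n - R t' ^ n) / (t' - t))) (𝓝[S ∩ Ioi t] t)
      (𝓝 (R t ^ (n - 1) * l)) := by
  have hsub : Tendsto (fun t' => t' - t) (𝓝[>] t) (𝓝[>] 0) := by
    refine tendsto_nhdsWithin_iff.2 ⟨?_, ?_⟩
    · have : Tendsto (fun t' => t' - t) (𝓝 t) (𝓝 (t - t)) :=
        (continuous_id.sub continuous_const).tendsto t
      rw [sub_self] at this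
      exact this.mono_left nhdsWithin_le_nhds
    · filter_upwards [self_mem_nhdsWithin] with t' ht'
      exact sub_pos.2 (mem_Ioi.1 ht')
  have h1 := (h.comp hsub).neg
  have hd : HasDerivWithinAt R (-l) (Ioi t) t := by
    rw [hasDerivWithinAt_iff_tendsto_slope' (notMem_Ioi.2 le_rfl)]
    refine h1.congr fun t' => ?_
    simp only [Function.comp_apply, slope_def_field, add_sub_cancel]
    rw [← neg_div, neg_sub]
  have hp := (hd.mono (inter_subset_right : S ∩ Ioi t ⊆ Ioi t)).fun_pow n
  rw [hasDerivWithinAt_iff_tendsto_slope' (fun h => lt_irrefl t h.2)] at hp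
  have h2 := (hp.neg).const_mul (n : ℝ)⁻¹
  have hn0 : (n : ℝ) ≠ 0 := by positivity
  have e : (n : ℝ)⁻¹ * -(↑n * R t ^ (n - 1) * -l) = R t ^ (n - 1) * l := by field_simp
  rw [e] at h2
  refine h2.congr fun t' => ?_
  rw [slope_def_field, ← neg_div, neg_sub]

/-- On a set of levels with mutually homothetic level sets, the volume of the superlevel sets is
differentiable almost everywhere from the right, with derivative `-lam`. -/
theorem ae_tendsto_volume (hn : 1 ≤ n) (L : Leaves w g α τ T Q E) {ρ : ℝ} (hρ : 0 < ρ)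
    (hb : Metric.closedBall (0 : Euc n) ρ ⊆ E τ) (L0 : Set (Euc n)) (a : ℝ → ℝ)
    (z : ℝ → Euc n) (S : Set ℝ) (hS : ∀ t ∈ S, t ∈ lvl α τ ∧ t ∈ T ∧ 0 < a t ∧
      E t = (-(a t)) • L0 + ({z t} : Set (Euc n)) ∧ ∀ ω, levRad Q E t ω = rad (E t) ω) :
    ∀ᵐ t : ℝ, t ∈ S → (𝓝[S ∩ Ioi t] t).NeBot ∧
      Tendsto (fun t' => ((volume (E t)).toReal - (volume (E t')).toReal) / (t' - t))
        (𝓝[S ∩ Ioi t] t) (𝓝 (lam g (E t))) := by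
  set f : ℝ → ℝ := fun t => (volume (E t)).toReal with hf
  have hmono : ∀ t ∈ S, ∀ t' ∈ S, t ≤ t' → f t' ≤ f t := fun t ht t' ht' h =>
    ENNReal.toReal_mono (L.body t (hS t ht).2.1).compact.measure_lt_top.ne
      (measure_mono (L.anti t (hS t ht).2.1 t' (hS t' ht').2.1 h))
  have hdiff : ∀ᵐ t : ℝ, t ∈ S → DifferentiableWithinAt ℝ (fun t => -f t) S t :=
    MonotoneOn.ae_differentiableWithinAt_of_mem fun t ht t' ht' h =>
      neg_le_neg (hmono t ht t' ht' h)
  have hiso : ∀ᵐ t : ℝ, t ∉ {t ∈ S | 𝓝[S ∩ Ioi t] t = ⊥} :=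
    countable_setOfPred_isolated_right_within.ae_notMem _
  filter_upwards [hdiff, hiso, L.ae_goodLevel hn hρ hb, L.ae_levRad_deriv hn] with t h1 h2 h3 h4 htS
  obtain ⟨hI, hT, ha, hE, hR⟩ := hS t htS
  refine ⟨⟨fun h => h2 ⟨htS, h⟩⟩, ?_⟩
  have G := h3 hI
  have hfp : 0 < f t := G.body.volume_pos
  obtain ⟨C, hC, hCr⟩ := homothet_rad_ge ha hE G.body hρ G.ball
  have hn0 : (0 : ℝ) < n := by exact_mod_cast hn
  -- difference quotients as integrals
  have hform : ∀ t' ∈ S, (f t - f t') / (t' - t) =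
      ∫ ω, (n : ℝ)⁻¹ * ((rad (E t) ω ^ n - rad (E t') ω ^ n) / (t' - t)) ∂sphMeas n := by
    intro t' ht'
    have hb' := L.body t' (hS t' ht').2.1
    rw [integral_const_mul, integral_div, integral_sub G.body.integrable_rad_pow
      hb'.integrable_rad_pow, G.body.integral_rad_pow hn, hb'.integral_rad_pow hn]
    field_simp
    rfl
  -- bounded slopes
  have hslope : ∃ M, 0 ≤ M ∧ ∀ᶠ t' in 𝓝[S ∩ Ioi t] t, (f t - f t') / (t' - t) ≤ M := by
    have hd := ((h1 htS).hasDerivWithinAt).mono (inter_subset_left : S ∩ Ioi t ⊆ S)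
    rw [hasDerivWithinAt_iff_tendsto_slope' (fun h => lt_irrefl t h.2)] at hd
    set l := derivWithin (fun t => -f t) S t
    refine ⟨|l| + 1, by positivity, ?_⟩
    filter_upwards [hd.eventually (gt_mem_nhds (show l < |l| + 1 by linarith [le_abs_self l]))]
      with t' ht'
    rw [slope_def_field] at ht'
    have e : -f t' - -f t = f t - f t' := by ring
    rw [e] at ht'
    exact ht'.le
  obtain ⟨M, hM0, hM⟩ := hslope
  have hmem : ∀ᶠ t' in 𝓝[S ∩ Ioi t] t, t' ∈ S ∩ Ioi t := self_mem_nhdsWithin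
  have hlim : Tendsto (fun t' => ∫ ω, (n : ℝ)⁻¹ * ((rad (E t) ω ^ n - rad (E t') ω ^ n) / (t' - t))
      ∂sphMeas n) (𝓝[S ∩ Ioi t] t) (𝓝 (lam g (E t))) := by
    refine tendsto_integral_filter_of_dominated_convergence
      (fun ω => C * (M / f t) * rad (E t) ω ^ n) ?_ ?_ (G.body.integrable_rad_pow.const_mul _) ?_
    · filter_upwards [hmem] with t' ht'
      have hb' := L.body t' (hS t' ht'.1).2.1
      exact (measurable_const.mul (((G.body.measurable_rad.pow_const n).sub
        (hb'.measurable_rad.pow_const n)).div_const _)).aestronglyMeasurable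
    · filter_upwards [hmem, hM] with t' ht' hMt'
      have htt : t < t' := ht'.2
      obtain ⟨-, hT', ha', hE', -⟩ := hS t' ht'.1
      have hb' := L.body t' hT'
      have hsub := L.anti t hT t' hT' htt.le
      have hft : f t = a t ^ n * (volume L0).toReal := by
        rw [hf]
        simp only
        rw [hE, volume_homothet _ ha, ENNReal.toReal_mul, ENNReal.toReal_ofReal (by positivity)]
      have hft' : f t' = a t' ^ n * (volume L0).toReal := by
        rw [hf]
        simp only
        rw [hE', volume_homothet _ ha', ENNReal.toReal_mul, ENNReal.toReal_ofReal (by positivity)]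
      have hV : 0 < (volume L0).toReal := by
        rw [hft] at hfp
        exact pos_of_mul_pos_right hfp (by positivity)
      have hle := hmono t htS t' ht'.1 htt.le
      have haa : a t' ≤ a t := by
        rw [hft, hft'] at hle
        exact le_of_pow_le_pow_left₀ (by omega) ha.le (le_of_mul_le_mul_right hle hV)
      have hθ : 1 - a t' / a t ≤ (f t - f t') / f t := by
        have e : (f t - f t') / f t = 1 - (a t' / a t) ^ n := by
          rw [hft, hft', div_pow]
          field_simp
        rw [e]
        have : (a t' / a t) ^ n ≤ a t' / a t :=
          pow_le_of_le_one (by positivity) ((div_le_one ha).2 haa) (by omega)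
        linarith
      refine Eventually.of_forall fun ω => ?_
      have hr := hCr (a t') (z t') ha' _ hE' hb' hsub haa ω
      have hR0 := G.body.rad_pos ω
      have hR0' := hb'.rad_pos ω
      have hRR := IsBody0.rad_mono hb' G.body hsub ω
      have hpow : rad (E t) ω ^ n - rad (E t') ω ^ n ≤
          n * (C * ((f t - f t') / f t)) * rad (E t) ω ^ n := by
        have hq0 : 0 < rad (E t') ω / rad (E t) ω := by positivity
        have hq : 1 - C * ((f t - f t') / f t) ≤ rad (E t') ω / rad (E t) ω := by
          rw [le_div_iff₀ hR0]
          refine le_trans (mul_le_mul_of_nonneg_right ?_ hR0.le) hr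
          have := mul_le_mul_of_nonneg_left hθ hC
          linarith
        have hbern := one_add_mul_le_pow (a := rad (E t') ω / rad (E t) ω - 1) (by linarith) n
        rw [add_sub_cancel, div_pow] at hbern
        have h5 : 1 - n * (C * ((f t - f t') / f t)) ≤ rad (E t') ω ^ n / rad (E t) ω ^ n := by
          refine le_trans ?_ hbern
          have := mul_le_mul_of_nonneg_left hq hn0.le
          linarith
        rw [le_div_iff₀ (by positivity)] at h5
        linarith
      have hnn : 0 ≤ rad (E t) ω ^ n - rad (E t') ω ^ n :=
        sub_nonneg.2 (pow_le_pow_left₀ hR0'.le hRR n)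
      have hh : 0 < t' - t := sub_pos.2 htt
      rw [Real.norm_eq_abs, abs_of_nonneg (by positivity)]
      have h6 : (n : ℝ)⁻¹ * ((rad (E t) ω ^ n - rad (E t') ω ^ n) / (t' - t)) ≤
          (n : ℝ)⁻¹ * ((n * (C * ((f t - f t') / f t)) * rad (E t) ω ^ n) / (t' - t)) := by gcongr
      refine h6.trans ?_
      have e : (n : ℝ)⁻¹ * ((n * (C * ((f t - f t') / f t)) * rad (E t) ω ^ n) / (t' - t)) =
          C * (((f t - f t') / (t' - t)) / f t) * rad (E t) ω ^ n := by field_simp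
      rw [e]
      gcongr
    · have h4' := h4 hI
      have hx : ∀ ω, levRad Q E t ω • (ω : Euc n) = bdPt (E t) ω := fun ω => by rw [hR, bdPt]
      filter_upwards [h4', G.pos] with ω h5 h6
      have hR0 := G.body.rad_pos ω
      have hrg : bdD g (E t) ω = -(rad (E t) ω * radG g (ω : Euc n) (rad (E t) ω)) := by
        rw [bdD, bdPt, inner_smul_right, radG]
      have hne : radG g (ω : Euc n) (rad (E t) ω) ≠ 0 := by
        intro h0
        rw [hrg, h0] at h6
        simp at h6
      have h7 := h5 (by rwa [hR])
      have h8 := tendsto_pow_quot (S := S) hn (R := fun t => levRad Q E t ω) h7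
      have e : (bdD g (E t) ω)⁻¹ * rad (E t) ω ^ n = levRad Q E t ω ^ (n - 1) *
          -(radG g (ω : Euc n) (levRad Q E t ω))⁻¹ := by
        rw [hR, hrg]
        obtain ⟨m, rfl⟩ : ∃ m, n = m + 1 := ⟨n - 1, by omega⟩
        rw [Nat.add_sub_cancel, pow_succ]
        field_simp
      rw [e]
      refine h8.congr' ?_
      filter_upwards [hmem] with t' ht'
      rw [hR, (hS t' ht'.1).2.2.2.2]
  refine hlim.congr' ?_
  filter_upwards [hmem] with t' ht' using (hform t' ht'.1).symm

end Leaves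

theorem yconj_zero {n : ℕ} (Ψ : Euc n → ℝ≥0∞) : yconj Ψ 0 = 0 := by
  simp [yconj]

namespace Leaves

variable {n : ℕ} {w : Euc n → ℝ} {g : Euc n → Euc n} {α : EReal} {τ : ℝ} {T Q : Set ℝ}
  {E : ℝ → Set (Euc n)}

theorem ae_conjLevel (hn : 1 ≤ n) (L : Leaves w g α τ T Q E) {ρ : ℝ} (hρ : 0 < ρ)
    (hb : Metric.closedBall (0 : Euc n) ρ ⊆ E τ) {Ψ : Euc n → ℝ≥0∞} (h0 : Ψ 0 = 0)
    (hm : ∀ r : ℝ, MeasurableSet {ξ | Ψ ξ ≤ ENNReal.ofReal r}) {s a : ℝ → ℝ} {z : ℝ → Euc n}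
    (hE : ∀ t ∈ T, 0 ≤ s t ∧ 0 < a t ∧
      E t = (-(a t)) • {ξ | Ψ ξ ≤ ENNReal.ofReal (s t)} + ({z t} : Set (Euc n)))
    {u : Euc n → ℝ} {gu : Euc n → Euc n} (hw : w =ᵐ[volume] u) (hg : g =ᵐ[volume] gu)
    (hsub : ∀ t ∈ T, μH[(n : ℝ) - 1] {x | u x = t ∧
      ¬ ∃ ξ, Ψ ξ = ENNReal.ofReal (s t) ∧ gu x ∈ subgrad Ψ ξ} = 0) :
    ∀ᵐ t : ℝ, t ∈ lvl α τ → ConjLevel Ψ w g ρ t (E t) (s t) (a t) (z t) := by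
  have hP : ∀ᵐ x, x ∉ E τ → ⟪g x, x⟫ ≠ 0 → w x = u x ∧ g x = gu x := by
    filter_upwards [hw, hg] with x h1 h2 _ _ using ⟨h1, h2⟩
  filter_upwards [L.ae_goodLevel hn hρ hb, L.ae_levels hn hP, L.ae_levRad_eq, L.full] with t
    h1 h2 h3 h4 hI
  have G := h1 hI
  have hT := h4 hI.1 hI.2
  obtain ⟨hs, ha, hEt⟩ := hE t hT
  refine ⟨G, h0, hs, ha, hm, hEt, ?_⟩
  have h5 := sphMeas_radial_null hn _ (hsub t hT) (fun ω => rad (E t) ω) ρ hρ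
    fun ω => G.body.le_rad hρ (Metric.ball_subset_closedBall.trans G.ball) ω
  have h2' := h2 hI
  filter_upwards [h2', h5, G.level] with ω h6 h7 h8
  rw [h3 hI.1 hI.2] at h6
  change w (bdPt (E t) ω) = u (bdPt (E t) ω) ∧ g (bdPt (E t) ω) = gu (bdPt (E t) ω) at h6
  by_contra hne
  refine h7 ⟨h6.1.symm.trans h8, fun ⟨ξ, hξ, hξ'⟩ => hne ⟨ξ, hξ, ?_⟩⟩
  rw [h6.2]
  exact hξ'

theorem lintegral_yconj (hn : 1 ≤ n) (L : Leaves w g α τ T Q E) {ρ : ℝ} (hρ : 0 < ρ)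
    (hb : Metric.closedBall (0 : Euc n) ρ ⊆ E τ) {Ψ : Euc n → ℝ≥0∞} {s a : ℝ → ℝ}
    {z : ℝ → Euc n}
    (hC : ∀ᵐ t : ℝ, t ∈ lvl α τ → ConjLevel Ψ w g ρ t (E t) (s t) (a t) (z t)) :
    ∫⁻ x in (E τ)ᶜ, yconj Ψ (g x) = ∫⁻ t in lvl α τ,
      ENNReal.ofReal ((a t)⁻¹ * (n * (volume (E t)).toReal) - s t * lam g (E t)) := by
  have hFm : Measurable fun x => yconj Ψ (g x) / ENNReal.ofReal (-⟪g x, x⟫) :=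
    ((lowerSemicontinuous_yconj Ψ).measurable.comp L.gm).div L.measurable_inner.neg.ennreal_ofReal
  have h1 := L.lintegral_levels hn _ hFm
  have hEm := L.bodyTop.compact.measurableSet
  have h2 : ∫⁻ x in (E τ)ᶜ, yconj Ψ (g x) = ∫⁻ x in (E τ)ᶜ,
      yconj Ψ (g x) / ENNReal.ofReal (-⟪g x, x⟫) * ENNReal.ofReal (-⟪g x, x⟫) := by
    refine setLIntegral_congr_fun_ae hEm.compl ?_
    filter_upwards [L.ae_norm_le hn hρ.le hb] with x hx hxE
    have h3 := hx hxE
    rcases eq_or_ne (g x) 0 with h0 | h0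
    · simp [h0, yconj_zero]
    · have : 0 < -⟪g x, x⟫ := lt_of_lt_of_le (mul_pos hρ (norm_pos_iff.2 h0)) h3
      rw [ENNReal.div_mul_cancel (ENNReal.ofReal_pos.2 this).ne' ENNReal.ofReal_ne_top]
  rw [h2, h1]
  refine setLIntegral_congr_fun_ae measurableSet_lvl ?_
  filter_upwards [hC, L.ae_levRad_eq] with t h3 h4 hI
  have C := h3 hI
  rw [← C.lintegral_yconj hn]
  refine lintegral_congr fun ω => ?_
  rw [h4 hI.1 hI.2]
  rfl

end Leaves

/-- The reflected homothetic copies of the sublevel sets of `Ψ`. -/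
def homLev {n : ℕ} (Ψ : Euc n → ℝ≥0∞) (s a : ℝ → ℝ) (z : ℝ → Euc n) (t : ℝ) : Set (Euc n) :=
  (-(a t)) • {ξ | Ψ ξ ≤ ENNReal.ofReal (s t)} + ({z t} : Set (Euc n))

/-- A function whose superlevel sets are reflected homothetic copies of sublevel sets of `Ψ`, with
gradients that are subgradients of `Ψ` on the level sets. -/
structure Side {n : ℕ} (Ψ : Euc n → ℝ≥0∞) (u : Euc n → ℝ) (gu : Euc n → Euc n) (α β : EReal)
    (T : Set ℝ) (s a : ℝ → ℝ) (z : ℝ → Euc n) : Prop where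
  weakGrad : HasWeakGradient u gu
  zero : Ψ 0 = 0
  meas : ∀ r : ℝ, MeasurableSet {ξ | Ψ ξ ≤ ENNReal.ofReal r}
  s_nonneg : ∀ t ∈ T, 0 ≤ s t
  a_pos : ∀ t ∈ T, 0 < a t
  compact : ∀ t ∈ T, IsCompact {ξ | Ψ ξ ≤ ENNReal.ofReal (s t)}
  convex : ∀ t ∈ T, Convex ℝ {ξ | Ψ ξ ≤ ENNReal.ofReal (s t)}
  interior_nonempty : ∀ t ∈ T, (interior {ξ | Ψ ξ ≤ ENNReal.ofReal (s t)}).Nonempty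
  level : ∀ t ∈ T, ∀ᵐ x, t ≤ u x ↔ x ∈ homLev Ψ s a z t
  sub : ∀ t ∈ T, μH[(n : ℝ) - 1] {x | u x = t ∧
    ¬ ∃ ξ, Ψ ξ = ENNReal.ofReal (s t) ∧ gu x ∈ subgrad Ψ ξ} = 0
  lower : ∀ᵐ x, α ≤ (u x : EReal)
  upper : ∀ᵐ x, (u x : EReal) ≤ β
  bounds : ∀ t ∈ T, α < (t : EReal) ∧ (t : EReal) < β
  full : ∀ᵐ t : ℝ, α < (t : EReal) → (t : EReal) < β → t ∈ T

theorem exists_dense_levels {α β : EReal} {T : Set ℝ}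
    (hT : ∀ᵐ t : ℝ, α < (t : EReal) → (t : EReal) < β → t ∈ T) :
    ∃ Q ⊆ T, Q.Countable ∧ ∀ x y : ℝ, α ≤ (x : EReal) → x < y → (y : EReal) ≤ β →
      ∃ q ∈ Q, x < q ∧ q < y := by
  classical
  set c : ℚ × ℚ → Set ℝ := fun p =>
    if h : (T ∩ Ioo (p.1 : ℝ) p.2).Nonempty then {h.some} else ∅ with hc
  refine ⟨⋃ p, c p, ?_, countable_iUnion fun p => ?_, fun x y hx hxy hy => ?_⟩
  · refine iUnion_subset fun p => ?_
    simp only [hc]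
    split_ifs with h
    · exact singleton_subset_iff.2 h.some_mem.1
    · exact empty_subset _
  · simp only [hc]
    split_ifs
    · exact countable_singleton _
    · exact countable_empty
  · obtain ⟨r1, h1, h1'⟩ := exists_rat_btwn hxy
    obtain ⟨r2, h2, h2'⟩ := exists_rat_btwn h1'
    have hne : (T ∩ Ioo (r1 : ℝ) r2).Nonempty := by
      by_contra hemp
      rw [not_nonempty_iff_eq_empty] at hemp
      have h0 : volume (Ioo (r1 : ℝ) r2) = 0 := by
        refine measure_mono_null ?_ (ae_iff.1 hT)
        intro t ht hh
        have h3 : t ∈ T := hh (hx.trans_lt (EReal.coe_lt_coe_iff.2 (h1.trans ht.1)))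
          ((EReal.coe_lt_coe_iff.2 (ht.2.trans h2')).trans_le hy)
        have h4 : t ∈ T ∩ Ioo (r1 : ℝ) r2 := ⟨h3, ht⟩
        rw [hemp] at h4
        exact h4
      rw [Real.volume_Ioo, ENNReal.ofReal_eq_zero] at h0
      linarith
    refine ⟨hne.some, mem_iUnion.2 ⟨(r1, r2), ?_⟩, h1.trans hne.some_mem.2.1,
      hne.some_mem.2.2.trans h2'⟩
    simp only [hc]
    rw [dif_pos hne]
    rfl

/-- A convex set with nonempty interior that is almost contained in a closed set is contained in
it. -/
theorem subset_of_ae_subset {n : ℕ} {A B : Set (Euc n)} (hA : Convex ℝ A)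
    (hAi : (interior A).Nonempty) (hB : IsClosed B) (h : ∀ᵐ x, x ∈ A → x ∈ B) : A ⊆ B := by
  have h1 : interior A ⊆ B := by
    have hopen : IsOpen (interior A \ B) := isOpen_interior.sdiff hB
    have h0 : volume (interior A \ B) = 0 := by
      refine measure_mono_null ?_ (ae_iff.1 h)
      intro x hx hh
      exact hx.2 (hh (interior_subset hx.1))
    exact sdiff_eq_empty.1 ((hopen.measure_eq_zero_iff volume).1 h0)
  calc A ⊆ closure A := subset_closure
    _ = closure (interior A) := (hA.closure_interior_eq_closure_of_nonempty_interior hAi).symm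
    _ ⊆ B := closure_minimal h1 hB

namespace Side

variable {n : ℕ} {Ψ : Euc n → ℝ≥0∞} {u : Euc n → ℝ} {gu : Euc n → Euc n} {α β : EReal}
  {T : Set ℝ} {s a : ℝ → ℝ} {z : ℝ → Euc n}

theorem homLev_compact (S : Side Ψ u gu α β T s a z) {t : ℝ} (ht : t ∈ T) :
    IsCompact (homLev Ψ s a z t) :=
  ((S.compact t ht).smul _).add isCompact_singleton

theorem homLev_convex (S : Side Ψ u gu α β T s a z) {t : ℝ} (ht : t ∈ T) :
    Convex ℝ (homLev Ψ s a z t) :=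
  ((S.convex t ht).smul _).add (convex_singleton _)

theorem homLev_interior (S : Side Ψ u gu α β T s a z) {t : ℝ} (ht : t ∈ T) :
    (interior (homLev Ψ s a z t)).Nonempty := by
  have ha : -(a t) ≠ 0 := neg_ne_zero.2 (S.a_pos t ht).ne'
  have h1 : (-(a t)) • interior {ξ | Ψ ξ ≤ ENNReal.ofReal (s t)} + ({z t} : Set (Euc n)) ⊆
      interior (homLev Ψ s a z t) := by
    refine interior_maximal (add_subset_add_right (smul_set_mono interior_subset)) ?_
    exact (isOpen_interior.smul₀ ha).add_right
  exact (((S.interior_nonempty t ht).smul_set).add (singleton_nonempty _)).mono h1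

theorem anti (S : Side Ψ u gu α β T s a z) {t t' : ℝ} (ht : t ∈ T) (ht' : t' ∈ T) (h : t ≤ t') :
    homLev Ψ s a z t' ⊆ homLev Ψ s a z t := by
  refine subset_of_ae_subset (S.homLev_convex ht') (S.homLev_interior ht')
    (S.homLev_compact ht).isClosed ?_
  filter_upwards [S.level t ht, S.level t' ht'] with x h1 h2 h3
  exact h1.1 (h.trans (h2.2 h3))

theorem translate_homLev (t : ℝ) (p : Euc n) :
    (fun x => x + p) ⁻¹' homLev Ψ s a z t =
      (-(a t)) • {ξ | Ψ ξ ≤ ENNReal.ofReal (s t)} + ({z t - p} : Set (Euc n)) := by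
  ext x
  simp only [homLev, Set.add_singleton, mem_preimage, mem_image]
  constructor
  · rintro ⟨y, hy, h⟩
    exact ⟨y, hy, by rw [← add_sub_assoc, h, add_sub_cancel_right]⟩
  · rintro ⟨y, hy, h⟩
    exact ⟨y, hy, by rw [← h]; abel⟩

theorem translate (S : Side Ψ u gu α β T s a z) (p : Euc n) :
    Side Ψ (fun x => u (x + p)) (fun x => gu (x + p)) α β T s a (fun t => z t - p) := by
  have hmp := (measurePreserving_add_right (volume : Measure (Euc n)) p).quasiMeasurePreserving
  refine ⟨S.weakGrad.comp_add p, S.zero, S.meas, S.s_nonneg, S.a_pos, S.compact, S.convex,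
    S.interior_nonempty, fun t ht => ?_, fun t ht => ?_, hmp.ae S.lower, hmp.ae S.upper,
    S.bounds, S.full⟩
  · filter_upwards [hmp.ae (S.level t ht)] with x hx
    rw [hx, ← mem_preimage (f := fun x => x + p), translate_homLev]
    rfl
  · have h := (IsometryEquiv.addRight p).hausdorffMeasure_preimage ((n : ℝ) - 1)
      {x | u x = t ∧ ¬ ∃ ξ, Ψ ξ = ENNReal.ofReal (s t) ∧ gu x ∈ subgrad Ψ ξ}
    rw [S.sub t ht] at h
    exact h

theorem exists_leaves (S : Side Ψ u gu α β T s a z) {Q : Set ℝ} (hQT : Q ⊆ T) (hQ : Q.Countable)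
    (hd : ∀ x y : ℝ, α ≤ (x : EReal) → x < y → (y : EReal) ≤ β → ∃ q ∈ Q, x < q ∧ q < y)
    {τ : ℝ} (hτ : τ ∈ Q) (h0 : (0 : Euc n) ∈ interior (homLev Ψ s a z τ)) :
    ∃ w g, w =ᵐ[volume] u ∧ g =ᵐ[volume] gu ∧
      Leaves w g α τ (T ∩ Iic τ) (Q ∩ Iic τ) (homLev Ψ s a z) := by
  have hum := S.weakGrad.1.aestronglyMeasurable
  have hgm := S.weakGrad.2.1.aestronglyMeasurable
  have hw : hum.mk u =ᵐ[volume] u := hum.ae_eq_mk.symm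
  have hg : hgm.mk gu =ᵐ[volume] gu := hgm.ae_eq_mk.symm
  refine ⟨hum.mk u, hgm.mk gu, hw, hg, ?_⟩
  have hwg : HasWeakGradient (hum.mk u) (hgm.mk gu) := by
    refine ⟨S.weakGrad.1.congr hw.symm, S.weakGrad.2.1.congr hg.symm, fun φ h1 h2 v => ?_⟩
    have e1 : ∫ x, hum.mk u x * fderiv ℝ φ x v = ∫ x, u x * fderiv ℝ φ x v :=
      integral_congr_ae (hw.mono fun x hx => by simp only [hx])
    have e2 : ∫ x, ⟪hgm.mk gu x, v⟫ * φ x = ∫ x, ⟪gu x, v⟫ * φ x :=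
      integral_congr_ae (hg.mono fun x hx => by simp only [hx])
    rw [e1, e2]
    exact S.weakGrad.2.2 φ h1 h2 v
  have hτT := hQT hτ
  have hτβ := (S.bounds τ hτT).2
  refine ⟨hwg, hum.stronglyMeasurable_mk.measurable, hgm.stronglyMeasurable_mk.measurable,
    hQ.mono inter_subset_left, ⟨hτ, mem_Iic.2 le_rfl⟩, inter_subset_inter_left _ hQT,
    fun t ht => ⟨(S.bounds t ht.1).1, ht.2⟩, ?_, ?_, fun t ht => ?_, fun t ht t' ht' h =>
    S.anti ht.1 ht'.1 h, fun t ht => ?_, ?_⟩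
  · filter_upwards [S.full] with t ht h1 h2
    exact ⟨ht h1 ((EReal.coe_lt_coe_iff.2 h2).trans hτβ), h2.le⟩
  · intro x y hx hxy hy
    obtain ⟨q, hq, h1, h2⟩ := hd x y hx hxy ((EReal.coe_le_coe_iff.2 hy).trans hτβ.le)
    exact ⟨q, ⟨hq, h2.le.trans hy⟩, h1, h2⟩
  · exact ⟨S.homLev_compact ht.1, S.homLev_convex ht.1, mem_interior_iff_mem_nhds.1
      (interior_mono (S.anti ht.1 hτT ht.2) h0)⟩
  · filter_upwards [S.level t ht.1, hw] with x h1 h2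
    rw [h2, h1]
  · filter_upwards [S.lower, hw] with x h1 h2
    rw [h2]; exact h1

end Side

namespace Side

variable {n : ℕ} {Ψ₁ Ψ₂ : Euc n → ℝ≥0∞} {u₁ u₂ : Euc n → ℝ} {g₁ g₂ : Euc n → Euc n}
  {α β : EReal} {T : Set ℝ} {s a : ℝ → ℝ} {z₁ z₂ : ℝ → Euc n}

theorem volume_homLev_eq (S₁ : Side Ψ₁ u₁ g₁ α β T s a z₁)
    (hV : ∀ r : ℝ, volume {ξ | Ψ₁ ξ ≤ ENNReal.ofReal r} = volume {ξ | Ψ₂ ξ ≤ ENNReal.ofReal r})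
    {t : ℝ} (ht : t ∈ T) : volume (homLev Ψ₁ s a z₁ t) = volume (homLev Ψ₂ s a z₂ t) := by
  rw [homLev, homLev, volume_homothet _ (S₁.a_pos t ht), volume_homothet _ (S₁.a_pos t ht), hV]

/-- The integrals of the two sides outside corresponding superlevel sets agree. -/
theorem lintegral_compl_eq_of_zero_mem (hn : 1 ≤ n) (S₁ : Side Ψ₁ u₁ g₁ α β T s a z₁)
    (S₂ : Side Ψ₂ u₂ g₂ α β T s a z₂)
    (hV : ∀ r : ℝ, volume {ξ | Ψ₁ ξ ≤ ENNReal.ofReal r} = volume {ξ | Ψ₂ ξ ≤ ENNReal.ofReal r})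
    {Q : Set ℝ} (hQT : Q ⊆ T) (hQ : Q.Countable)
    (hd : ∀ x y : ℝ, α ≤ (x : EReal) → x < y → (y : EReal) ≤ β → ∃ q ∈ Q, x < q ∧ q < y)
    {τ : ℝ} (hτ : τ ∈ Q) (h₁ : (0 : Euc n) ∈ interior (homLev Ψ₁ s a z₁ τ))
    (h₂ : (0 : Euc n) ∈ interior (homLev Ψ₂ s a z₂ τ)) :
    ∫⁻ x in (homLev Ψ₁ s a z₁ τ)ᶜ, yconj Ψ₁ (g₁ x) =
      ∫⁻ x in (homLev Ψ₂ s a z₂ τ)ᶜ, yconj Ψ₂ (g₂ x) := by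
  obtain ⟨w₁, g₁', hw₁, hg₁, L₁⟩ := S₁.exists_leaves hQT hQ hd hτ h₁
  obtain ⟨w₂, g₂', hw₂, hg₂, L₂⟩ := S₂.exists_leaves hQT hQ hd hτ h₂
  obtain ⟨ρ₁, hρ₁, hb₁⟩ := Metric.nhds_basis_closedBall.mem_iff.1 (mem_interior_iff_mem_nhds.1 h₁)
  obtain ⟨ρ₂, hρ₂, hb₂⟩ := Metric.nhds_basis_closedBall.mem_iff.1 (mem_interior_iff_mem_nhds.1 h₂)
  have C₁ := L₁.ae_conjLevel hn hρ₁ hb₁ S₁.zero S₁.meas (s := s) (a := a) (z := z₁)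
    (fun t ht => ⟨S₁.s_nonneg t ht.1, S₁.a_pos t ht.1, rfl⟩) hw₁ hg₁ fun t ht => S₁.sub t ht.1
  have C₂ := L₂.ae_conjLevel hn hρ₂ hb₂ S₂.zero S₂.meas (s := s) (a := a) (z := z₂)
    (fun t ht => ⟨S₂.s_nonneg t ht.1, S₂.a_pos t ht.1, rfl⟩) hw₂ hg₂ fun t ht => S₂.sub t ht.1
  have e₁ := L₁.lintegral_yconj hn hρ₁ hb₁ C₁
  have e₂ := L₂.lintegral_yconj hn hρ₂ hb₂ C₂
  have f₁ : ∫⁻ x in (homLev Ψ₁ s a z₁ τ)ᶜ, yconj Ψ₁ (g₁ x) =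
      ∫⁻ x in (homLev Ψ₁ s a z₁ τ)ᶜ, yconj Ψ₁ (g₁' x) :=
    lintegral_congr_ae (ae_restrict_of_ae (hg₁.mono fun x hx => by simp only [hx]))
  have f₂ : ∫⁻ x in (homLev Ψ₂ s a z₂ τ)ᶜ, yconj Ψ₂ (g₂ x) =
      ∫⁻ x in (homLev Ψ₂ s a z₂ τ)ᶜ, yconj Ψ₂ (g₂' x) :=
    lintegral_congr_ae (ae_restrict_of_ae (hg₂.mono fun x hx => by simp only [hx]))
  rw [f₁, f₂, e₁, e₂]
  set V : ℝ → ℝ := fun r => (volume {ξ | Ψ₁ ξ ≤ ENNReal.ofReal r}).toReal with hVd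
  set B : Set ℝ := {r | 0 ≤ r ∧ ∃ l₁ l₂, l₁ ≠ l₂ ∧ UpperExp V r l₁ ∧ UpperExp V r l₂} with hB
  have hBc : B.Countable := countable_upperExp V
  set P : ℝ → Set ℝ := fun c => {t | t ∈ Leaves.lvl α τ ∧ t ∈ T ∩ Iic τ ∧ s t = c ∧
    (∀ ω, levRad (Q ∩ Iic τ) (homLev Ψ₁ s a z₁) t ω = rad (homLev Ψ₁ s a z₁ t) ω) ∧
    ∀ ω, levRad (Q ∩ Iic τ) (homLev Ψ₂ s a z₂) t ω = rad (homLev Ψ₂ s a z₂ t) ω} with hP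
  have hfix : ∀ᵐ t : ℝ, ∀ c ∈ B, t ∈ P c →
      lam g₁' (homLev Ψ₁ s a z₁ t) = lam g₂' (homLev Ψ₂ s a z₂ t) := by
    refine (ae_ball_iff hBc).2 fun c _ => ?_
    filter_upwards [L₁.ae_tendsto_volume hn hρ₁ hb₁ {ξ | Ψ₁ ξ ≤ ENNReal.ofReal c} a z₁ (P c)
      (fun t ht => ⟨ht.1, ht.2.1, S₁.a_pos t ht.2.1.1, by rw [homLev, ht.2.2.1], ht.2.2.2.1⟩),
      L₂.ae_tendsto_volume hn hρ₂ hb₂ {ξ | Ψ₂ ξ ≤ ENNReal.ofReal c} a z₂ (P c)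
      (fun t ht => ⟨ht.1, ht.2.1, S₂.a_pos t ht.2.1.1, by rw [homLev, ht.2.2.1], ht.2.2.2.2⟩)]
      with t k₁ k₂ ht
    obtain ⟨hne, m₁⟩ := k₁ ht
    have m₂ := (k₂ ht).2
    refine tendsto_nhds_unique m₁ (m₂.congr' ?_)
    filter_upwards [self_mem_nhdsWithin] with t' ht'
    rw [S₁.volume_homLev_eq hV (z₂ := z₂) ht.2.1.1, S₁.volume_homLev_eq hV (z₂ := z₂) ht'.1.2.1.1]
  refine setLIntegral_congr_fun_ae Leaves.measurableSet_lvl ?_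
  filter_upwards [C₁, C₂, hfix, L₁.full, L₁.ae_levRad_eq, L₂.ae_levRad_eq] with t c₁ c₂ hf hfull
    r₁ r₂ hI
  have ht := hfull hI.1 hI.2
  have k₁ := c₁ hI
  have k₂ := c₂ hI
  have hlam : s t * lam g₁' (homLev Ψ₁ s a z₁ t) = s t * lam g₂' (homLev Ψ₂ s a z₂ t) := by
    rcases (S₁.s_nonneg t ht.1).eq_or_lt with h0 | hpos
    · rw [← h0, zero_mul, zero_mul]
    congr 1
    have x₁ := k₁.upperExp hn hpos
    have x₂ := k₂.upperExp hn hpos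
    simp only [← hV] at x₂
    by_cases hs : s t ∈ B
    · exact hf _ hs ⟨hI, ht, rfl, r₁ hI.1 hI.2, r₂ hI.1 hI.2⟩
    · by_contra hne
      have ha := S₁.a_pos t ht.1
      exact hs ⟨hpos.le, _, _, fun h => hne (mul_left_cancel₀ (by positivity) h), x₁, x₂⟩
  rw [hlam, S₁.volume_homLev_eq hV (z₂ := z₂) ht.1]

theorem lintegral_compl_eq (hn : 1 ≤ n) (S₁ : Side Ψ₁ u₁ g₁ α β T s a z₁)
    (S₂ : Side Ψ₂ u₂ g₂ α β T s a z₂)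
    (hV : ∀ r : ℝ, volume {ξ | Ψ₁ ξ ≤ ENNReal.ofReal r} = volume {ξ | Ψ₂ ξ ≤ ENNReal.ofReal r})
    {Q : Set ℝ} (hQT : Q ⊆ T) (hQ : Q.Countable)
    (hd : ∀ x y : ℝ, α ≤ (x : EReal) → x < y → (y : EReal) ≤ β → ∃ q ∈ Q, x < q ∧ q < y)
    {τ : ℝ} (hτ : τ ∈ Q) :
    ∫⁻ x in (homLev Ψ₁ s a z₁ τ)ᶜ, yconj Ψ₁ (g₁ x) =
      ∫⁻ x in (homLev Ψ₂ s a z₂ τ)ᶜ, yconj Ψ₂ (g₂ x) := by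
  obtain ⟨p₁, hp₁⟩ := S₁.homLev_interior (hQT hτ)
  obtain ⟨p₂, hp₂⟩ := S₂.homLev_interior (hQT hτ)
  have key : ∀ (Ψ : Euc n → ℝ≥0∞) (g : Euc n → Euc n) (z : ℝ → Euc n) (p : Euc n),
      ∫⁻ x in (homLev Ψ s a z τ)ᶜ, yconj Ψ (g x) =
      ∫⁻ x in (homLev Ψ s a (fun t => z t - p) τ)ᶜ, yconj Ψ (g (x + p)) := by
    intro Ψ g z p
    have h : (homLev Ψ s a (fun t => z t - p) τ)ᶜ =
        (fun x => x + p) ⁻¹' (homLev Ψ s a z τ)ᶜ := by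
      rw [preimage_compl, translate_homLev]; rfl
    rw [h]
    exact ((measurePreserving_add_right volume p).setLIntegral_comp_preimage_emb
      (measurableEmbedding_addRight p) (fun x => yconj Ψ (g x)) _).symm
  have hint : ∀ (Ψ : Euc n → ℝ≥0∞) (z : ℝ → Euc n) (p : Euc n), p ∈ interior (homLev Ψ s a z τ) →
      (0 : Euc n) ∈ interior (homLev Ψ s a (fun t => z t - p) τ) := by
    intro Ψ z p hp
    have h : homLev Ψ s a (fun t => z t - p) τ = (fun x => x + p) ⁻¹' homLev Ψ s a z τ := by
      rw [translate_homLev]; rfl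
    have hc : ContinuousAt (fun x : Euc n => x + p) 0 := by fun_prop
    rw [h, mem_interior_iff_mem_nhds]
    refine hc ?_
    show homLev Ψ s a z τ ∈ 𝓝 (0 + p)
    rw [zero_add]
    exact mem_interior_iff_mem_nhds.1 hp
  rw [key Ψ₁ g₁ z₁ p₁, key Ψ₂ g₂ z₂ p₂]
  exact lintegral_compl_eq_of_zero_mem hn (S₁.translate p₁) (S₂.translate p₂) hV hQT hQ hd hτ
    (hint _ _ _ hp₁) (hint _ _ _ hp₂)

end Side

theorem HasWeakGradient.ae_eq_zero_of_const {n : ℕ} {u : Euc n → ℝ} {g : Euc n → Euc n}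
    (h : HasWeakGradient u g) {U : Set (Euc n)} (hU : IsOpen U) {c : ℝ}
    (hc : ∀ᵐ x, x ∈ U → u x = c) : ∀ᵐ x, x ∈ U → g x = 0 := by
  refine hU.ae_eq_zero_of_integral_contDiff_smul_eq_zero (h.2.1.locallyIntegrableOn U) ?_
  intro φ hφ hφc hφU
  have hint : Integrable (fun x => φ x • g x) :=
    h.2.1.integrable_smul_left_of_hasCompactSupport hφ.continuous hφc
  refine ext_inner_left ℝ fun v => ?_
  rw [← integral_inner hint, inner_zero_right]
  have h1 : ∫ x, ⟪v, φ x • g x⟫ = ∫ x, ⟪g x, v⟫ * φ x := by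
    refine integral_congr_ae (ae_of_all _ fun x => ?_)
    simp only [real_inner_smul_right, real_inner_comm v]
    ring
  have h2 : ∫ x, u x * fderiv ℝ φ x v = ∫ x, c * fderiv ℝ φ x v := by
    refine integral_congr_ae (hc.mono fun x hx => ?_)
    by_cases hxU : x ∈ U
    · simp only [hx hxU]
    · have h3 : fderiv ℝ φ x = 0 := by
        by_contra hne
        exact hxU (hφU (support_fderiv_subset ℝ (Function.mem_support.2 hne)))
      simp [h3]
  have hcf : Continuous fun x => c * fderiv ℝ φ x v :=
    continuous_const.mul ((hφ.continuous_fderiv (by simp)).clm_apply continuous_const)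
  have h4 : ∫ x, c * fderiv ℝ φ x v = 0 := by
    have h5 := integral_mul_fderiv_eq_neg_fderiv_mul_of_integrable (μ := volume) (f := fun _ => c)
      (g := φ) (v := v) (by simp) ?_ ?_ (fun x _ => differentiableAt_const c)
      (fun x _ => hφ.differentiable (by simp) x)
    · simpa using h5
    · refine hcf.integrable_of_hasCompactSupport ?_
      refine (hφc.fderiv (𝕜 := ℝ)).mono fun x hx => ?_
      rw [Function.mem_support] at hx ⊢
      contrapose! hx
      simp [hx]
    · exact (continuous_const.mul hφ.continuous).integrable_of_hasCompactSupport hφc.mul_left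
  have h6 := h.2.2 φ hφ hφc v
  rw [h2, h4] at h6
  rw [h1]
  linarith

namespace Side

variable {n : ℕ} {Ψ : Euc n → ℝ≥0∞} {u : Euc n → ℝ} {gu : Euc n → Euc n} {α β : EReal}
  {T : Set ℝ} {s a : ℝ → ℝ} {z : ℝ → Euc n}

theorem lintegral_eq_iSup (S : Side Ψ u gu α β T s a z) {Q : Set ℝ} (hQT : Q ⊆ T)
    (hQ : Q.Countable)
    (hd : ∀ x y : ℝ, α ≤ (x : EReal) → x < y → (y : EReal) ≤ β → ∃ q ∈ Q, x < q ∧ q < y) :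
    ∫⁻ x, yconj Ψ (gu x) = ⨆ q : Q, ∫⁻ x in (homLev Ψ s a z q)ᶜ, yconj Ψ (gu x) := by
  have := hQ.to_subtype
  have hdir : Directed (fun x1 x2 => x1 ⊆ x2) fun q : Q => (homLev Ψ s a z q)ᶜ := by
    intro p q
    rcases le_total (p : ℝ) q with h | h
    · exact ⟨q, compl_subset_compl.2 (S.anti (hQT p.2) (hQT q.2) h), subset_rfl⟩
    · exact ⟨p, subset_rfl, compl_subset_compl.2 (S.anti (hQT q.2) (hQT p.2) h)⟩
  rw [← setLIntegral_iUnion_of_directed _ hdir]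
  set C : Set (Euc n) := ⋂ q : Q, homLev Ψ s a z q with hC
  have hCm : MeasurableSet C :=
    MeasurableSet.iInter fun q => (S.homLev_compact (hQT q.2)).isClosed.measurableSet
  have hCc : Convex ℝ C := convex_iInter fun q => S.homLev_convex (hQT q.2)
  have hUC : ⋃ q : Q, (homLev Ψ s a z q)ᶜ = Cᶜ := by rw [hC, compl_iInter]
  rw [hUC, ← lintegral_add_compl (fun x => yconj Ψ (gu x)) hCm]
  have hP : ∀ᵐ x, (∀ q : Q, x ∈ homLev Ψ s a z q → (q : ℝ) ≤ u x) ∧ α ≤ (u x : EReal) ∧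
      (u x : EReal) ≤ β := by
    have h1 : ∀ᵐ x, ∀ q : Q, x ∈ homLev Ψ s a z q → (q : ℝ) ≤ u x :=
      ae_all_iff.2 fun q => (S.level q (hQT q.2)).mono fun x hx => hx.2
    filter_upwards [h1, S.lower, S.upper] with x h1 h2 h3 using ⟨h1, h2, h3⟩
  have hconst : ∃ c, ∀ᵐ x, x ∈ C → u x = c := by
    have hlt : ∀ x y, (∀ q : Q, (q : ℝ) ≤ u y) → α ≤ (u y : EReal) → (u x : EReal) ≤ β →
        ¬ u y < u x := by
      intro x y hy hα hβ hlt
      obtain ⟨q, hq, h1, h2⟩ := hd _ _ hα hlt hβ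
      exact absurd (hy ⟨q, hq⟩) (not_le.2 h1)
    by_cases hex : ∃ x0 ∈ C, (∀ q : Q, x0 ∈ homLev Ψ s a z q → (q : ℝ) ≤ u x0) ∧
        α ≤ (u x0 : EReal) ∧ (u x0 : EReal) ≤ β
    · obtain ⟨x0, hx0, h1, h2, h3⟩ := hex
      refine ⟨u x0, hP.mono fun x hx hxC => ?_⟩
      rw [hC, mem_iInter] at hx0 hxC
      exact le_antisymm (not_lt.1 (hlt x x0 (fun q => h1 q (hx0 q)) h2 hx.2.2))
        (not_lt.1 (hlt x0 x (fun q => hx.1 q (hxC q)) hx.2.1 h3))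
    · exact ⟨0, hP.mono fun x hx hxC => (hex ⟨x, hxC, hx⟩).elim⟩
  obtain ⟨c, hc⟩ := hconst
  have h0 : ∀ᵐ x, x ∈ interior C → gu x = 0 :=
    S.weakGrad.ae_eq_zero_of_const isOpen_interior
      (hc.mono fun x hx hxi => hx (interior_subset hxi))
  have hfr : ∀ᵐ x, x ∉ frontier C :=
    measure_eq_zero_iff_ae_notMem.1 (hCc.addHaar_frontier volume)
  have hz : ∫⁻ x in C, yconj Ψ (gu x) = 0 := by
    rw [setLIntegral_congr_fun_ae hCm (g := fun _ => 0) ?_, lintegral_zero]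
    filter_upwards [h0, hfr] with x hx hxf hxC
    have : x ∈ interior C := by
      by_contra hni
      exact hxf ⟨subset_closure hxC, hni⟩
    rw [hx this, yconj_zero]
  rw [hz, zero_add]

/-- The energies of two functions with the same levels and scales agree when the sublevel sets of
the two Young functions have equal volumes. -/
theorem lintegral_eq {Ψ₁ Ψ₂ : Euc n → ℝ≥0∞} {u₁ u₂ : Euc n → ℝ} {g₁ g₂ : Euc n → Euc n}
    {z₁ z₂ : ℝ → Euc n} (hn : 1 ≤ n) (S₁ : Side Ψ₁ u₁ g₁ α β T s a z₁)
    (S₂ : Side Ψ₂ u₂ g₂ α β T s a z₂)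
    (hV : ∀ r : ℝ, volume {ξ | Ψ₁ ξ ≤ ENNReal.ofReal r} = volume {ξ | Ψ₂ ξ ≤ ENNReal.ofReal r}) :
    ∫⁻ x, yconj Ψ₁ (g₁ x) = ∫⁻ x, yconj Ψ₂ (g₂ x) := by
  obtain ⟨Q, hQT, hQ, hd⟩ := exists_dense_levels S₁.full
  rw [S₁.lintegral_eq_iSup hQT hQ hd, S₂.lintegral_eq_iSup hQT hQ hd]
  exact iSup_congr fun q => lintegral_compl_eq hn S₁ S₂ hV hQT hQ hd q.2

end Side

section Biconjugate

variable {n : ℕ} {Φ : Euc n → ℝ≥0∞}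

theorem convexOn_toReal (hc : ConvexOnE Φ) (hfin : ∀ x, Φ x ≠ ⊤) :
    ConvexOn ℝ univ fun x => (Φ x).toReal := by
  refine ⟨convex_univ, fun x _ y _ a b ha hb hab => ?_⟩
  have h := ENNReal.toReal_mono (by finiteness [hfin x, hfin y]) (hc x y a b ha hb hab)
  rwa [ENNReal.toReal_add (by finiteness [hfin x]) (by finiteness [hfin y]), ENNReal.toReal_mul,
    ENNReal.toReal_mul, ENNReal.toReal_ofReal ha, ENNReal.toReal_ofReal hb] at h

theorem yconj_yconj_le (Φ : Euc n → ℝ≥0∞) (x : Euc n) : yconj (yconj Φ) x ≤ Φ x := by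
  refine iSup_le fun η => tsub_le_iff_left.2 ?_
  have h : ENNReal.ofReal ⟪η, x⟫ - Φ x ≤ yconj Φ η :=
    le_iSup (fun y => ENNReal.ofReal ⟪η, y⟫ - Φ y) x
  rw [real_inner_comm]
  exact tsub_le_iff_right.1 h

theorem yconj_yconj (hc : ConvexOnE Φ) (hfin : ∀ x, Φ x ≠ ⊤) (h0 : Φ 0 = 0) :
    yconj (yconj Φ) = Φ := by
  funext x
  refine le_antisymm (yconj_yconj_le Φ x) ?_
  have hcv := convexOn_toReal hc hfin
  have hcont := hcv.continuousOn isOpen_univ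
  refine le_of_forall_lt fun r hr => ?_
  have hrtop : r ≠ ⊤ := hr.ne_top
  obtain ⟨b, hb1, hb2⟩ := exists_between ((ENNReal.toReal_lt_toReal hrtop (hfin x)).2 hr)
  obtain ⟨l, c, hl, hlx⟩ := hcv.exists_affine_le_of_lt (𝕜 := ℝ) (mem_univ x) hb2 isClosed_univ
    hcont.lowerSemicontinuousOn
  simp only [RCLike.re_to_real] at hl hlx
  set v := (InnerProductSpace.toDual ℝ (Euc n)).symm l with hv
  have hlv : ∀ y, l y = ⟪v, y⟫ := fun y => by
    rw [hv, InnerProductSpace.toDual_symm_apply]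
  have hle : ∀ y, ⟪v, y⟫ + c ≤ (Φ y).toReal := fun y => by
    have := hl ⟨y, mem_univ y⟩
    simpa [hlv] using this
  have hconj : yconj Φ v ≤ ENNReal.ofReal (-c) := by
    refine iSup_le fun y => ?_
    rw [← ENNReal.ofReal_toReal (hfin y), ← ENNReal.ofReal_sub _ ENNReal.toReal_nonneg]
    exact ENNReal.ofReal_le_ofReal (by linarith [hle y])
  have hc0 : c ≤ 0 := by
    have := hle 0
    rw [h0] at this
    simpa using this
  have hbx : b = ⟪x, v⟫ + c := by
    rw [real_inner_comm, ← hlv]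
    simpa using hlx.symm
  calc r < ENNReal.ofReal b := (ENNReal.lt_ofReal_iff_toReal_lt hrtop).2 hb1
    _ = ENNReal.ofReal ⟪x, v⟫ - ENNReal.ofReal (-c) := by
      rw [← ENNReal.ofReal_sub _ (neg_nonneg.2 hc0), sub_neg_eq_add, hbx]
    _ ≤ ENNReal.ofReal ⟪x, v⟫ - yconj Φ v := tsub_le_tsub_left hconj _
    _ ≤ yconj (yconj Φ) x := le_iSup (fun η => ENNReal.ofReal ⟪x, η⟫ - yconj Φ η) v

theorem ofReal_eq_ofReal_max_zero (r : ℝ) : ENNReal.ofReal r = ENNReal.ofReal (max r 0) := by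
  rcases le_total r 0 with h | h
  · rw [max_eq_right h, ENNReal.ofReal_zero, ENNReal.ofReal_of_nonpos h]
  · rw [max_eq_left h]

theorem yconj_le_ofReal_iff (hfin : ∀ x, Φ x ≠ ⊤) {r : ℝ} (hr : 0 ≤ r) (ξ : Euc n) :
    yconj Φ ξ ≤ ENNReal.ofReal r ↔ ∀ η, ⟪ξ, η⟫ ≤ r + (Φ η).toReal := by
  refine iSup_le_iff.trans (forall_congr' fun η => ?_)
  have h0 : 0 ≤ r + (Φ η).toReal := add_nonneg hr ENNReal.toReal_nonneg
  rw [tsub_le_iff_right, ← ENNReal.ofReal_le_ofReal_iff h0, ENNReal.ofReal_add hr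
    ENNReal.toReal_nonneg, ENNReal.ofReal_toReal (hfin η)]

theorem convex_yconj_sublevel (hfin : ∀ x, Φ x ≠ ⊤) (r : ℝ) :
    Convex ℝ {ξ | yconj Φ ξ ≤ ENNReal.ofReal r} := by
  rw [ofReal_eq_ofReal_max_zero]
  simp only [yconj_le_ofReal_iff hfin (le_max_right r 0), ofPred_forall]
  refine convex_iInter fun η => ?_
  refine convex_halfSpace_le ⟨fun x y => inner_add_left _ _ _, fun c x => ?_⟩ _
  simp [real_inner_smul_left]

theorem isCompact_yconj_sublevel (hfin : ∀ x, Φ x ≠ ⊤) (r : ℝ) :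
    IsCompact {ξ | yconj Φ ξ ≤ ENNReal.ofReal r} := by
  refine Metric.isCompact_of_isClosed_isBounded
    ((lowerSemicontinuous_yconj Φ).isClosed_preimage _) ?_
  rw [ofReal_eq_ofReal_max_zero]
  set ρ := max r 0
  have hb := fun ξ => yconj_le_ofReal_iff hfin (le_max_right r 0) ξ
  set e : Fin n → Euc n := fun i => EuclideanSpace.single i 1 with he
  refine isBounded_iff_forall_norm_le.2
    ⟨∑ i, (ρ + (Φ (e i)).toReal + (Φ (-e i)).toReal), fun ξ hξ => ?_⟩
  have h := (hb ξ).1 hξ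
  have hξs : ξ = ∑ i, ξ i • e i := by
    ext j
    simp [he, Finset.sum_apply, Pi.single_apply]
  calc ‖ξ‖ ≤ ∑ i, ‖ξ i • e i‖ := by
        conv_lhs => rw [hξs]
        exact norm_sum_le _ _
    _ ≤ _ := Finset.sum_le_sum fun i _ => ?_
  have h1 := h (e i)
  have h2 := h (-e i)
  have h3 : ⟪ξ, e i⟫ = ξ i := by simp [he, EuclideanSpace.inner_single_right]
  rw [inner_neg_right, h3] at h2
  rw [h3] at h1
  have h4 : ‖e i‖ = 1 := by simp [he]
  rw [norm_smul, h4, mul_one, Real.norm_eq_abs, abs_le]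
  have := ENNReal.toReal_nonneg (a := Φ (e i))
  have := ENNReal.toReal_nonneg (a := Φ (-e i))
  constructor <;> linarith

end Biconjugate

section ConvexBody

variable {n : ℕ} {K : Set (Euc n)}

theorem IsConvexBody.gauge_le_iff (hK : IsConvexBody K) (h0 : (0 : Euc n) ∈ interior K) {c : ℝ}
    (hc : 0 ≤ c) (x : Euc n) : gauge K x ≤ c ↔ x ∈ c • K := by
  have hK0 : K ∈ 𝓝 (0 : Euc n) := mem_interior_iff_mem_nhds.1 h0
  rcases hc.eq_or_lt with rfl | hc
  · rw [zero_smul_set ⟨0, interior_subset h0⟩, Set.mem_zero]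
    have h := gauge_pos (x := x) (absorbent_nhds_zero hK0)
      ((NormedSpace.isVonNBounded_iff ℝ).2 hK.1.isBounded)
    rw [← not_lt, h, not_not]
  · rw [mem_smul_set_iff_inv_smul_mem₀ hc.ne']
    conv_rhs => rw [← hK.1.isClosed.closure_eq, ← gauge_le_one_iff_mem_closure hK.2 hK0,
      gauge_smul_of_nonneg (inv_nonneg.2 hc.le), smul_eq_mul, inv_mul_le_iff₀ hc, mul_one]

theorem IsConvexBody.volume_pos (h0 : (0 : Euc n) ∈ interior K) : 0 < volume K :=
  Measure.measure_pos_of_mem_nhds _ (mem_interior_iff_mem_nhds.1 h0)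

theorem IsConvexBody.volume_gauge_eq (hn : 1 ≤ n) (hK : IsConvexBody K)
    (h0 : (0 : Euc n) ∈ interior K) (c : ℝ) : volume {x | gauge K x = c} = 0 := by
  have hK0 : K ∈ 𝓝 (0 : Euc n) := mem_interior_iff_mem_nhds.1 h0
  have : NeZero n := ⟨by omega⟩
  have : Nontrivial (Euc n) := inferInstance
  rcases lt_trichotomy c 0 with hc | rfl | hc
  · convert measure_empty (μ := volume)
    exact eq_empty_of_forall_notMem fun x hx => (hc.trans_le (gauge_nonneg x)).ne' hx
  · refine measure_mono_null (t := {0}) (fun x hx => ?_) (measure_singleton _)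
    have := (hK.gauge_le_iff h0 le_rfl x).1 (le_of_eq hx)
    rwa [zero_smul_set ⟨0, interior_subset h0⟩] at this
  · refine measure_mono_null (t := c • frontier K) (fun x hx => ?_) ?_
    · rw [mem_smul_set_iff_inv_smul_mem₀ hc.ne', ← gauge_eq_one_iff_mem_frontier hK.2 hK0,
        gauge_smul_of_nonneg (inv_nonneg.2 hc.le), hx, smul_eq_mul, inv_mul_cancel₀ hc.ne']
    · rw [Measure.addHaar_smul, hK.2.addHaar_frontier volume, mul_zero]

/-- The dilation factor turning `K` into a set of volume `v`. -/
def dilFactor (K : Set (Euc n)) (v : ℝ≥0∞) : ℝ := (v.toReal / (volume K).toReal) ^ ((1 : ℝ) / n)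

theorem dilFactor_nonneg (K : Set (Euc n)) (v : ℝ≥0∞) : 0 ≤ dilFactor K v :=
  Real.rpow_nonneg (div_nonneg ENNReal.toReal_nonneg ENNReal.toReal_nonneg) _

theorem dilFactor_pow (hn : 1 ≤ n) (K : Set (Euc n)) (v : ℝ≥0∞) :
    dilFactor K v ^ n = v.toReal / (volume K).toReal := by
  rw [dilFactor, one_div, Real.rpow_inv_natCast_pow
    (div_nonneg ENNReal.toReal_nonneg ENNReal.toReal_nonneg) (by omega)]

theorem IsConvexBody.volume_dilFactor_smul (hn : 1 ≤ n) (hK : IsConvexBody K)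
    (h0 : (0 : Euc n) ∈ interior K) {v : ℝ≥0∞} (hv : v ≠ ⊤) :
    volume (dilFactor K v • K) = v := by
  have hKt : volume K ≠ ⊤ := hK.1.measure_lt_top.ne
  have hKp : 0 < (volume K).toReal :=
    ENNReal.toReal_pos (IsConvexBody.volume_pos h0).ne' hKt
  rw [Measure.addHaar_smul, finrank_euclideanSpace_fin,
    abs_of_nonneg (pow_nonneg (dilFactor_nonneg K v) n), dilFactor_pow hn]
  nth_rewrite 2 [← ENNReal.ofReal_toReal hKt]
  rw [← ENNReal.ofReal_mul (by positivity), div_mul_cancel₀ _ hKp.ne', ENNReal.ofReal_toReal hv]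

theorem IsConvexBody.mul_gauge_le_iff (hn : 1 ≤ n) (hK : IsConvexBody K)
    (h0 : (0 : Euc n) ∈ interior K) {v : ℝ≥0∞} (hv : v ≠ ⊤) (x : Euc n) :
    volume K * ENNReal.ofReal (gauge K x ^ n) ≤ v ↔ gauge K x ≤ dilFactor K v := by
  have hKt : volume K ≠ ⊤ := hK.1.measure_lt_top.ne
  have hKp : 0 < (volume K).toReal :=
    ENNReal.toReal_pos (IsConvexBody.volume_pos h0).ne' hKt
  rw [← ENNReal.toReal_le_toReal (by finiteness) hv, ENNReal.toReal_mul,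
    ENNReal.toReal_ofReal (pow_nonneg (gauge_nonneg x) n),
    ← pow_le_pow_iff_left₀ (gauge_nonneg x) (dilFactor_nonneg K v) (by omega : n ≠ 0),
    dilFactor_pow hn, le_div_iff₀ hKp, mul_comm]

end ConvexBody

section YoungSymm

variable {n : ℕ} {K : Set (Euc n)} {Ψ : Euc n → ℝ≥0∞}

theorem youngSymm_zero (hn : 1 ≤ n) (K : Set (Euc n)) (Ψ : Euc n → ℝ≥0∞) :
    youngSymm K Ψ 0 = 0 := by
  refine le_antisymm (sInf_le ?_) zero_le
  simp [gauge_zero, show n ≠ 0 by omega]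

theorem youngSymm_le_ofReal_iff (hc : ∀ r : ℝ, MeasurableSet {ξ | Ψ ξ ≤ ENNReal.ofReal r})
    (hf : ∀ r : ℝ, volume {ξ | Ψ ξ ≤ ENNReal.ofReal r} ≠ ⊤) (r : ℝ) (ξ : Euc n) :
    youngSymm K Ψ ξ ≤ ENNReal.ofReal r ↔
      volume K * ENNReal.ofReal (gauge K (-ξ) ^ n) ≤ volume {η | Ψ η ≤ ENNReal.ofReal r} := by
  refine ⟨fun h => ?_, fun h => sInf_le h⟩
  rw [ofReal_eq_ofReal_max_zero r] at h ⊢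
  set ρ := max r 0 with hρ
  have hρ0 : 0 ≤ ρ := le_max_right _ _
  have hset : {η | Ψ η ≤ ENNReal.ofReal ρ} = ⋂ r' > ρ, {η | Ψ η ≤ ENNReal.ofReal r'} := by
    ext η
    simp only [mem_ofPred_eq, mem_iInter]
    refine ⟨fun h r' hr' => h.trans (ENNReal.ofReal_le_ofReal (le_of_lt hr')), fun h => ?_⟩
    refine le_of_forall_gt_imp_ge_of_dense fun b hb => ?_
    rcases eq_or_ne b ⊤ with rfl | hbt
    · exact le_top
    · rw [← ENNReal.ofReal_toReal hbt]
      exact h _ ((ENNReal.ofReal_lt_iff_lt_toReal hρ0 hbt).1 hb)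
  have hlim := tendsto_measure_biInter_gt (μ := (volume : Measure (Euc n))) (a := ρ)
    (s := fun r' => {η | Ψ η ≤ ENNReal.ofReal r'}) (fun r' _ => (hc r').nullMeasurableSet)
    (fun i j _ hij η hη => le_trans hη (ENNReal.ofReal_le_ofReal hij))
    ⟨ρ + 1, by simp, hf _⟩
  rw [← hset] at hlim
  refine ge_of_tendsto hlim ?_
  filter_upwards [self_mem_nhdsWithin] with r' hr'
  have hlt : youngSymm K Ψ ξ < ENNReal.ofReal r' :=
    h.trans_lt ((ENNReal.ofReal_lt_ofReal_iff (hρ0.trans_lt hr')).2 hr')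
  obtain ⟨t, ht, htr⟩ := sInf_lt_iff.1 hlt
  exact le_trans ht (measure_mono fun η hη => le_trans hη htr.le)

theorem youngSymm_sublevel (hn : 1 ≤ n) (hK : IsConvexBody K) (h0 : (0 : Euc n) ∈ interior K)
    (hc : ∀ r : ℝ, MeasurableSet {ξ | Ψ ξ ≤ ENNReal.ofReal r})
    (hf : ∀ r : ℝ, volume {ξ | Ψ ξ ≤ ENNReal.ofReal r} ≠ ⊤) (r : ℝ) :
    {ξ | youngSymm K Ψ ξ ≤ ENNReal.ofReal r} =
      (-dilFactor K (volume {ξ | Ψ ξ ≤ ENNReal.ofReal r})) • K := by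
  ext ξ
  rw [mem_ofPred_eq, youngSymm_le_ofReal_iff hc hf, hK.mul_gauge_le_iff hn h0 (hf r),
    hK.gauge_le_iff h0 (dilFactor_nonneg K _), neg_smul_set, Set.mem_neg]

theorem volume_youngSymm_sublevel (hn : 1 ≤ n) (hK : IsConvexBody K)
    (h0 : (0 : Euc n) ∈ interior K)
    (hc : ∀ r : ℝ, MeasurableSet {ξ | Ψ ξ ≤ ENNReal.ofReal r})
    (hf : ∀ r : ℝ, volume {ξ | Ψ ξ ≤ ENNReal.ofReal r} ≠ ⊤) (r : ℝ) :
    volume {ξ | youngSymm K Ψ ξ ≤ ENNReal.ofReal r} = volume {ξ | Ψ ξ ≤ ENNReal.ofReal r} := by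
  rw [youngSymm_sublevel hn hK h0 hc hf, neg_smul_set, Measure.measure_neg,
    hK.volume_dilFactor_smul hn h0 (hf r)]

end YoungSymm

section Rearrangement

variable {n : ℕ} {u : Euc n → ℝ}

theorem distFn_antitone (u : Euc n → ℝ) : Antitone (distFn u) :=
  fun _ _ h => measure_mono fun _ hx => lt_of_le_of_lt h hx

theorem eInf_le_ae (u : Euc n → ℝ) : ∀ᵐ x, eInf u ≤ (u x : EReal) := ae_essInf_le

theorem le_eSup_ae (u : Euc n → ℝ) : ∀ᵐ x, (u x : EReal) ≤ eSup u := ae_le_essSup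

theorem bddBelow_decRearr (hn : 1 ≤ n) (u : Euc n → ℝ) (r : ℝ) :
    BddBelow {t : ℝ | distFn u t ≤ ENNReal.ofReal r} := by
  have : NeZero n := ⟨by omega⟩
  have hmono : Monotone fun k : ℕ => {x | -(k : ℝ) < u x} := 
      fun i j hij x (hx : -(i : ℝ) < u x) =>
        (neg_le_neg (Nat.cast_le.2 hij)).trans_lt hx
  have hlim := tendsto_measure_iUnion_atTop (μ := (volume : Measure (Euc n))) hmono
  have hU : ⋃ k : ℕ, {x | -(k : ℝ) < u x} = univ := by
    refine eq_univ_of_forall fun x => mem_iUnion.2 ?_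
    obtain ⟨k, hk⟩ := exists_nat_gt (-u x)
    exact ⟨k, neg_lt.1 hk⟩
  have hvol : volume (univ : Set (Euc n)) = ⊤ := measure_univ_of_isAddLeftInvariant _
  rw [hU, hvol] at hlim
  obtain ⟨k, hk⟩ := (hlim.eventually (lt_mem_nhds (ENNReal.ofReal_lt_top (r := r)))).exists
  refine ⟨-k, fun t ht => ?_⟩
  by_contra hlt
  exact absurd (lt_of_lt_of_le hk (distFn_antitone u (not_le.1 hlt).le)) (not_lt.2 ht)

theorem nonempty_decRearr (hu : MemMd u) {r : ℝ} (hr : 0 < r) :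
    {t : ℝ | distFn u t ≤ ENNReal.ofReal r}.Nonempty := by
  obtain ⟨x, hx⟩ := (eInf_le_ae u).exists
  obtain ⟨τ, hτ, -⟩ : ∃ τ : ℝ, eInf u < τ ∧ True :=
    ⟨u x + 1, hx.trans_lt (EReal.coe_lt_coe_iff.2 (lt_add_one _)), trivial⟩
  have hanti : Antitone fun k : ℕ => {x | τ + (k : ℝ) < u x} := 
      fun i j hij x (hx : τ + (j : ℝ) < u x) =>
        (add_le_add_right (Nat.cast_le.2 hij) τ).trans_lt hx
  have hlim := tendsto_measure_iInter_atTop (μ := (volume : Measure (Euc n)))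
    (fun k => (measurableSet_lt measurable_const hu.1).nullMeasurableSet) hanti
    ⟨0, by simpa [distFn] using (hu.2 τ hτ).ne⟩
  have hI : ⋂ k : ℕ, {x | τ + (k : ℝ) < u x} = ∅ := by
    refine eq_empty_of_forall_notMem fun x hx => ?_
    obtain ⟨k, hk⟩ := exists_nat_gt (u x - τ)
    have : τ + (k : ℝ) < u x := mem_iInter.1 hx k
    linarith
  rw [hI, measure_empty] at hlim
  obtain ⟨k, hk⟩ := (hlim.eventually (gt_mem_nhds (ENNReal.ofReal_pos.2 hr))).exists
  exact ⟨τ + k, le_of_lt hk⟩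

theorem lt_distFn_of_le_decRearr (hn : 1 ≤ n) {r t τ : ℝ} (h : t ≤ decRearr u r) (hτ : τ < t) :
    ENNReal.ofReal r < distFn u τ := by
  by_contra hle
  exact notMem_of_lt_csInf (hτ.trans_le h) (bddBelow_decRearr hn u r) (not_lt.1 hle)

theorem le_decRearr (hu : MemMd u) {r t : ℝ} (hr : 0 < r)
    (h : ∀ τ < t, ENNReal.ofReal r < distFn u τ) : t ≤ decRearr u r :=
  le_csInf (nonempty_decRearr hu hr) fun b hb => by
    by_contra hlt
    exact absurd (h b (not_le.1 hlt)) (not_lt.2 hb)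

theorem le_volume_of_le_decRearr (hn : 1 ≤ n) (hu : MemMd u) {r t : ℝ} (ht : eInf u < t)
    (h : t ≤ decRearr u r) : ENNReal.ofReal r ≤ volume {x | t ≤ u x} := by
  obtain ⟨τ, hτ1, hτ2⟩ := EReal.exists_between_coe_real ht
  have hτ2' : τ < t := EReal.coe_lt_coe_iff.1 hτ2
  have hset : {x | t ≤ u x} = ⋂ k : ℕ, {x | t - (t - τ) / (k + 1) < u x} := by
    ext x
    simp only [mem_ofPred_eq, mem_iInter]
    refine ⟨fun h k => lt_of_lt_of_le (by
      have : 0 < (t - τ) / (k + 1) := div_pos (sub_pos.2 hτ2') (by positivity)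
      linarith) h, fun h => ?_⟩
    have hl : Tendsto (fun k : ℕ => t - (t - τ) * (1 / ((k : ℝ) + 1))) atTop
        (𝓝 (t - (t - τ) * 0)) :=
      tendsto_const_nhds.sub (tendsto_const_nhds.mul tendsto_one_div_add_atTop_nhds_zero_nat)
    rw [mul_zero, sub_zero] at hl
    refine le_of_tendsto hl (Eventually.of_forall fun k => ?_)
    rw [mul_one_div]
    exact (h k).le
  have hanti : Antitone fun k : ℕ => {x | t - (t - τ) / (k + 1) < u x} := 
      fun i j hij x (hx : t - (t - τ) / (j + 1) < u x) => by
    refine lt_of_le_of_lt ?_ hx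
    have : (t - τ) / (j + 1) ≤ (t - τ) / (i + 1) :=
      div_le_div_of_nonneg_left (sub_pos.2 hτ2').le (by positivity) (by gcongr)
    linarith
  have hlim := tendsto_measure_iInter_atTop (μ := (volume : Measure (Euc n)))
    (fun k => (measurableSet_lt measurable_const hu.1).nullMeasurableSet) hanti
    ⟨0, by simpa [distFn] using (hu.2 τ hτ1).ne⟩
  rw [← hset] at hlim
  refine ge_of_tendsto hlim (Eventually.of_forall fun k => ?_)
  refine (lt_distFn_of_le_decRearr hn h ?_).le
  have : 0 < (t - τ) / (k + 1) := div_pos (sub_pos.2 hτ2') (by positivity)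
  linarith

theorem le_decRearr_of_lt_volume (hu : MemMd u) {r t : ℝ} (hr : 0 < r)
    (h : ENNReal.ofReal r < volume {x | t ≤ u x}) : t ≤ decRearr u r :=
  le_decRearr hu hr fun _ hτ => h.trans_le (measure_mono fun _ hx => lt_of_lt_of_le hτ hx)

theorem decRearr_le_eSup (hn : 1 ≤ n) (u : Euc n → ℝ) (r : ℝ) :
    (decRearr u r : EReal) ≤ eSup u := by
  refine le_of_not_gt fun hlt => ?_
  obtain ⟨τ, hτ1, hτ2⟩ := EReal.exists_between_coe_real hlt
  have h0 : distFn u τ = 0 := by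
    refine measure_mono_null ?_ (ae_iff.1 (le_eSup_ae u))
    intro x hx h
    exact absurd (EReal.coe_lt_coe_iff.2 hx) (not_lt.2 (h.trans hτ1.le))
  have h1 : decRearr u r ≤ τ := csInf_le (bddBelow_decRearr hn u r) (by simp [h0])
  exact absurd (EReal.coe_lt_coe_iff.1 hτ2) (not_lt.2 h1)

theorem eInf_le_decRearr (hn : 1 ≤ n) (hu : MemMd u) {r : ℝ} (hr : 0 < r) :
    eInf u ≤ (decRearr u r : EReal) := by
  have : NeZero n := ⟨by omega⟩
  have hvol : volume (univ : Set (Euc n)) = ⊤ := measure_univ_of_isAddLeftInvariant _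
  refine le_of_not_gt fun hlt => ?_
  obtain ⟨t, ht1, ht2⟩ := EReal.exists_between_coe_real hlt
  refine absurd (EReal.coe_lt_coe_iff.1 ht1) (not_lt.2 (le_decRearr hu hr fun τ hτ => ?_))
  have h1 : distFn u τ = ⊤ := by
    rw [← hvol]
    refine measure_congr (eventuallyEq_univ.2 ?_)
    filter_upwards [eInf_le_ae u] with x hx
    exact hτ.trans (EReal.coe_lt_coe_iff.1 (ht2.trans_le hx))
  rw [h1]
  exact ENNReal.ofReal_lt_top

end Rearrangement

section Assembly

variable {n : ℕ} {K : Set (Euc n)} {u : Euc n → ℝ}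

theorem volume_superlevel_ne_top (hu : MemMd u) {t : ℝ} (ht : eInf u < t) :
    volume {x | t ≤ u x} ≠ ⊤ := by
  obtain ⟨τ, hτ1, hτ2⟩ := EReal.exists_between_coe_real ht
  exact ((measure_mono fun x hx => (EReal.coe_lt_coe_iff.1 hτ2).trans_le hx).trans_lt
    (hu.2 τ hτ1)).ne

theorem ae_gauge_pos (hn : 1 ≤ n) (hK : IsConvexBody K) (h0 : (0 : Euc n) ∈ interior K) :
    ∀ᵐ x, 0 < (volume K).toReal * gauge K x ^ n := by
  filter_upwards [measure_eq_zero_iff_ae_notMem.1 (hK.volume_gauge_eq hn h0 0)] with x hx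
  exact mul_pos (ENNReal.toReal_pos (IsConvexBody.volume_pos h0).ne' hK.1.measure_lt_top.ne)
    (pow_pos ((gauge_nonneg x).lt_of_ne' hx) n)

theorem ae_le_funcSymm_iff (hn : 1 ≤ n) (hK : IsConvexBody K) (h0 : (0 : Euc n) ∈ interior K)
    (hu : MemMd u) {t : ℝ} (ht : eInf u < t) :
    ∀ᵐ x, t ≤ funcSymm K u x ↔
      volume K * ENNReal.ofReal (gauge K x ^ n) ≤ volume {x | t ≤ u x} := by
  have hKt : volume K ≠ ⊤ := hK.1.measure_lt_top.ne
  have hW := volume_superlevel_ne_top hu ht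
  filter_upwards [ae_gauge_pos hn hK h0, measure_eq_zero_iff_ae_notMem.1
    (hK.volume_gauge_eq hn h0 (dilFactor K (volume {x | t ≤ u x})))] with x hx hne
  have hr : ENNReal.ofReal ((volume K).toReal * gauge K x ^ n) =
      volume K * ENNReal.ofReal (gauge K x ^ n) := by
    rw [ENNReal.ofReal_mul ENNReal.toReal_nonneg, ENNReal.ofReal_toReal hKt]
  rw [← hr]
  refine ⟨fun h => le_volume_of_le_decRearr hn hu ht h, fun h => ?_⟩
  refine le_decRearr_of_lt_volume hu hx (lt_of_le_of_ne h fun heq => hne ?_)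
  have h1 : gauge K x ^ n = dilFactor K (volume {x | t ≤ u x}) ^ n := by
    rw [dilFactor_pow hn, ← heq, ENNReal.toReal_ofReal hx.le, mul_div_cancel_left₀]
    exact (ENNReal.toReal_pos (IsConvexBody.volume_pos h0).ne' hKt).ne'
  exact (pow_left_inj₀ (gauge_nonneg x) (dilFactor_nonneg K _) (by omega)).1 h1

theorem Side.symm {Ψ : Euc n → ℝ≥0∞} {gu gK : Euc n → Euc n} {T : Set ℝ} {s a : ℝ → ℝ}
    {z : ℝ → Euc n} (hn : 1 ≤ n) (S : Side Ψ u gu (eInf u) (eSup u) T s a z)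
    (hK : IsConvexBody K) (h0 : (0 : Euc n) ∈ interior K) (hu : MemMd u)
    (hcpt : ∀ r : ℝ, IsCompact {ξ | Ψ ξ ≤ ENNReal.ofReal r})
    (hgK : HasWeakGradient (funcSymm K u) gK)
    (hsub : ∀ t ∈ T, μH[(n : ℝ) - 1] {x | funcSymm K u x = t ∧
      ¬ ∃ ξ, youngSymm K Ψ ξ = ENNReal.ofReal (s t) ∧ gK x ∈ subgrad (youngSymm K Ψ) ξ} = 0) :
    Side (youngSymm K Ψ) (funcSymm K u) gK (eInf u) (eSup u) T s a fun _ => 0 := by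
  have hc : ∀ r : ℝ, MeasurableSet {ξ | Ψ ξ ≤ ENNReal.ofReal r} :=
    fun r => (hcpt r).isClosed.measurableSet
  have hf : ∀ r : ℝ, volume {ξ | Ψ ξ ≤ ENNReal.ofReal r} ≠ ⊤ :=
    fun r => (hcpt r).measure_lt_top.ne
  have hlev := fun r => youngSymm_sublevel hn hK h0 hc hf r
  have hcptK : ∀ r : ℝ, IsCompact {ξ | youngSymm K Ψ ξ ≤ ENNReal.ofReal r} := fun r => by
    rw [hlev]; exact hK.1.smul _
  refine ⟨hgK, youngSymm_zero hn K Ψ, fun r => (hcptK r).isClosed.measurableSet, S.s_nonneg,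
    S.a_pos, fun t _ => hcptK _, fun t _ => ?_, fun t ht => ?_, fun t ht => ?_, hsub, ?_, ?_,
    S.bounds, S.full⟩
  · rw [hlev]; exact hK.2.smul _
  · have hVpos : 0 < volume {ξ | Ψ ξ ≤ ENNReal.ofReal (s t)} :=
      Measure.measure_pos_of_nonempty_interior _ (S.interior_nonempty t ht)
    have hd : 0 < dilFactor K (volume {ξ | Ψ ξ ≤ ENNReal.ofReal (s t)}) :=
      Real.rpow_pos_of_pos (div_pos (ENNReal.toReal_pos hVpos.ne' (hf _))
        (ENNReal.toReal_pos (IsConvexBody.volume_pos h0).ne' hK.1.measure_lt_top.ne)) _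
    rw [hlev, interior_smul₀ (neg_ne_zero.2 hd.ne')]
    exact ⟨_, smul_mem_smul_set h0⟩
  · have ha := S.a_pos t ht
    have hW : volume {x | t ≤ u x} =
        ENNReal.ofReal (a t ^ n) * volume {ξ | Ψ ξ ≤ ENNReal.ofReal (s t)} := by
      rw [← volume_homothet _ ha (z t)]
      exact measure_congr ((S.level t ht).mono fun x hx => propext hx)
    filter_upwards [ae_le_funcSymm_iff hn hK h0 hu (S.bounds t ht).1] with x hx
    rw [hx, homLev, mem_homothet ha, mem_ofPred_eq, youngSymm_le_ofReal_iff hc hf, neg_neg,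
      sub_zero, hW, gauge_smul_of_nonneg (inv_nonneg.2 ha.le), smul_eq_mul, mul_pow, inv_pow,
      ENNReal.ofReal_mul (by positivity), ENNReal.ofReal_inv_of_pos (by positivity),
      mul_left_comm, ENNReal.inv_mul_le_iff (by simpa using pow_pos ha n) ENNReal.ofReal_ne_top]
  · exact (ae_gauge_pos hn hK h0).mono fun x hx => eInf_le_decRearr hn hu hx
  · exact ae_of_all _ fun x => decRearr_le_eSup hn u _

end Assembly
/-- **Theorem (sufficient conditions for equality).** -/
theorem statement3 {n : ℕ} (hn : 1 ≤ n) (K : Set (Euc n)) (hK : IsConvexBody K)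
    (h0K : (0 : Euc n) ∈ interior K)
    (Φ : Euc n → ℝ≥0∞) (hΦ : IsNYoung Φ)
    (hΦfin : ∀ x : Euc n, x ≠ 0 → 0 < Φ x ∧ Φ x ≠ ⊤)
    (u : Euc n → ℝ) (gu : Euc n → Euc n) (hu : MemV1d Φ u gu)
    (gK : Euc n → Euc n) (hgK : HasWeakGradient (funcSymm K u) gK)
    (hyp : ∀ᵐ t : ℝ ∂volume, eInf u < (t : EReal) → (t : EReal) < eSup u →
      ∃ s : ℝ, 0 ≤ s ∧ ∃ a : ℝ, 0 < a ∧ ∃ z : Euc n,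
        (interior {ξ | yconj Φ ξ ≤ ENNReal.ofReal s}).Nonempty ∧
        volume ({x | t ≤ u x} ∆ ((-a) • {ξ | yconj Φ ξ ≤ ENNReal.ofReal s} + ({z} : Set (Euc n)))) = 0 ∧
        (∀ᵐ x ∂(μH[(n : ℝ) - 1]).restrict {x | u x = t},
          ∃ ξ : Euc n, yconj Φ ξ = ENNReal.ofReal s ∧ gu x ∈ subgrad (yconj Φ) ξ) ∧
        (∀ᵐ x ∂(μH[(n : ℝ) - 1]).restrict {x | funcSymm K u x = t},
          ∃ ξ : Euc n, youngSymm K (yconj Φ) ξ = ENNReal.ofReal s ∧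
            gK x ∈ subgrad (youngSymm K (yconj Φ)) ξ) ∧
        (0 < s →
          ∫⁻ x in {x | u x = t}, (ENNReal.ofReal ‖gu x‖)⁻¹ ∂μH[(n : ℝ) - 1] =
          ∫⁻ x in {x | funcSymm K u x = t}, (ENNReal.ofReal ‖gK x‖)⁻¹ ∂μH[(n : ℝ) - 1])) :
    ∫⁻ x, yconj (youngSymm K (yconj Φ)) (gK x) = ∫⁻ x, Φ (gu x) := by
  have hfin : ∀ x, Φ x ≠ ⊤ := fun x => by
    rcases eq_or_ne x 0 with rfl | hx
    · simp [hΦ.map_zero]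
    · exact (hΦfin x hx).2
  obtain ⟨hgu, hmd, -⟩ := hu
  have hcpt := isCompact_yconj_sublevel hfin
  let G : ℝ → ℝ × ℝ × Euc n → Prop := fun t p => 0 ≤ p.1 ∧ 0 < p.2.1 ∧
        (interior {ξ | yconj Φ ξ ≤ ENNReal.ofReal p.1}).Nonempty ∧
        (∀ᵐ x, t ≤ u x ↔
          x ∈ (-p.2.1) • {ξ | yconj Φ ξ ≤ ENNReal.ofReal p.1} + ({p.2.2} : Set (Euc n))) ∧
        μH[(n : ℝ) - 1] {x | u x = t ∧ ¬ ∃ ξ : Euc n, yconj Φ ξ = ENNReal.ofReal p.1 ∧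
          gu x ∈ subgrad (yconj Φ) ξ} = 0 ∧
        μH[(n : ℝ) - 1] {x | funcSymm K u x = t ∧ ¬ ∃ ξ : Euc n,
          youngSymm K (yconj Φ) ξ = ENNReal.ofReal p.1 ∧
            gK x ∈ subgrad (youngSymm K (yconj Φ)) ξ} = 0
  have hex : ∀ᵐ t : ℝ ∂volume, eInf u < (t : EReal) → (t : EReal) < eSup u → ∃ p, G t p := by
    have hnull : ∀ (P : Euc n → Prop) (A : Set (Euc n)),
        (∀ᵐ x ∂(μH[(n : ℝ) - 1]).restrict A, P x) →
        μH[(n : ℝ) - 1] {x | x ∈ A ∧ ¬ P x} = 0 := by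
      intro P A h
      refine le_antisymm ?_ zero_le
      have h1 := Measure.le_restrict_apply (μ := μH[(n : ℝ) - 1]) A {x | ¬ P x}
      rw [ae_iff.1 h] at h1
      refine le_trans (measure_mono fun x hx => ?_) h1
      exact ⟨hx.2, hx.1⟩
    filter_upwards [hyp] with t ht h1 h2
    obtain ⟨s, hs, a, ha, z, hi, hv, hc, hd, -⟩ := ht h1 h2
    refine ⟨(s, a, z), hs, ha, hi, ?_, hnull _ _ hc, hnull _ _ hd⟩
    filter_upwards [measure_symmDiff_eq_zero_iff.1 hv] with x hx
    exact iff_of_eq hx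
  let T : Set ℝ := {t | (eInf u < (t : EReal) ∧ (t : EReal) < eSup u) ∧ ∃ p, G t p}
  choose! p hp using fun (t : ℝ) (ht : t ∈ T) => ht.2
  have S : Side (yconj Φ) u gu (eInf u) (eSup u) T (fun t => (p t).1) (fun t => (p t).2.1)
      fun t => (p t).2.2 := by
    refine ⟨hgu, yconj_zero Φ, fun r => (hcpt r).isClosed.measurableSet, fun t ht => (hp t ht).1,
      fun t ht => (hp t ht).2.1, fun t _ => hcpt _, fun t _ => convex_yconj_sublevel hfin _,
      fun t ht => (hp t ht).2.2.1, fun t ht => (hp t ht).2.2.2.1,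
      fun t ht => (hp t ht).2.2.2.2.1, eInf_le_ae u, le_eSup_ae u, fun t ht => ht.1, ?_⟩
    exact hex.mono fun t ht h1 h2 => ⟨⟨h1, h2⟩, ht h1 h2⟩
  have SK := S.symm hn hK h0K hmd hcpt hgK fun t ht => (hp t ht).2.2.2.2.2
  rw [SK.lintegral_eq hn S fun r => volume_youngSymm_sublevel hn hK h0K
    (fun r => (hcpt r).isClosed.measurableSet) (fun r => (hcpt r).measure_lt_top.ne) r,
    yconj_yconj hΦ.convex hfin hΦ.map_zero]

end
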